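/- arXiv:1004.4917 — 9 statements merged into one kernel-verified Lean document; each statement's English description precedes it below -/
import Mathlib

section
/- Consider a compound discrete memoryless channel with states and feedback: finite alphabets 𝒳, 𝒮, 𝒴, finite index set Θ, channels W : Θ → 𝒳 → 𝒮 → PMF 𝒴, state distribution P_S : PMF 𝒮, states known non-causally at the transmitter, and past channel outputs fed back to the transmitter. Then the feedback capacity, i.e., the supremum of rates achievable with feedback codes, equals min_{θ∈Θ} sup { I(U;Y_θ) − I(U;S) }, where for each θ the supremum is over all conditional distributions P_{XU|S} : 𝒮 → PMF (𝒳 × 𝒰) with auxiliary alphabet 𝒰 = Fin (|𝒳|·|𝒮| + |Θ|), and the informations are computed from the joint pmf p_θ(u,s,x,y) = P_S(s) · P_{XU|S}(s)(x,u) · (W θ x s)(y). -/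
open scoped BigOperators

noncomputable section

namespace CompoundFeedback

variable {𝒳 𝒮 𝒴 : Type} [Fintype 𝒳] [Fintype 𝒮] [Fintype 𝒴]

/-- Mutual information `I(A;B)` of a joint (real-valued) pmf `p` on `A × B`,
with natural logarithm and the convention `0·log(·) = 0`. -/
def mutualInfo {A B : Type} [Fintype A] [Fintype B] (p : A × B → ℝ) : ℝ :=
  ∑ a : A, ∑ b : B,
    p (a, b) *
      Real.log (p (a, b) / ((∑ b' : B, p (a, b')) * (∑ a' : A, p (a', b))))

/-- Average (over i.i.d. states with pmf `PS`) error probability of message `m`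
for channel component `θ`, for a feedback `(n,M)` code: the `i`-th channel
input `φ i m y⁻ s` may depend on the message `m`, the first `i` channel
outputs `y⁻` and the whole state sequence `s`. -/
def avgErrorFB {Θ : Type} (W : Θ → 𝒳 → 𝒮 → PMF 𝒴) (PS : PMF 𝒮) {n M : ℕ}
    (φ : (i : Fin n) → Fin M → (Fin i.val → 𝒴) → (Fin n → 𝒮) → 𝒳)
    (ψ : (Fin n → 𝒴) → Fin M) (m : Fin M) (θ : Θ) : ℝ :=
  ∑ s : Fin n → 𝒮, (∏ i, (PS (s i)).toReal) *
    ∑ y : Fin n → 𝒴,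
      (∏ i, ((W θ (φ i m (fun j : Fin i.val => y ⟨j.1, lt_trans j.2 i.2⟩) s) (s i))
        (y i)).toReal) * (if ψ y ≠ m then 1 else 0)

/-- `R` is an achievable rate with feedback for the compound DMC `{W θ}` with
i.i.d. states (pmf `PS`) known non-causally at the transmitter and past
channel outputs fed back to the transmitter. -/
def IsAchievableFB {Θ : Type} (W : Θ → 𝒳 → 𝒮 → PMF 𝒴) (PS : PMF 𝒮) (R : ℝ) : Prop :=
  0 ≤ R ∧
    ∀ ε ∈ Set.Ioo (0 : ℝ) 1, ∀ γ ∈ Set.Ioo (0 : ℝ) 1, ∃ n₀ : ℕ, ∀ n ≥ n₀,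
      ∃ M : ℕ, 1 ≤ M ∧
        ∃ (φ : (i : Fin n) → Fin M → (Fin i.val → 𝒴) → (Fin n → 𝒮) → 𝒳)
          (ψ : (Fin n → 𝒴) → Fin M),
          Real.log M / n ≥ R - γ ∧ ∀ m θ, avgErrorFB W PS φ ψ m θ ≤ ε

section PartA
open Classical

lemma pi_sum_prod {ι A : Type} [Fintype ι] [DecidableEq ι] [Fintype A] (g : ι → A → ℝ) :
    ∑ c : ι → A, ∏ i, g i (c i) = ∏ i, ∑ a, g i a := by
  rw [Finset.prod_univ_sum, Fintype.piFinset_univ]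

lemma pi_sum_one {ι A : Type} [Fintype ι] [DecidableEq ι] [Fintype A] (w : A → ℝ)
    (hw : ∑ a, w a = 1) : ∑ c : ι → A, ∏ i, w (c i) = 1 := by
  rw [pi_sum_prod (fun _ => w)]; simp [hw]

lemma pi_marg2 {ι A : Type} [Fintype ι] [DecidableEq ι] [Fintype A] (w : A → ℝ)
    (hw : ∑ a, w a = 1) (f h : A → ℝ) {i0 j0 : ι} (hij : i0 ≠ j0) :
    ∑ c : ι → A, (∏ i, w (c i)) * (f (c i0) * h (c j0)) =
      (∑ a, w a * f a) * (∑ a, w a * h a) := by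
  have key := pi_sum_prod (fun (i : ι) a => w a *
    ((if i = i0 then f a else 1) * (if i = j0 then h a else 1)))
  have e1 : ∀ c : ι → A, ∏ i, (w (c i) *
      ((if i = i0 then f (c i) else 1) * (if i = j0 then h (c i) else 1))) =
      (∏ i, w (c i)) * (f (c i0) * h (c j0)) := by
    intro c
    simp only [Finset.prod_mul_distrib, Finset.prod_ite_eq', Finset.mem_univ, if_true]
  have e2 : ∀ i : ι, ∑ a, (w a *
    ((if i = i0 then f a else 1) * (if i = j0 then h a else 1))) =
    (if i = i0 then ∑ a, w a * f a else 1) * (if i = j0 then ∑ a, w a * h a else 1) := by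
    intro i
    by_cases h1 : i = i0
    · have h2 : i ≠ j0 := fun h => hij (h1 ▸ h)
      simp [h1, hij]
    · by_cases h2 : i = j0
      · simp [h2, hij.symm]
      · simp [h1, h2, hw]
  simp only [e1, e2] at key
  rw [key]
  simp only [Finset.prod_mul_distrib, Finset.prod_ite_eq', Finset.mem_univ, if_true]

lemma pi_marg1 {ι A : Type} [Fintype ι] [DecidableEq ι] [Fintype A] (w : A → ℝ)
    (hw : ∑ a, w a = 1) (f : A → ℝ) (i0 : ι) :
    ∑ c : ι → A, (∏ i, w (c i)) * f (c i0) = ∑ a, w a * f a := by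
  have key := pi_sum_prod (fun (i : ι) a => w a * (if i = i0 then f a else 1))
  have e1 : ∀ c : ι → A, ∏ i, (w (c i) * (if i = i0 then f (c i) else 1)) =
      (∏ i, w (c i)) * f (c i0) := by
    intro c
    simp only [Finset.prod_mul_distrib, Finset.prod_ite_eq', Finset.mem_univ, if_true]
  have e2 : ∀ i : ι, ∑ a, (w a * (if i = i0 then f a else 1)) =
    (if i = i0 then ∑ a, w a * f a else 1) := by
    intro i
    by_cases h1 : i = i0
    · simp [h1]
    · simp [h1, hw]
  simp only [e1, e2] at key
  rw [key]
  simp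

lemma pi_var {ι κ A : Type} [Fintype ι] [DecidableEq ι] [Fintype κ] [Fintype A] (w : A → ℝ)
    (hw : ∑ a, w a = 1) (f : A → ℝ) (hf : ∑ a, w a * f a = 0) (j : κ → ι)
    (hj : Function.Injective j) :
    ∑ c : ι → A, (∏ i, w (c i)) * (∑ k, f (c (j k))) ^ 2 =
      Fintype.card κ * ∑ a, w a * (f a) ^ 2 := by
  have e1 : ∀ c : ι → A, (∏ i, w (c i)) * (∑ k, f (c (j k))) ^ 2 =
      ∑ k, ∑ l, (∏ i, w (c i)) * (f (c (j k)) * f (c (j l))) := by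
    intro c
    rw [sq, Finset.sum_mul_sum, Finset.mul_sum]
    simp_rw [Finset.mul_sum]
  simp_rw [e1]
  rw [Finset.sum_comm]
  have e2 : ∀ k l : κ, ∑ c : ι → A, (∏ i, w (c i)) * (f (c (j k)) * f (c (j l))) =
      if k = l then ∑ a, w a * (f a) ^ 2 else 0 := by
    intro k l
    split_ifs with h
    · subst h
      rw [pi_marg1 w hw (fun a => f a * f a)]
      simp [sq]
    · rw [pi_marg2 w hw f f (fun h' => h (hj h')), hf, zero_mul]
  have e3 : ∀ k : κ, ∑ c : ι → A, ∑ l, (∏ i, w (c i)) * (f (c (j k)) * f (c (j l))) =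
      ∑ a, w a * (f a) ^ 2 := by
    intro k
    rw [Finset.sum_comm]
    simp [e2]
  simp [e3]

lemma lln {A : Type} [Fintype A] (w : A → ℝ) (hw0 : ∀ a, 0 ≤ w a) (hw : ∑ a, w a = 1)
    (f : A → ℝ) (μ : ℝ) (hμ : ∑ a, w a * f a = μ) {δ ε : ℝ} (hδ : 0 < δ) (hε : 0 < ε) :
    ∃ n₀ : ℕ, ∀ n ≥ n₀, ∑ c : Fin n → A, (∏ i, w (c i)) *
      (if n * δ ≤ |∑ i, f (c i) - n * μ| then (1:ℝ) else 0) ≤ ε := by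
  set v := ∑ a, w a * (f a - μ) ^ 2 with hv
  have hv0 : 0 ≤ v := Finset.sum_nonneg fun a _ => mul_nonneg (hw0 a) (sq_nonneg _)
  obtain ⟨n₀, hn₀⟩ := exists_nat_gt (v / (δ ^ 2 * ε))
  refine ⟨n₀ + 1, fun n hn => ?_⟩
  have hnpos : (0:ℝ) < n := by exact_mod_cast (by omega : 0 < n)
  have hnge : (n₀:ℝ) ≤ n := by exact_mod_cast (by omega : n₀ ≤ n)
  have h0 : ∑ a, w a * (f a - μ) = 0 := by
    simp_rw [mul_sub]
    rw [Finset.sum_sub_distrib, hμ, ← Finset.sum_mul, hw]; ring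
  have hvar := pi_var (ι := Fin n) w hw (fun a => f a - μ) h0 id Function.injective_id
  have hle : ∑ c : Fin n → A, (∏ i, w (c i)) *
      (if n * δ ≤ |∑ i, f (c i) - n * μ| then (1:ℝ) else 0) ≤
      ∑ c : Fin n → A, ((∏ i, w (c i)) * (∑ k, (f (c (id k)) - μ)) ^ 2) * (1 / (n * δ) ^ 2) := by
    apply Finset.sum_le_sum
    intro c _
    have hp : 0 ≤ ∏ i, w (c i) := Finset.prod_nonneg fun i _ => hw0 _
    rw [mul_assoc]
    apply mul_le_mul_of_nonneg_left _ hp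
    have e : ∑ k, (f (c (id k)) - μ) = ∑ i, f (c i) - n * μ := by
      simp [Finset.sum_sub_distrib]
    rw [e]
    split_ifs with h
    · rw [mul_one_div, le_div_iff₀ (by positivity), one_mul, ← sq_abs (∑ i, f (c i) - n * μ)]
      exact pow_le_pow_left₀ (by positivity) h 2
    · positivity
  refine hle.trans ?_
  rw [← Finset.sum_mul, hvar, ← hv, Fintype.card_fin]
  have : v < n * (δ ^ 2 * ε) := by
    have := (div_lt_iff₀ (by positivity)).1 hn₀
    nlinarith [mul_pos (pow_pos hδ 2) hε]
  rw [mul_one_div, div_le_iff₀ (by positivity)]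
  nlinarith

end PartA

section PartB
open Classical

lemma soft_cover {ι U S : Type} [Fintype ι] [DecidableEq ι] [Fintype U] [Fintype S]
    (π : U → ℝ) (hπ0 : ∀ u, 0 ≤ π u) (hπ : ∑ u, π u = 1) (VS : U → S → ℝ)
    (hVS0 : ∀ u s, 0 ≤ VS u s) (PS : S → ℝ) (hPS : ∀ s, ∑ u, π u * VS u s = PS s)
    (hPS1 : ∑ s, PS s = 1) (A : ℝ) (hA : 0 < A) (L : ℕ) (hL : 1 ≤ L) (j : Fin L → ι)
    (hj : Function.Injective j) :
    ∑ c : ι → U, (∏ i, π (c i)) * ∑ s, |PS s - (1 / L) * ∑ l, VS (c (j l)) s| ≤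
      Real.sqrt (A / L) + 2 * ∑ u, ∑ s, π u * VS u s * (if A * PS s < VS u s then 1 else 0) := by
  have hL0 : (0:ℝ) < L := by exact_mod_cast hL
  have hp : ∀ c : ι → U, 0 ≤ ∏ i, π (c i) := fun c => Finset.prod_nonneg fun i _ => hπ0 _
  have hPS0 : ∀ s, 0 ≤ PS s := fun s => by
    rw [← hPS]; exact Finset.sum_nonneg fun u _ => mul_nonneg (hπ0 u) (hVS0 u s)
  have main : ∀ s, ∑ c : ι → U, (∏ i, π (c i)) * |PS s - (1 / L) * ∑ l, VS (c (j l)) s| ≤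
      Real.sqrt (A / L) * PS s +
        2 * ∑ u, π u * VS u s * (if A * PS s < VS u s then 1 else 0) := by
    intro s
    set g : U → ℝ := fun u => VS u s * (if A * PS s < VS u s then 0 else 1) with hg
    set b : U → ℝ := fun u => VS u s * (if A * PS s < VS u s then 1 else 0) with hb
    have hg0 : ∀ u, 0 ≤ g u := fun u => mul_nonneg (hVS0 u s) (by split_ifs <;> norm_num)
    have hb0 : ∀ u, 0 ≤ b u := fun u => mul_nonneg (hVS0 u s) (by split_ifs <;> norm_num)
    have hgb : ∀ u, VS u s = g u + b u := fun u => by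
      simp only [hg, hb]; split_ifs <;> simp
    set μg := ∑ u, π u * g u with hμg
    set μb := ∑ u, π u * b u with hμb
    have hμb' : ∑ u, π u * VS u s * (if A * PS s < VS u s then 1 else 0) = μb := by
      simp only [hμb, hb, mul_assoc]
    rw [hμb']
    have hμb0 : 0 ≤ μb := Finset.sum_nonneg fun u _ => mul_nonneg (hπ0 u) (hb0 u)
    have hsum : PS s = μg + μb := by
      rw [← hPS, hμg, hμb, ← Finset.sum_add_distrib]
      exact Finset.sum_congr rfl fun u _ => by rw [hgb u]; ring
    have hpt : ∀ c : ι → U, |PS s - (1 / L) * ∑ l, VS (c (j l)) s| ≤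
        (1 / L) * |∑ l, (g (c (j l)) - μg)| + μb + (1 / L) * ∑ l, b (c (j l)) := by
      intro c
      have e : PS s - (1 / L) * ∑ l, VS (c (j l)) s =
          -((1 / L) * ∑ l, (g (c (j l)) - μg)) + μb - (1 / L) * ∑ l, b (c (j l)) := by
        simp_rw [hgb]
        rw [Finset.sum_add_distrib, Finset.sum_sub_distrib, hsum]
        simp
        field_simp
        ring
      have hbb : 0 ≤ (1 / (L:ℝ)) * ∑ l, b (c (j l)) :=
        mul_nonneg (by positivity) (Finset.sum_nonneg fun l _ => hb0 _)
      have : (1 / (L:ℝ)) * |∑ l, (g (c (j l)) - μg)| = |(1 / (L:ℝ)) * ∑ l, (g (c (j l)) - μg)| := by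
        rw [abs_mul, abs_of_pos (by positivity : (0:ℝ) < 1 / L)]
      rw [this, e]
      have h1 := abs_le.1 (le_refl |(1 / (L:ℝ)) * ∑ l, (g (c (j l)) - μg)|)
      rw [abs_le]; constructor <;> linarith [h1.1, h1.2]
    have hone : ∑ c : ι → U, ∏ i, π (c i) = 1 := pi_sum_one π hπ
    have hE : ∑ c : ι → U, (∏ i, π (c i)) * |PS s - (1 / L) * ∑ l, VS (c (j l)) s| ≤
        (1 / L) * (∑ c : ι → U, (∏ i, π (c i)) * |∑ l, (g (c (j l)) - μg)|) + μb +
          (1 / L) * ∑ l, ∑ c : ι → U, (∏ i, π (c i)) * b (c (j l)) := by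
      calc _ ≤ ∑ c : ι → U, ((1 / L) * ((∏ i, π (c i)) * |∑ l, (g (c (j l)) - μg)|) +
              (∏ i, π (c i)) * μb + (1 / L) * ∑ l, (∏ i, π (c i)) * b (c (j l))) := by
            apply Finset.sum_le_sum
            intro c _
            have := mul_le_mul_of_nonneg_left (hpt c) (hp c)
            refine this.trans (le_of_eq ?_)
            rw [← Finset.mul_sum]; ring
        _ = _ := by
            rw [Finset.sum_add_distrib, Finset.sum_add_distrib, ← Finset.mul_sum,
              ← Finset.sum_mul, hone, one_mul, ← Finset.mul_sum, Finset.sum_comm]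
    have hthird : (1 / (L:ℝ)) * ∑ l, ∑ c : ι → U, (∏ i, π (c i)) * b (c (j l)) = μb := by
      simp_rw [pi_marg1 π hπ b]
      rw [Finset.sum_const, Finset.card_univ, Fintype.card_fin, nsmul_eq_mul, ← hμb]
      field_simp
    have hfirst : (1 / (L:ℝ)) * (∑ c : ι → U, (∏ i, π (c i)) * |∑ l, (g (c (j l)) - μg)|) ≤
        Real.sqrt (A / L) * PS s := by
      set E := ∑ c : ι → U, (∏ i, π (c i)) * |∑ l, (g (c (j l)) - μg)| with hEdef
      have hcs : E ^ 2 ≤ (∑ c : ι → U, ∏ i, π (c i)) *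
          ∑ c : ι → U, (∏ i, π (c i)) * (∑ l, (g (c (j l)) - μg)) ^ 2 := by
        apply Finset.sum_sq_le_sum_mul_sum_of_sq_le_mul
        · exact fun c _ => hp c
        · exact fun c _ => mul_nonneg (hp c) (sq_nonneg _)
        · intro c _
          rw [mul_pow, sq_abs]; exact le_of_eq (by ring)
      have h0 : ∑ u, π u * (g u - μg) = 0 := by
        simp_rw [mul_sub]
        rw [Finset.sum_sub_distrib, ← Finset.sum_mul, hπ, ← hμg]; ring
      rw [hone, one_mul, pi_var π hπ (fun u => g u - μg) h0 j hj, Fintype.card_fin] at hcs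
      have hv1 : ∑ u, π u * (g u - μg) ^ 2 ≤ ∑ u, π u * (g u) ^ 2 := by
        have : ∑ u, π u * (g u - μg) ^ 2 = ∑ u, π u * (g u) ^ 2 - μg ^ 2 := by
          have : ∀ u, π u * (g u - μg) ^ 2 =
              π u * (g u) ^ 2 - 2 * μg * (π u * g u) + π u * μg ^ 2 := fun u => by ring
          simp_rw [this]
          rw [Finset.sum_add_distrib, Finset.sum_sub_distrib, ← Finset.mul_sum, ← hμg,
            ← Finset.sum_mul, hπ]; ring
        rw [this]; nlinarith [sq_nonneg μg]
      have hv2 : ∑ u, π u * (g u) ^ 2 ≤ A * PS s * PS s := by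
        calc _ ≤ ∑ u, (A * PS s) * (π u * VS u s) := by
              apply Finset.sum_le_sum
              intro u _
              have : (g u) ^ 2 ≤ A * PS s * VS u s := by
                simp only [hg]
                split_ifs with h
                · simp
                  exact mul_nonneg (mul_nonneg hA.le (hPS0 s)) (hVS0 u s)
                · rw [mul_one, sq]
                  exact mul_le_mul_of_nonneg_right (not_lt.1 h) (hVS0 u s)
              nlinarith [mul_le_mul_of_nonneg_left this (hπ0 u)]
          _ = _ := by rw [← Finset.mul_sum, hPS]
      have hfin : ((1 / (L:ℝ)) * E) ^ 2 ≤ (Real.sqrt (A / L) * PS s) ^ 2 := by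
        rw [mul_pow, mul_pow, Real.sq_sqrt (by positivity)]
        have : E ^ 2 ≤ L * (A * PS s * PS s) :=
          hcs.trans (mul_le_mul_of_nonneg_left (hv1.trans hv2) hL0.le)
        calc (1 / (L:ℝ)) ^ 2 * E ^ 2 ≤ (1 / (L:ℝ)) ^ 2 * (L * (A * PS s * PS s)) :=
              mul_le_mul_of_nonneg_left this (by positivity)
          _ = _ := by field_simp
      exact le_of_abs_le (abs_le_of_sq_le_sq hfin (mul_nonneg (Real.sqrt_nonneg _) (hPS0 s)))
    linarith
  calc _ = ∑ s, ∑ c : ι → U, (∏ i, π (c i)) * |PS s - (1 / L) * ∑ l, VS (c (j l)) s| := by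
        simp_rw [Finset.mul_sum]; rw [Finset.sum_comm]
    _ ≤ ∑ s, (Real.sqrt (A / L) * PS s +
        2 * ∑ u, π u * VS u s * (if A * PS s < VS u s then 1 else 0)) :=
        Finset.sum_le_sum fun s _ => main s
    _ = _ := by
        rw [Finset.sum_add_distrib, ← Finset.mul_sum, hPS1, mul_one, ← Finset.mul_sum,
          Finset.sum_comm]

lemma exists_le_of_avg {C : Type} [Fintype C] (p F : C → ℝ) (hp : ∀ c, 0 ≤ p c)
    (hp1 : ∑ c, p c = 1) (b : ℝ) (h : ∑ c, p c * F c ≤ b) : ∃ c, F c ≤ b := by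
  by_contra hcon
  push Not at hcon
  have h1 : ∑ c, p c * (F c - b) ≤ 0 := by
    simp_rw [mul_sub]
    rw [Finset.sum_sub_distrib, ← Finset.sum_mul, hp1]; linarith
  have h2 : ∀ c, 0 ≤ p c * (F c - b) := fun c => mul_nonneg (hp c) (by linarith [hcon c])
  have h3 := (Finset.sum_eq_zero_iff_of_nonneg (fun c _ => h2 c)).1
    (le_antisymm h1 (Finset.sum_nonneg fun c _ => h2 c))
  have h4 : ∀ c, p c = 0 := fun c => by
    have := h3 c (Finset.mem_univ c)
    rcases mul_eq_zero.1 this with h | h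
    · exact h
    · linarith [hcon c]
  simp [h4] at hp1

lemma oneshot {U S X Y : Type} [Fintype U] [Fintype S] [Fintype X] [Fintype Y] [Nonempty X]
    (π : U → ℝ) (hπ0 : ∀ u, 0 ≤ π u) (hπ : ∑ u, π u = 1)
    (V : U → S → X → ℝ) (hV0 : ∀ u s x, 0 ≤ V u s x)
    (w : X → S → Y → ℝ) (hw0 : ∀ x s y, 0 ≤ w x s y) (hw : ∀ x s, ∑ y, w x s y = 1)
    (VS : U → S → ℝ) (hVS : ∀ u s, ∑ x, V u s x = VS u s)
    (VY : U → Y → ℝ) (hVY : ∀ u y, ∑ s, ∑ x, V u s x * w x s y = VY u y)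
    (PS : S → ℝ) (hPS : ∀ s, ∑ u, π u * VS u s = PS s) (hPS1 : ∑ s, PS s = 1)
    (PY : Y → ℝ) (hPY : ∀ y, ∑ u, π u * VY u y = PY y) (hPY1 : ∑ y, PY y = 1)
    (A B : ℝ) (hA : 0 < A) (hB : 0 < B) (M L : ℕ) (hM : 1 ≤ M) (hL : 1 ≤ L) :
    ∃ (xe : Fin M → S → X) (ψ : Y → Fin M),
      ∑ m, ∑ s, PS s * ∑ y, w (xe m s) s y * (if ψ y ≠ m then 1 else 0) ≤
        M * (Real.sqrt (A / L) +
          2 * (∑ u, ∑ s, π u * VS u s * (if A * PS s < VS u s then 1 else 0)) +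
          ∑ u, ∑ y, π u * VY u y * (if VY u y < B * PY y then 1 else 0) +
          M * L / B) := by
  have hL0 : (0:ℝ) < L := by exact_mod_cast hL
  have hVS0 : ∀ u s, 0 ≤ VS u s := fun u s => by
    rw [← hVS]; exact Finset.sum_nonneg fun x _ => hV0 u s x
  have hVY0 : ∀ u y, 0 ≤ VY u y := fun u y => by
    rw [← hVY]
    exact Finset.sum_nonneg fun s _ => Finset.sum_nonneg fun x _ => mul_nonneg (hV0 u s x) (hw0 x s y)
  have hPY0 : ∀ y, 0 ≤ PY y := fun y => by
    rw [← hPY]; exact Finset.sum_nonneg fun u _ => mul_nonneg (hπ0 u) (hVY0 u y)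
  have hPS0 : ∀ y, 0 ≤ PS y := fun y => by
    rw [← hPS]; exact Finset.sum_nonneg fun u _ => mul_nonneg (hπ0 u) (hVS0 u y)
  set bG := ∑ u, ∑ s, π u * VS u s * (if A * PS s < VS u s then 1 else 0) with hbG
  set bT := ∑ u, ∑ y, π u * VY u y * (if VY u y < B * PY y then 1 else 0) with hbT
  -- decoder
  let ψ : (Fin M × Fin L → U) → Y → Fin M := fun c y =>
    if h : ∃ m, ∃ l, B * PY y ≤ VY (c (m, l)) y then h.choose else ⟨0, hM⟩
  have hψ : ∀ c y m l, (if ψ c y ≠ m then (1:ℝ) else 0) ≤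
      (if VY (c (m, l)) y < B * PY y then 1 else 0) +
      ∑ a ∈ Finset.univ.filter (fun a : Fin M × Fin L => a.1 ≠ m),
        (if B * PY y ≤ VY (c a) y then (1:ℝ) else 0) := by
    intro c y m l
    have hs0 : 0 ≤ ∑ a ∈ Finset.univ.filter (fun a : Fin M × Fin L => a.1 ≠ m),
        (if B * PY y ≤ VY (c a) y then (1:ℝ) else 0) :=
      Finset.sum_nonneg fun a _ => by split_ifs <;> norm_num
    by_cases h1 : VY (c (m, l)) y < B * PY y
    · rw [if_pos h1]
      split_ifs <;> linarith
    · rw [if_neg h1, zero_add]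
      by_cases h2 : ψ c y = m
      · simpa [h2] using hs0
      · rw [if_pos h2]
        have hex : ∃ m, ∃ l, B * PY y ≤ VY (c (m, l)) y := ⟨m, l, not_lt.1 h1⟩
        have hch : ψ c y = hex.choose := by simp only [ψ]; rw [dif_pos hex]
        obtain ⟨l', hl'⟩ := hex.choose_spec
        rw [← hch] at hl'
        have hmem : (ψ c y, l') ∈ Finset.univ.filter (fun a : Fin M × Fin L => a.1 ≠ m) := by
          simp [h2]
        have := Finset.single_le_sum (f := fun a => (if B * PY y ≤ VY (c a) y then (1:ℝ) else 0))
          (fun a _ => by positivity) hmem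
        simp only [if_pos hl'] at this
        exact this
  -- encoder
  have henc : ∀ c m s, ∃ x, ∀ x', ∑ y, w x s y * (if ψ c y ≠ m then (1:ℝ) else 0) ≤
      ∑ y, w x' s y * (if ψ c y ≠ m then (1:ℝ) else 0) := fun c m s =>
    Finite.exists_min (fun x => ∑ y, w x s y * (if ψ c y ≠ m then (1:ℝ) else 0))
  choose xe hxe using henc
  let er : (Fin M × Fin L → U) → Fin M → S → ℝ := fun c m s =>
    ∑ y, w (xe c m s) s y * (if ψ c y ≠ m then (1:ℝ) else 0)
  have her0 : ∀ c m s, 0 ≤ er c m s := fun c m s =>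
    Finset.sum_nonneg fun y _ => mul_nonneg (hw0 _ _ _) (by split_ifs <;> norm_num)
  have her1 : ∀ c m s, er c m s ≤ 1 := fun c m s => by
    rw [← hw (xe c m s) s]
    apply Finset.sum_le_sum
    intro y _
    have := hw0 (xe c m s) s y
    split_ifs <;> linarith
  have hp : ∀ c : Fin M × Fin L → U, 0 ≤ ∏ i, π (c i) := fun c => Finset.prod_nonneg fun i _ => hπ0 _
  have hone : ∑ c : Fin M × Fin L → U, ∏ i, π (c i) = 1 := pi_sum_one π hπ
  -- pointwise bound
  have hpt : ∀ c m, ∑ s, PS s * er c m s ≤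
      ∑ s, |PS s - (1 / L) * ∑ l, VS (c (m, l)) s| +
      (1 / L) * ∑ l, ∑ y, VY (c (m, l)) y * (if ψ c y ≠ m then 1 else 0) := by
    intro c m
    have h1 : ∑ s, PS s * er c m s ≤ ∑ s, |PS s - (1 / L) * ∑ l, VS (c (m, l)) s| +
        ∑ s, ((1 / L) * ∑ l, VS (c (m, l)) s) * er c m s := by
      rw [← Finset.sum_add_distrib]
      apply Finset.sum_le_sum
      intro s _
      have ha := le_abs_self (PS s - (1 / L) * ∑ l, VS (c (m, l)) s)
      have hb := abs_nonneg (PS s - (1 / L) * ∑ l, VS (c (m, l)) s)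
      nlinarith [her0 c m s, her1 c m s]
    refine h1.trans (add_le_add le_rfl ?_)
    have h2 : ∑ s, ((1 / (L:ℝ)) * ∑ l, VS (c (m, l)) s) * er c m s =
        (1 / L) * ∑ l, ∑ s, VS (c (m, l)) s * er c m s := by
      rw [Finset.sum_comm, Finset.mul_sum]
      apply Finset.sum_congr rfl
      intro s _
      rw [mul_assoc, Finset.sum_mul]
    rw [h2]
    apply mul_le_mul_of_nonneg_left _ (by positivity)
    apply Finset.sum_le_sum
    intro l _
    calc ∑ s, VS (c (m, l)) s * er c m s
        ≤ ∑ s, ∑ x, V (c (m, l)) s x * ∑ y, w x s y * (if ψ c y ≠ m then (1:ℝ) else 0) := by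
          apply Finset.sum_le_sum
          intro s _
          rw [← hVS, Finset.sum_mul]
          exact Finset.sum_le_sum fun x _ => mul_le_mul_of_nonneg_left (hxe c m s x) (hV0 _ _ _)
      _ = ∑ y, (∑ s, ∑ x, V (c (m, l)) s x * w x s y) * (if ψ c y ≠ m then 1 else 0) := by
          simp_rw [Finset.mul_sum, Finset.sum_mul]
          rw [Finset.sum_comm]
          simp_rw [← mul_assoc]
          rw [Finset.sum_comm]
          conv_lhs => enter [2, s]; rw [Finset.sum_comm]
          rw [Finset.sum_comm]
      _ = _ := by simp_rw [hVY]
  -- packing expectation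
  have hpack : ∀ m l, ∑ c : Fin M × Fin L → U, (∏ i, π (c i)) *
      ∑ y, VY (c (m, l)) y * (if ψ c y ≠ m then 1 else 0) ≤ bT + M * L / B := by
    intro m l
    have ha : ∀ c : Fin M × Fin L → U, (∏ i, π (c i)) *
        ∑ y, VY (c (m, l)) y * (if ψ c y ≠ m then 1 else 0) ≤
        ∑ y, (∏ i, π (c i)) * (VY (c (m, l)) y * (if VY (c (m, l)) y < B * PY y then 1 else 0)) +
        ∑ y, ∑ a ∈ Finset.univ.filter (fun a : Fin M × Fin L => a.1 ≠ m), (∏ i, π (c i)) *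
          (VY (c (m, l)) y * (if B * PY y ≤ VY (c a) y then (1:ℝ) else 0)) := by
      intro c
      rw [Finset.mul_sum, ← Finset.sum_add_distrib]
      apply Finset.sum_le_sum
      intro y _
      rw [← Finset.mul_sum, ← mul_add, ← Finset.mul_sum, ← mul_add]
      exact mul_le_mul_of_nonneg_left
        (mul_le_mul_of_nonneg_left (hψ c y m l) (hVY0 _ _)) (hp c)
    refine (Finset.sum_le_sum fun c _ => ha c).trans ?_
    rw [Finset.sum_add_distrib]
    apply add_le_add
    · rw [Finset.sum_comm, hbT]
      conv_rhs => rw [Finset.sum_comm]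
      apply le_of_eq
      apply Finset.sum_congr rfl
      intro y _
      rw [pi_marg1 π hπ (fun u => VY u y * (if VY u y < B * PY y then 1 else 0))]
      simp_rw [mul_assoc]
    · rw [Finset.sum_comm]
      have hb : ∀ y, ∑ c : Fin M × Fin L → U,
          ∑ a ∈ Finset.univ.filter (fun a : Fin M × Fin L => a.1 ≠ m), (∏ i, π (c i)) *
          (VY (c (m, l)) y * (if B * PY y ≤ VY (c a) y then (1:ℝ) else 0)) ≤
          (M * L) * (PY y / B) := by
        intro y
        rw [Finset.sum_comm]
        have hc : ∀ a ∈ Finset.univ.filter (fun a : Fin M × Fin L => a.1 ≠ m),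
            ∑ c : Fin M × Fin L → U, (∏ i, π (c i)) *
            (VY (c (m, l)) y * (if B * PY y ≤ VY (c a) y then (1:ℝ) else 0)) ≤ PY y / B := by
          intro a ha
          have hne : (m, l) ≠ a := by
            rintro rfl
            simp at ha
          rw [pi_marg2 π hπ (fun u => VY u y) (fun u => if B * PY y ≤ VY u y then (1:ℝ) else 0) hne,
            hPY, le_div_iff₀ hB]
          calc _ = ∑ u, π u * (B * PY y * (if B * PY y ≤ VY u y then (1:ℝ) else 0)) := by
                rw [Finset.mul_sum, Finset.sum_mul]
                exact Finset.sum_congr rfl fun u _ => by ring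
            _ ≤ ∑ u, π u * VY u y := by
                apply Finset.sum_le_sum
                intro u _
                apply mul_le_mul_of_nonneg_left _ (hπ0 u)
                split_ifs with h
                · linarith
                · simpa using hVY0 u y
            _ = _ := hPY y
        refine (Finset.sum_le_card_nsmul _ _ _ hc).trans ?_
        rw [nsmul_eq_mul]
        apply mul_le_mul_of_nonneg_right _ (div_nonneg (hPY0 y) hB.le)
        have := Finset.card_filter_le (Finset.univ : Finset (Fin M × Fin L)) (fun a => a.1 ≠ m)
        rw [Finset.card_univ, Fintype.card_prod, Fintype.card_fin, Fintype.card_fin] at this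
        exact_mod_cast this
      refine (Finset.sum_le_sum fun y _ => hb y).trans (le_of_eq ?_)
      rw [← Finset.mul_sum, ← Finset.sum_div, hPY1]; ring
  have hmean : ∑ c : Fin M × Fin L → U, (∏ i, π (c i)) * ∑ m, ∑ s, PS s * er c m s ≤
      M * (Real.sqrt (A / L) + 2 * bG + bT + M * L / B) := by
    have hm : ∀ m, ∑ c : Fin M × Fin L → U, (∏ i, π (c i)) * ∑ s, PS s * er c m s ≤
        Real.sqrt (A / L) + 2 * bG + bT + M * L / B := by
      intro m
      have h1 := soft_cover (ι := Fin M × Fin L) π hπ0 hπ VS hVS0 PS hPS hPS1 A hA L hL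
        (fun l => (m, l)) (fun l l' h => (Prod.mk.inj h).2)
      have h2 : (1 / (L:ℝ)) * ∑ l, ∑ c : Fin M × Fin L → U, (∏ i, π (c i)) *
          ∑ y, VY (c (m, l)) y * (if ψ c y ≠ m then 1 else 0) ≤ bT + M * L / B := by
        have := Finset.sum_le_card_nsmul Finset.univ _ _ (fun l (_ : l ∈ Finset.univ) => hpack m l)
        rw [nsmul_eq_mul, Finset.card_univ, Fintype.card_fin] at this
        calc _ ≤ (1 / (L:ℝ)) * (L * (bT + M * L / B)) :=
              mul_le_mul_of_nonneg_left this (by positivity)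
          _ = _ := by field_simp
      calc _ ≤ ∑ c : Fin M × Fin L → U, ((∏ i, π (c i)) *
            ∑ s, |PS s - (1 / L) * ∑ l, VS (c (m, l)) s| +
            (1 / L) * ∑ l, (∏ i, π (c i)) *
              ∑ y, VY (c (m, l)) y * (if ψ c y ≠ m then 1 else 0)) := by
            apply Finset.sum_le_sum
            intro c _
            refine (mul_le_mul_of_nonneg_left (hpt c m) (hp c)).trans (le_of_eq ?_)
            rw [← Finset.mul_sum]; ring
        _ ≤ _ := by
            rw [Finset.sum_add_distrib, ← Finset.mul_sum, Finset.sum_comm (s := Finset.univ)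
              (t := Finset.univ) (f := fun (c : Fin M × Fin L → U) (l : Fin L) => (∏ i, π (c i)) *
              ∑ y, VY (c (m, l)) y * (if ψ c y ≠ m then (1:ℝ) else 0))]
            linarith
    have := Finset.sum_le_card_nsmul Finset.univ _ _ (fun m (_ : m ∈ Finset.univ) => hm m)
    rw [nsmul_eq_mul, Finset.card_univ, Fintype.card_fin] at this
    refine le_trans (le_of_eq ?_) this
    rw [Finset.sum_comm]
    simp_rw [Finset.mul_sum]
  obtain ⟨c, hc⟩ := exists_le_of_avg _ _ hp hone _ hmean
  exact ⟨xe c, ψ c, hc⟩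

end PartB

section PartC
open Classical

lemma mutualInfo_nonneg {A B : Type} [Fintype A] [Fintype B] (p : A × B → ℝ)
    (h0 : ∀ z, 0 ≤ p z) (h1 : ∑ a, ∑ b, p (a, b) = 1) : 0 ≤ mutualInfo p := by
  have hpt : ∀ a b, p (a, b) - (∑ b' : B, p (a, b')) * (∑ a' : A, p (a', b)) ≤ p (a, b) *
      Real.log (p (a, b) / ((∑ b' : B, p (a, b')) * (∑ a' : A, p (a', b)))) := by
    intro a b
    have ha : p (a, b) ≤ ∑ b' : B, p (a, b') :=
      Finset.single_le_sum (f := fun b' => p (a, b')) (fun b' _ => h0 _) (Finset.mem_univ b)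
    have hb : p (a, b) ≤ ∑ a' : A, p (a', b) :=
      Finset.single_le_sum (f := fun a' => p (a', b)) (fun b' _ => h0 _) (Finset.mem_univ a)
    set x := ∑ b' : B, p (a, b')
    set y := ∑ a' : A, p (a', b)
    rcases (h0 (a, b)).eq_or_lt with h | h
    · rw [← h]; rw [← h] at ha hb; simp; exact mul_nonneg ha hb
    · have hx : 0 < x := by linarith
      have hy : 0 < y := by linarith
      have := Real.one_sub_inv_le_log_of_pos (div_pos h (mul_pos hx hy))
      calc _ = p (a, b) * (1 - (p (a, b) / (x * y))⁻¹) := by field_simp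
        _ ≤ _ := mul_le_mul_of_nonneg_left this h.le
  have hs : ∑ a, ∑ b, (p (a, b) - (∑ b' : B, p (a, b')) * (∑ a' : A, p (a', b))) = 0 := by
    simp_rw [Finset.sum_sub_distrib]
    rw [h1, ← Finset.sum_mul_sum, h1, Finset.sum_comm, h1]; ring
  rw [← hs]
  exact Finset.sum_le_sum fun a _ => Finset.sum_le_sum fun b _ => hpt a b

lemma expurgate {M : ℕ} (err : Fin (2 * M) → ℝ) (h0 : ∀ m, 0 ≤ err m) {δ : ℝ} (hδ : 0 < δ)
    (h : ∑ m, err m ≤ (2 * M : ℕ) * δ) :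
    ∃ j : Fin M → Fin (2 * M), Function.Injective j ∧ ∀ m, err (j m) ≤ 2 * δ := by
  set good := Finset.univ.filter (fun m => err m ≤ 2 * δ) with hgood
  set bad := Finset.univ.filter (fun m => ¬ err m ≤ 2 * δ) with hbad
  have hc : good.card + bad.card = 2 * M := by
    have := Finset.card_filter_add_card_filter_not (s := (Finset.univ : Finset (Fin (2 * M))))
      (fun m => err m ≤ 2 * δ)
    rw [Finset.card_univ, Fintype.card_fin] at this
    rw [hgood, hbad]; convert this
  have hb : (bad.card : ℝ) * (2 * δ) ≤ (2 * M : ℕ) * δ := by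
    refine le_trans ?_ h
    have h1 : (bad.card : ℝ) * (2 * δ) ≤ ∑ m ∈ bad, err m := by
      rw [← nsmul_eq_mul]
      apply Finset.card_nsmul_le_sum
      intro m hm
      simp only [hbad, Finset.mem_filter] at hm
      linarith [hm.2]
    refine h1.trans (Finset.sum_le_sum_of_subset_of_nonneg (Finset.subset_univ _) fun m _ _ => h0 m)
  have hb' : bad.card ≤ M := by
    have : (bad.card : ℝ) ≤ M := by
      push_cast at hb
      have h2 : (bad.card : ℝ) * (2 * δ) ≤ M * (2 * δ) := by linarith
      exact le_of_mul_le_mul_right h2 (by linarith)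
    exact_mod_cast this
  have hg : M ≤ good.card := by omega
  refine ⟨good.orderEmbOfCardLe hg, (good.orderEmbOfCardLe hg).injective, fun m => ?_⟩
  have := Finset.orderEmbOfCardLe_mem good hg m
  simp only [hgood, Finset.mem_filter] at this
  exact this.2

lemma sum_pair {n : ℕ} {U S : Type} [Fintype U] [Fintype S] (F : (Fin n → U) → (Fin n → S) → ℝ) :
    ∑ u : Fin n → U, ∑ s : Fin n → S, F u s =
      ∑ c : Fin n → U × S, F (fun i => (c i).1) (fun i => (c i).2) := by
  rw [← Fintype.sum_prod_type', ← (Equiv.arrowProdEquivProdArrow (Fin n) (fun _ => U) (fun _ => S)).sum_comp]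
  rfl

lemma aep {U S : Type} [Fintype U] [Fintype S] (p : U × S → ℝ) (hp0 : ∀ z, 0 ≤ p z)
    (hp1 : ∑ u, ∑ s, p (u, s) = 1) (π : U → ℝ) (hπ : ∀ u, π u = ∑ s, p (u, s))
    (PS : S → ℝ) (hPS : ∀ s, PS s = ∑ u, p (u, s))
    (K : U → S → ℝ) (hK : ∀ u s, K u s = p (u, s) / π u)
    {δ ε : ℝ} (hδ : 0 < δ) (hε : 0 < ε) :
    ∃ n₀ : ℕ, ∀ n ≥ n₀,
      (∑ u : Fin n → U, ∑ s : Fin n → S, (∏ i, π (u i)) * (∏ i, K (u i) (s i)) *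
        (if Real.exp (n * (mutualInfo p + δ)) * (∏ i, PS (s i)) < ∏ i, K (u i) (s i)
          then (1:ℝ) else 0) ≤ ε) ∧
      (∑ u : Fin n → U, ∑ s : Fin n → S, (∏ i, π (u i)) * (∏ i, K (u i) (s i)) *
        (if ∏ i, K (u i) (s i) < Real.exp (n * (mutualInfo p - δ)) * (∏ i, PS (s i))
          then (1:ℝ) else 0) ≤ ε) := by
  have hpπ : ∀ u s, p (u, s) ≤ π u := fun u s => by
    rw [hπ]
    exact Finset.single_le_sum (f := fun b' => p (u, b')) (fun b' _ => hp0 _) (Finset.mem_univ s)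
  have hpS : ∀ u s, p (u, s) ≤ PS s := fun u s => by
    rw [hPS]
    exact Finset.single_le_sum (f := fun b' => p (b', s)) (fun b' _ => hp0 _) (Finset.mem_univ u)
  have hprod : ∀ u s, π u * K u s = p (u, s) := fun u s => by
    rw [hK]
    by_cases h : π u = 0
    · have := hpπ u s
      rw [h] at this
      rw [h, le_antisymm this (hp0 _)]; simp
    · field_simp
  obtain ⟨n₀, hn₀⟩ := lln p hp0 (by rw [Fintype.sum_prod_type]; exact hp1)
    (fun z => Real.log (p z / (π z.1 * PS z.2))) (mutualInfo p)
    (by rw [Fintype.sum_prod_type]; simp only [mutualInfo, hπ, hPS]) hδ hε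
  refine ⟨n₀, fun n hn => ?_⟩
  have key : ∀ (P : (Fin n → U) → (Fin n → S) → Prop),
      (∀ u s, (∀ i, 0 < K (u i) (s i)) → (∀ i, 0 < PS (s i)) → P u s →
        n * δ ≤ |∑ i, (Real.log (K (u i) (s i)) - Real.log (PS (s i))) - n * mutualInfo p|) →
      ∑ u : Fin n → U, ∑ s : Fin n → S, (∏ i, π (u i)) * (∏ i, K (u i) (s i)) *
        (if P u s then (1:ℝ) else 0) ≤ ε := by
    intro P hP
    rw [sum_pair (fun u s => (∏ i, π (u i)) * (∏ i, K (u i) (s i)) * (if P u s then (1:ℝ) else 0))]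
    refine le_trans ?_ (hn₀ n hn)
    apply Finset.sum_le_sum
    intro c _
    rw [← Finset.prod_mul_distrib]
    simp only [hprod]
    have hnn : 0 ≤ ∏ i, p (c i) := Finset.prod_nonneg fun i _ => hp0 _
    rcases hnn.eq_or_lt with h | h
    · simp only [Prod.mk.eta]; rw [← h]; simp
    · apply mul_le_mul_of_nonneg_left _ hnn
      have hpos : ∀ i, 0 < p (c i) := fun i => (hp0 _).lt_of_ne' fun h' =>
        h.ne' (Finset.prod_eq_zero (Finset.mem_univ i) h')
      have hπp : ∀ i, 0 < π (c i).1 := fun i => (hpos i).trans_le (hpπ _ _)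
      have hSp : ∀ i, 0 < PS (c i).2 := fun i => (hpos i).trans_le (hpS _ _)
      have hKp : ∀ i, 0 < K (c i).1 (c i).2 := fun i => by
        rw [hK]; exact div_pos (hpos i) (hπp i)
      by_cases hPP : P (fun i => (c i).1) (fun i => (c i).2)
      · have := hP _ _ hKp hSp hPP
        have e : ∑ i, Real.log (p (c i) / (π (c i).1 * PS (c i).2)) =
            ∑ i, (Real.log (K (c i).1 (c i).2) - Real.log (PS (c i).2)) := by
          apply Finset.sum_congr rfl
          intro i _
          rw [← Real.log_div (hKp i).ne' (hSp i).ne', hK, div_div]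
        rw [e, if_pos hPP, if_pos this]
      · rw [if_neg hPP]; split_ifs <;> norm_num
  constructor
  · apply key
    intro u s hKp hSp hlt
    have h1 := Real.log_lt_log (mul_pos (Real.exp_pos _) (Finset.prod_pos fun i _ => hSp i)) hlt
    rw [Real.log_mul (Real.exp_pos _).ne' (Finset.prod_pos fun i _ => hSp i).ne', Real.log_exp,
      Real.log_prod (fun i _ => (hSp i).ne'), Real.log_prod (fun i _ => (hKp i).ne')] at h1
    rw [Finset.sum_sub_distrib]
    refine le_trans ?_ (le_abs_self _)
    linarith
  · apply key
    intro u s hKp hSp hlt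
    have h1 := Real.log_lt_log (Finset.prod_pos fun i _ => hKp i) hlt
    rw [Real.log_mul (Real.exp_pos _).ne' (Finset.prod_pos fun i _ => hSp i).ne', Real.log_exp,
      Real.log_prod (fun i _ => (hSp i).ne'), Real.log_prod (fun i _ => (hKp i).ne')] at h1
    rw [Finset.sum_sub_distrib]
    refine le_trans ?_ (neg_abs_le _ |> neg_le.1)
    linarith

lemma gp_code {U S X Y : Type} [Fintype U] [Fintype S] [Fintype X] [Fintype Y] [Nonempty X]
    (ps : S → ℝ) (hps1 : ∑ s, ps s = 1)
    (w : X → S → Y → ℝ) (hw0 : ∀ x s y, 0 ≤ w x s y) (hw : ∀ x s, ∑ y, w x s y = 1)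
    (q : U → S → X → ℝ) (hq0 : ∀ u s x, 0 ≤ q u s x) (hq : ∀ s, ∑ u, ∑ x, q u s x = ps s)
    (r ε : ℝ) (hr : r < mutualInfo (fun z : U × Y => ∑ s, ∑ x, q z.1 s x * w x s z.2) -
      mutualInfo (fun z : U × S => ∑ x, q z.1 z.2 x)) (hε : 0 < ε) :
    ∃ n₀ : ℕ, ∀ n ≥ n₀, ∀ M : ℕ, 1 ≤ M → (M : ℝ) ≤ Real.exp (n * r) →
      ∃ (xe : Fin M → (Fin n → S) → (Fin n → X)) (ψ : (Fin n → Y) → Fin M), ∀ m,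
        ∑ s : Fin n → S, (∏ i, ps (s i)) * ∑ y : Fin n → Y,
          (∏ i, w (xe m s i) (s i) (y i)) * (if ψ y ≠ m then 1 else 0) ≤ ε := by
  set qUY : U × Y → ℝ := fun z => ∑ s, ∑ x, q z.1 s x * w x s z.2 with hqUY
  set qUS : U × S → ℝ := fun z => ∑ x, q z.1 z.2 x with hqUS
  set I1 := mutualInfo qUY with hI1
  set I2 := mutualInfo qUS with hI2
  set π : U → ℝ := fun u => ∑ s, ∑ x, q u s x with hπdef
  have hqUY0 : ∀ z, 0 ≤ qUY z := fun z => Finset.sum_nonneg fun s _ =>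
    Finset.sum_nonneg fun x _ => mul_nonneg (hq0 _ _ _) (hw0 _ _ _)
  have hqUS0 : ∀ z, 0 ≤ qUS z := fun z => Finset.sum_nonneg fun x _ => hq0 _ _ _
  have hπ0 : ∀ u, 0 ≤ π u := fun u => Finset.sum_nonneg fun s _ =>
    Finset.sum_nonneg fun x _ => hq0 _ _ _
  have hπ1 : ∑ u, π u = 1 := by
    simp only [hπdef]; rw [Finset.sum_comm]; simp_rw [hq]; exact hps1
  have hπS : ∀ u, π u = ∑ s, qUS (u, s) := fun u => rfl
  have hπY : ∀ u, π u = ∑ y, qUY (u, y) := fun u => by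
    simp only [hqUY, hπdef]
    conv_rhs => rw [Finset.sum_comm]
    apply Finset.sum_congr rfl
    intro s _
    conv_rhs => rw [Finset.sum_comm]
    apply Finset.sum_congr rfl
    intro x _
    rw [← Finset.mul_sum, hw, mul_one]
  have hS1 : ∑ u, ∑ s, qUS (u, s) = 1 := by simp_rw [← hπS]; exact hπ1
  have hY1 : ∑ u, ∑ s, qUY (u, s) = 1 := by simp_rw [← hπY]; exact hπ1
  set PY : Y → ℝ := fun y => ∑ u, qUY (u, y) with hPY
  have hPY1 : ∑ y, PY y = 1 := by simp only [hPY]; rw [Finset.sum_comm]; exact hY1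
  have hqz : ∀ u, π u = 0 → ∀ s x, q u s x = 0 := by
    intro u hu s x
    have h1 := (Finset.sum_eq_zero_iff_of_nonneg (fun s _ =>
      Finset.sum_nonneg fun x _ => hq0 u s x)).1 hu s (Finset.mem_univ s)
    exact (Finset.sum_eq_zero_iff_of_nonneg (fun x _ => hq0 u s x)).1 h1 x (Finset.mem_univ x)
  set V : U → S → X → ℝ := fun u s x => q u s x / π u with hV
  set VS : U → S → ℝ := fun u s => qUS (u, s) / π u with hVS
  set VY : U → Y → ℝ := fun u y => qUY (u, y) / π u with hVY
  have hπV : ∀ u t, (π u = 0 → t = 0) → π u * (t / π u) = t := by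
    intro u t h
    by_cases h' : π u = 0
    · simp [h', h h']
    · field_simp
  have hVSm : ∀ s, ∑ u, π u * VS u s = ps s := by
    intro s
    rw [← hq]
    apply Finset.sum_congr rfl
    intro u _
    simp only [hVS]
    exact hπV u _ fun h => Finset.sum_eq_zero fun x _ => hqz u h _ _
  have hVYm : ∀ y, ∑ u, π u * VY u y = PY y := by
    intro s
    apply Finset.sum_congr rfl
    intro u _
    simp only [hVY]
    exact hπV u _ fun h => Finset.sum_eq_zero fun s _ => Finset.sum_eq_zero fun x _ => by
      simp [hqz u h]
  have hVs : ∀ u s, ∑ x, V u s x = VS u s := fun u s => by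
    simp only [hV, hVS, hqUS]; rw [Finset.sum_div]
  have hVy : ∀ u y, ∑ s, ∑ x, V u s x * w x s y = VY u y := fun u y => by
    simp only [hV, hVY, hqUY]
    simp_rw [Finset.sum_div, div_mul_eq_mul_div]
  have hI2n : 0 ≤ I2 := mutualInfo_nonneg qUS hqUS0 hS1
  set δ := (I1 - I2 - r) / 4 with hδ
  have hδ0 : 0 < δ := by rw [hδ]; linarith
  obtain ⟨n1, hn1⟩ := aep qUS hqUS0 hS1 π hπS ps (fun s => (hq s).symm) VS (fun _ _ => rfl) hδ0
    (by positivity : 0 < ε / 20)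
  obtain ⟨n2, hn2⟩ := aep qUY hqUY0 hY1 π hπY PY (fun s => rfl) VY (fun _ _ => rfl) hδ0
    (by positivity : 0 < ε / 10)
  have htend : Filter.Tendsto (fun n : ℕ => Real.exp (-(n * δ))) Filter.atTop (nhds 0) := by
    apply Real.tendsto_exp_neg_atTop_nhds_zero.comp
    exact Filter.Tendsto.atTop_mul_const hδ0 tendsto_natCast_atTop_atTop
  have hev := htend.eventually (ge_mem_nhds (show (0:ℝ) < min ((ε / 10) ^ 2) (ε / 40) by positivity))
  obtain ⟨n3, hn3⟩ := Filter.eventually_atTop.1 hev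
  refine ⟨max n1 (max n2 n3), fun n hn M hM hMr => ?_⟩
  have hb1 := (hn1 n (by omega)).1
  have hb2 := (hn2 n (by omega)).2
  have hb3 := hn3 n (by omega)
  have hb3a := hb3.trans (min_le_left _ _)
  have hb3b := hb3.trans (min_le_right _ _)
  set L : ℕ := ⌈Real.exp (n * (I2 + 2 * δ))⌉₊ with hLdef
  have hLge : Real.exp (n * (I2 + 2 * δ)) ≤ L := Nat.le_ceil _
  have hLle : (L:ℝ) ≤ 2 * Real.exp (n * (I2 + 2 * δ)) := by
    have h1 := (Nat.ceil_lt_add_one (Real.exp_pos (n * (I2 + 2 * δ))).le).le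
    have h2 : 1 ≤ Real.exp (n * (I2 + 2 * δ)) := Real.one_le_exp (by positivity)
    linarith
  have hL1 : 1 ≤ L := Nat.one_le_ceil_iff.2 (Real.exp_pos _)
  obtain ⟨xe, ψ, hx⟩ := oneshot (U := Fin n → U) (S := Fin n → S) (X := Fin n → X) (Y := Fin n → Y)
    (fun u => ∏ i, π (u i)) (fun u => Finset.prod_nonneg fun i _ => hπ0 _) (pi_sum_one π hπ1)
    (fun u s x => ∏ i, V (u i) (s i) (x i))
    (fun u s x => Finset.prod_nonneg fun i _ => div_nonneg (hq0 _ _ _) (hπ0 _))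
    (fun x s y => ∏ i, w (x i) (s i) (y i)) (fun x s y => Finset.prod_nonneg fun i _ => hw0 _ _ _)
    (fun x s => by rw [pi_sum_prod (fun i y => w (x i) (s i) y)]; simp [hw])
    (fun u s => ∏ i, VS (u i) (s i))
    (fun u s => by rw [pi_sum_prod (fun i x => V (u i) (s i) x)]; simp_rw [hVs])
    (fun u y => ∏ i, VY (u i) (y i))
    (fun u y => by
      simp_rw [← Finset.prod_mul_distrib]
      have : ∀ s : Fin n → S, ∑ x : Fin n → X, ∏ i, V (u i) (s i) (x i) * w (x i) (s i) (y i) =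
          ∏ i, ∑ x, V (u i) (s i) x * w x (s i) (y i) := fun s =>
        pi_sum_prod (fun i x => V (u i) (s i) x * w x (s i) (y i))
      simp_rw [this]
      rw [pi_sum_prod (fun i s => ∑ x, V (u i) s x * w x s (y i))]
      simp_rw [hVy])
    (fun s => ∏ i, ps (s i))
    (fun s => by
      simp_rw [← Finset.prod_mul_distrib]
      rw [pi_sum_prod (fun i u => π u * VS u (s i))]
      simp_rw [hVSm])
    (pi_sum_one ps hps1)
    (fun y => ∏ i, PY (y i))
    (fun s => by
      simp_rw [← Finset.prod_mul_distrib]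
      rw [pi_sum_prod (fun i u => π u * VY u (s i))]
      simp_rw [hVYm])
    (pi_sum_one PY hPY1)
    (Real.exp (n * (I2 + δ))) (Real.exp (n * (I1 - δ))) (Real.exp_pos _) (Real.exp_pos _)
    (2 * M) L (by omega) hL1
  have ht1 : Real.sqrt (Real.exp (n * (I2 + δ)) / L) ≤ ε / 10 := by
    rw [Real.sqrt_le_left (by positivity)]
    refine le_trans ?_ hb3a
    rw [div_le_iff₀ (by exact_mod_cast hL1)]
    refine le_trans (le_of_eq ?_) (mul_le_mul_of_nonneg_left hLge (Real.exp_pos _).le)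
    rw [← Real.exp_add]; congr 1; ring
  have ht2 : ((2 * M : ℕ) : ℝ) * L / Real.exp (n * (I1 - δ)) ≤ ε / 10 := by
    push_cast
    rw [div_le_iff₀ (Real.exp_pos _)]
    calc 2 * (M:ℝ) * L ≤ 2 * Real.exp (n * r) * (2 * Real.exp (n * (I2 + 2 * δ))) := by
          gcongr
      _ = 4 * Real.exp (-(n * δ)) * Real.exp (n * (I1 - δ)) := by
          have : Real.exp (n * r) * Real.exp (n * (I2 + 2 * δ)) =
            Real.exp (-(n * δ)) * Real.exp (n * (I1 - δ)) := by
            rw [← Real.exp_add, ← Real.exp_add]; congr 1; rw [hδ]; ring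
          linear_combination 4 * this
      _ ≤ _ := by
          apply mul_le_mul_of_nonneg_right _ (Real.exp_pos _).le
          linarith
  set err : Fin (2 * M) → ℝ := fun m => ∑ s : Fin n → S, (∏ i, ps (s i)) * ∑ y : Fin n → Y,
          (∏ i, w (xe m s i) (s i) (y i)) * (if ψ y ≠ m then 1 else 0) with herr
  have hps0 : ∀ s, 0 ≤ ps s := fun s => by
    rw [← hq]; exact Finset.sum_nonneg fun u _ => Finset.sum_nonneg fun x _ => hq0 _ _ _
  have herr0 : ∀ m, 0 ≤ err m := fun m => Finset.sum_nonneg fun s _ =>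
    mul_nonneg (Finset.prod_nonneg fun i _ => hps0 _) (Finset.sum_nonneg fun y _ =>
      mul_nonneg (Finset.prod_nonneg fun i _ => hw0 _ _ _) (by split_ifs <;> norm_num))
  obtain ⟨j, hj, hjm⟩ := expurgate err herr0 (half_pos hε) (by
    refine hx.trans ?_
    apply mul_le_mul_of_nonneg_left _ (by positivity)
    linarith)
  refine ⟨fun m s => xe (j m) s, fun y => if h : ∃ m, j m = ψ y then h.choose else ⟨0, hM⟩,
    fun m => ?_⟩
  have := hjm m
  refine le_trans ?_ (this.trans (by linarith))
  simp only [herr]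
  apply Finset.sum_le_sum
  intro s _
  apply mul_le_mul_of_nonneg_left _ (Finset.prod_nonneg fun i _ => hps0 _)
  apply Finset.sum_le_sum
  intro y _
  apply mul_le_mul_of_nonneg_left _ (Finset.prod_nonneg fun i _ => hw0 _ _ _)
  by_cases hy : ψ y = j m
  · have hex : ∃ m, j m = ψ y := ⟨m, hy.symm⟩
    have : (if h : ∃ m, j m = ψ y then h.choose else ⟨0, hM⟩) = m := by
      rw [dif_pos hex]; exact hj (hex.choose_spec.trans hy)
    rw [if_neg (not_not.2 this)]; split_ifs <;> norm_num
  · rw [if_pos hy]; split_ifs <;> norm_num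

end PartC

section PartD
open Classical

lemma sum_snoc {n : ℕ} {Y : Type} [Fintype Y] (G : (Fin (n + 1) → Y) → ℝ) :
    ∑ y : Fin (n + 1) → Y, G y = ∑ y : Fin n → Y, ∑ a : Y, G (Fin.snoc y a) := by
  rw [← (Fin.snocEquiv (fun _ : Fin (n + 1) => Y)).sum_comp, Fintype.sum_prod_type, Finset.sum_comm]
  rfl

lemma causal_sum {Y : Type} [Fintype Y] [Nonempty Y] : ∀ {n : ℕ}
    (K : Fin n → (Fin n → Y) → Y → ℝ)
    (_ : ∀ i y y', (∀ j < i, y j = y' j) → K i y = K i y') (_ : ∀ i y, ∑ b, K i y b = 1),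
    ∑ y : Fin n → Y, ∏ i, K i y (y i) = 1 := by
  intro n
  induction n with
  | zero => intro K _ _; simp
  | succ n ih =>
    intro K hK h1
    obtain ⟨a0⟩ := ‹Nonempty Y›
    rw [sum_snoc]
    have hk : ∀ (i : Fin n) (y : Fin n → Y) (a : Y),
        K i.castSucc (Fin.snoc y a) = K i.castSucc (Fin.snoc y a0) := by
      intro i y a
      apply hK
      intro j hj
      have : j = Fin.castSucc (Fin.castLT j (by have := Fin.lt_def.1 hj; simp at this; omega)) := by simp
      rw [this, Fin.snoc_castSucc (α := fun _ => Y), Fin.snoc_castSucc (α := fun _ => Y)]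
    have hl : ∀ (y : Fin n → Y) (a : Y),
        K (Fin.last n) (Fin.snoc y a) = K (Fin.last n) (Fin.snoc y a0) := by
      intro y a
      apply hK
      intro j hj
      have : j = Fin.castSucc (Fin.castLT j (by have := Fin.lt_def.1 hj; simpa using this)) := by simp
      rw [this, Fin.snoc_castSucc (α := fun _ => Y), Fin.snoc_castSucc (α := fun _ => Y)]
    simp_rw [Fin.prod_univ_castSucc, Fin.snoc_castSucc (α := fun _ => Y), Fin.snoc_last, hk, hl,
      ← Finset.mul_sum, h1, mul_one]
    apply ih (fun i y b => K i.castSucc (Fin.snoc y a0) b)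
    · intro i y y' h
      apply hK
      intro j hj
      have : j = Fin.castSucc (Fin.castLT j (by have := Fin.lt_def.1 hj; simp at this; omega)) := by simp
      rw [this, Fin.snoc_castSucc (α := fun _ => Y), Fin.snoc_castSucc (α := fun _ => Y)]
      apply h
      rw [Fin.lt_def] at hj ⊢
      simpa using hj
    · intro i y; exact h1 _ _

lemma causal_tail {Y : Type} [Fintype Y] [Nonempty Y] : ∀ {n : ℕ}
    (K : Fin n → (Fin n → Y) → Y → ℝ)
    (_ : ∀ i y y', (∀ j < i, y j = y' j) → K i y = K i y') (_ : ∀ i y, ∑ b, K i y b = 1)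
    (i : Fin n) (F : (Fin n → Y) → Y → ℝ) (_ : ∀ y y', (∀ j < i, y j = y' j) → F y = F y'),
    ∑ y : Fin n → Y, (∏ i, K i y (y i)) * F y (y i) =
      ∑ y : Fin n → Y, (∏ i, K i y (y i)) * ∑ b, K i y b * F y b := by
  intro n
  induction n with
  | zero => intro K _ _ i; exact i.elim0
  | succ n ih =>
    intro K hK h1 i F hF
    obtain ⟨a0⟩ := ‹Nonempty Y›
    rw [sum_snoc, sum_snoc]
    have hk : ∀ (i : Fin n) (y : Fin n → Y) (a : Y),
        K i.castSucc (Fin.snoc y a) = K i.castSucc (Fin.snoc y a0) := by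
      intro i y a
      apply hK
      intro j hj
      have : j = Fin.castSucc (Fin.castLT j (by have := Fin.lt_def.1 hj; simp at this; omega)) := by simp
      rw [this, Fin.snoc_castSucc (α := fun _ => Y), Fin.snoc_castSucc (α := fun _ => Y)]
    have hl : ∀ (y : Fin n → Y) (a : Y),
        K (Fin.last n) (Fin.snoc y a) = K (Fin.last n) (Fin.snoc y a0) := by
      intro y a
      apply hK
      intro j hj
      have : j = Fin.castSucc (Fin.castLT j (by have := Fin.lt_def.1 hj; simpa using this)) := by simp
      rw [this, Fin.snoc_castSucc (α := fun _ => Y), Fin.snoc_castSucc (α := fun _ => Y)]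
    have hf : ∀ (y : Fin n → Y) (a : Y), F (Fin.snoc y a) = F (Fin.snoc y a0) := by
      intro y a
      apply hF
      intro j hj
      have : j = Fin.castSucc (Fin.castLT j (by have := Fin.lt_def.1 hj; omega)) := by simp
      rw [this, Fin.snoc_castSucc (α := fun _ => Y), Fin.snoc_castSucc (α := fun _ => Y)]
    refine Fin.lastCases ?_ (fun i => ?_) i (motive := fun i' => i = i' → _) rfl
    · rintro rfl
      simp_rw [Fin.prod_univ_castSucc, Fin.snoc_castSucc (α := fun _ => Y), Fin.snoc_last, hk, hl, hf,
        mul_assoc, ← Finset.mul_sum, ← Finset.sum_mul, h1, one_mul]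
    · rintro rfl
      simp_rw [Fin.prod_univ_castSucc, Fin.snoc_castSucc (α := fun _ => Y), Fin.snoc_last, hk, hl, hf,
        mul_assoc, ← Finset.mul_sum, ← Finset.sum_mul, h1, one_mul]
      apply ih (fun i y b => K i.castSucc (Fin.snoc y a0) b) _ _ i (fun y b => F (Fin.snoc y a0) b)
      · intro y y' h
        apply hF
        intro j hj
        have : j = Fin.castSucc (Fin.castLT j (by have := Fin.lt_def.1 hj; simp at this; omega)) := by simp
        rw [this, Fin.snoc_castSucc (α := fun _ => Y), Fin.snoc_castSucc (α := fun _ => Y)]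
        apply h
        rw [Fin.lt_def] at hj ⊢
        simpa using hj
      · intro i y y' h
        apply hK
        intro j hj
        have : j = Fin.castSucc (Fin.castLT j (by have := Fin.lt_def.1 hj; simp at this; omega)) := by simp
        rw [this, Fin.snoc_castSucc (α := fun _ => Y), Fin.snoc_castSucc (α := fun _ => Y)]
        apply h
        rw [Fin.lt_def] at hj ⊢
        simpa using hj
      · intro i y; exact h1 _ _

/-- Expectation of `F (states, outputs)` under the encoder `e`. -/
def EE {S X Y : Type} [Fintype S] [Fintype Y] (ps : S → ℝ) (w : X → S → Y → ℝ) {n : ℕ}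
    (e : (Fin n → S) → (Fin n → Y) → Fin n → X) (F : (Fin n → S) → (Fin n → Y) → ℝ) : ℝ :=
  ∑ s : Fin n → S, ∑ y : Fin n → Y, (∏ i, ps (s i) * w (e s y i) (s i) (y i)) * F s y

def Causal {S X Y : Type} {n : ℕ} (e : (Fin n → S) → (Fin n → Y) → Fin n → X) : Prop :=
  ∀ s y y' i, (∀ j < i, y j = y' j) → e s y i = e s y' i

def cat {S X Y : Type} {a b : ℕ} (e1 : (Fin a → S) → (Fin a → Y) → Fin a → X)
    (e2 : (Fin a → S) → (Fin a → Y) → (Fin b → S) → (Fin b → Y) → Fin b → X) :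
    (Fin (a + b) → S) → (Fin (a + b) → Y) → Fin (a + b) → X := fun s y =>
  Fin.append (e1 (fun i => s (Fin.castAdd b i)) (fun i => y (Fin.castAdd b i)))
    (e2 (fun i => s (Fin.castAdd b i)) (fun i => y (Fin.castAdd b i))
      (fun i => s (Fin.natAdd a i)) (fun i => y (Fin.natAdd a i)))

lemma cat_causal {S X Y : Type} {a b : ℕ} (e1 : (Fin a → S) → (Fin a → Y) → Fin a → X)
    (e2 : (Fin a → S) → (Fin a → Y) → (Fin b → S) → (Fin b → Y) → Fin b → X)
    (h1 : Causal e1) (h2 : ∀ s y, Causal (e2 s y)) : Causal (cat e1 e2) := by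
  intro s y y' i
  refine Fin.addCases (fun i => ?_) (fun i => ?_) i
  · intro h
    simp only [cat, Fin.append_left]
    apply h1
    intro j hj
    apply h
    rw [Fin.lt_def] at hj ⊢
    simpa using hj
  · intro h
    simp only [cat, Fin.append_right]
    have : (fun i => y (Fin.castAdd b i)) = (fun i => y' (Fin.castAdd b i)) := by
      funext j
      apply h
      rw [Fin.lt_def]
      simp; omega
    rw [this]
    apply h2
    intro j hj
    apply h
    rw [Fin.lt_def] at hj ⊢
    simpa using hj

lemma sum_append {a b : ℕ} {Y : Type} [Fintype Y] (G : (Fin (a + b) → Y) → ℝ) :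
    ∑ y, G y = ∑ y1 : Fin a → Y, ∑ y2 : Fin b → Y, G (Fin.append y1 y2) := by
  rw [← (Fin.appendEquiv a b).sum_comp, Fintype.sum_prod_type]
  rfl

lemma EE_cat {S X Y : Type} [Fintype S] [Fintype Y] (ps : S → ℝ) (w : X → S → Y → ℝ) {a b : ℕ}
    (e1 : (Fin a → S) → (Fin a → Y) → Fin a → X)
    (e2 : (Fin a → S) → (Fin a → Y) → (Fin b → S) → (Fin b → Y) → Fin b → X)
    (F : (Fin (a + b) → S) → (Fin (a + b) → Y) → ℝ) :
    EE ps w (cat e1 e2) F = EE ps w e1 (fun s1 y1 => EE ps w (e2 s1 y1)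
      (fun s2 y2 => F (Fin.append s1 s2) (Fin.append y1 y2))) := by
  unfold EE
  rw [sum_append]
  simp_rw [sum_append (Y := Y), Fin.prod_univ_add, cat, Fin.append_left, Fin.append_right,
    Finset.mul_sum, mul_assoc]
  apply Finset.sum_congr rfl
  intro s1 _
  rw [Finset.sum_comm]

section basic
variable {S X Y : Type} [Fintype S] [Fintype Y] (ps : S → ℝ) (w : X → S → Y → ℝ) {n : ℕ}
  (e : (Fin n → S) → (Fin n → Y) → Fin n → X)

lemma EE_add (F G : (Fin n → S) → (Fin n → Y) → ℝ) :
    EE ps w e (fun s y => F s y + G s y) = EE ps w e F + EE ps w e G := by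
  simp only [EE, mul_add, Finset.sum_add_distrib]

lemma EE_mul (c : ℝ) (F : (Fin n → S) → (Fin n → Y) → ℝ) :
    EE ps w e (fun s y => c * F s y) = c * EE ps w e F := by
  simp only [EE, Finset.mul_sum]
  exact Finset.sum_congr rfl fun s _ => Finset.sum_congr rfl fun y _ => by ring

lemma EE_sum {κ : Type} (t : Finset κ) (F : κ → (Fin n → S) → (Fin n → Y) → ℝ) :
    EE ps w e (fun s y => ∑ k ∈ t, F k s y) = ∑ k ∈ t, EE ps w e (F k) := by
  simp only [EE, Finset.mul_sum]
  rw [Finset.sum_comm]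
  conv_rhs => enter [2, k]; rw [Finset.sum_comm]
  conv_rhs => rw [Finset.sum_comm]
  refine Finset.sum_congr rfl fun s _ => ?_
  conv_rhs => rw [Finset.sum_comm]

lemma EE_mono (hps : ∀ s, 0 ≤ ps s) (hw : ∀ x s y, 0 ≤ w x s y)
    (F G : (Fin n → S) → (Fin n → Y) → ℝ) (h : ∀ s y, F s y ≤ G s y) :
    EE ps w e F ≤ EE ps w e G := by
  apply Finset.sum_le_sum; intro s _
  apply Finset.sum_le_sum; intro y _
  exact mul_le_mul_of_nonneg_left (h s y)
    (Finset.prod_nonneg fun i _ => mul_nonneg (hps _) (hw _ _ _))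

lemma EE_const [Nonempty Y] (hps1 : ∑ s, ps s = 1) (hw1 : ∀ x s, ∑ y, w x s y = 1)
    (he : Causal e) (c : ℝ) :
    EE ps w e (fun _ _ => c) = c := by
  simp only [EE, ← Finset.sum_mul]
  have : ∀ s : Fin n → S, ∑ y : Fin n → Y, ∏ i, ps (s i) * w (e s y i) (s i) (y i) =
      ∏ i, ps (s i) := by
    intro s
    simp_rw [Finset.prod_mul_distrib, ← Finset.mul_sum]
    rw [causal_sum (fun i y b => w (e s y i) (s i) b), mul_one]
    · intro i y y' h; simp only [he s y y' i h]
    · intro i y; exact hw1 _ _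
  simp_rw [this]
  rw [pi_sum_one ps hps1, one_mul]

lemma EE_one_use (f : S → X) (F : (Fin 1 → S) → (Fin 1 → Y) → ℝ) :
    EE ps w (fun (s : Fin 1 → S) (_ : Fin 1 → Y) i => f (s i)) F =
      ∑ s, ∑ y, ps s * w (f s) s y * F (fun _ => s) (fun _ => y) := by
  unfold EE
  rw [← (Equiv.funUnique (Fin 1) S).symm.sum_comp]
  refine Finset.sum_congr rfl fun s _ => ?_
  rw [← (Equiv.funUnique (Fin 1) Y).symm.sum_comp]
  refine Finset.sum_congr rfl fun y _ => ?_
  simp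
  left; rfl

end basic
end PartD

section PartE
open Classical

def oneUse {S X Y : Type} (f : S → X) : (Fin 1 → S) → (Fin 1 → Y) → Fin 1 → X :=
  fun s _ i => f (s i)

lemma oneUse_causal {S X Y : Type} (f : S → X) : Causal (oneUse f : (Fin 1 → S) → (Fin 1 → Y) → Fin 1 → X) := by
  intro s y y' i _; rfl

lemma EE_oneUse {S X Y : Type} [Fintype S] [Fintype Y] (ps : S → ℝ) (w : X → S → Y → ℝ)
    (f : S → X) (F : (Fin 1 → S) → (Fin 1 → Y) → ℝ) :
    EE ps w (oneUse f) F =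
      ∑ s, ∑ y, ps s * w (f s) s y * F (fun _ => s) (fun _ => y) := EE_one_use ps w f F

lemma two_use {S X Y : Type} [Fintype S] [Fintype Y] (ps : S → ℝ) (w : X → S → Y → ℝ)
    (xs : X) (ss : S) (ys y2 : Y) (f f' : S → X) :
    EE ps w (cat (oneUse fun _ => xs) (fun s1 y1 => oneUse (if s1 0 = ss ∧ y1 0 = ys then f else f')))
      (fun _ y => (if y (Fin.castAdd 1 0) = ys then 1 else 0) * (if y (Fin.natAdd 1 0) = y2 then 1 else 0))
     = (∑ s, ps s * w xs s ys) * (∑ s, ps s * w (f' s) s y2) +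
       ps ss * w xs ss ys * ((∑ s, ps s * w (f s) s y2) - (∑ s, ps s * w (f' s) s y2)) := by
  rw [EE_cat, EE_oneUse]
  simp_rw [EE_oneUse, Fin.append_left, Fin.append_right]
  have h : ∀ (s1 : S) (y1 : Y), (∑ s, ∑ y, ps s * w ((if s1 = ss ∧ y1 = ys then f else f') s) s y *
      ((if y1 = ys then 1 else 0) * (if y = y2 then 1 else 0))) =
      if y1 = ys then (∑ s, ps s * w (f' s) s y2) + if s1 = ss then
        ((∑ s, ps s * w (f s) s y2) - (∑ s, ps s * w (f' s) s y2)) else 0 else (0:ℝ) := by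
    intro s1 y1
    by_cases h1 : y1 = ys <;> by_cases h2 : s1 = ss <;> simp [h1, h2]
  simp_rw [h]
  simp only [mul_ite, mul_zero, Finset.sum_ite_eq', Finset.mem_univ, if_true, mul_add,
    Finset.sum_add_distrib, ← Finset.sum_mul]

lemma separable {S X Y : Type} [Fintype S] [Fintype Y] (ps : S → ℝ) (wa wb : X → S → Y → ℝ)
    (s0 : S) (x x' : X) (hs0 : ps s0 ≠ 0) (hx : wa x s0 ≠ wa x' s0)
    (hne : ¬ ∀ s, ps s ≠ 0 → ∀ x, wa x s = wb x s) :
    ∃ (L : ℕ) (e : (Fin L → S) → (Fin L → Y) → Fin L → X) (T : (Fin L → Y) → ℝ), Causal e ∧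
      EE ps wa e (fun _ y => T y) ≠ EE ps wb e (fun _ y => T y) := by
  by_cases h : ∃ (f : S → X) (y0 : Y), ∑ s, ps s * wa (f s) s y0 ≠ ∑ s, ps s * wb (f s) s y0
  · obtain ⟨f, y0, h⟩ := h
    refine ⟨1, oneUse f, fun y => if y 0 = y0 then 1 else 0, oneUse_causal f, ?_⟩
    rw [EE_oneUse, EE_oneUse]
    simpa using h
  · push Not at h
    push Not at hne
    obtain ⟨ss, hss, xs, hxs⟩ := hne
    obtain ⟨ys, hys⟩ := Function.ne_iff.1 hxs
    obtain ⟨y2, hy2⟩ := Function.ne_iff.1 hx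
    refine ⟨1 + 1, _, fun y => (if y (Fin.castAdd 1 0) = ys then 1 else 0) * (if y (Fin.natAdd 1 0) = y2 then 1 else 0),
      cat_causal _ _ (oneUse_causal fun _ => xs) (fun s1 y1 => oneUse_causal
        (if s1 0 = ss ∧ y1 0 = ys then (fun _ => x) else Function.update (fun _ => x) s0 x')), ?_⟩
    rw [two_use, two_use]
    rw [← h (fun _ => xs) ys, ← h (fun _ => x) y2, ← h (Function.update (fun _ => x) s0 x') y2]
    have hd : ∑ s, ps s * wa x s y2 - ∑ s, ps s * wa (Function.update (fun _ => x) s0 x' s) s y2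
        = ps s0 * (wa x s0 y2 - wa x' s0 y2) := by
      rw [← Finset.sum_sub_distrib, Finset.sum_eq_single s0]
      · simp; ring
      · intro s _ hs; simp [Function.update_of_ne hs]
      · simp
    rw [hd]
    intro heq
    have h2 := add_left_cancel heq
    have h3 : ps s0 * (wa x s0 y2 - wa x' s0 y2) ≠ 0 := mul_ne_zero hs0 (sub_ne_zero.2 hy2)
    have h4 := mul_right_cancel₀ h3 h2
    exact hys (mul_left_cancel₀ hss h4)

section rep
variable {Θ S X Y : Type} [Fintype S] [Fintype Y] [Nonempty Y] (ps : S → ℝ) (w : Θ → X → S → Y → ℝ)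
  (hps : ∀ s, 0 ≤ ps s) (hps1 : ∑ s, ps s = 1) (hw : ∀ θ x s y, 0 ≤ w θ x s y)
  (hw1 : ∀ θ x s, ∑ y, w θ x s y = 1)

include hps1 hw1 in
lemma repeat_test {L : ℕ} (e : (Fin L → S) → (Fin L → Y) → Fin L → X) (T : (Fin L → Y) → ℝ)
    (he : Causal e) (k : ℕ) :
    ∃ (L' : ℕ) (e' : (Fin L' → S) → (Fin L' → Y) → Fin L' → X) (T' : (Fin L' → Y) → ℝ), Causal e' ∧
      ∀ θ, EE ps (w θ) e' (fun _ y => T' y - k * EE ps (w θ) e (fun _ y => T y)) = 0 ∧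
        EE ps (w θ) e' (fun _ y => (T' y - k * EE ps (w θ) e (fun _ y => T y)) ^ 2) =
        k * EE ps (w θ) e (fun _ y => (T y - EE ps (w θ) e (fun _ y => T y)) ^ 2) := by
  induction k with
  | zero =>
    refine ⟨0, fun _ _ i => i.elim0, fun _ => 0, fun _ _ _ i => i.elim0, fun θ => ?_⟩
    simp [EE]
  | succ k ih =>
    obtain ⟨L', e', T', he', h⟩ := ih
    refine ⟨L' + L, cat e' (fun _ _ => e), fun y => T' (fun i => y (Fin.castAdd L i)) +
      T (fun i => y (Fin.natAdd L' i)), cat_causal _ _ he' (fun _ _ => he), fun θ => ?_⟩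
    obtain ⟨h1, h2⟩ := h θ
    set p := EE ps (w θ) e (fun _ y => T y) with hp
    have hz : EE ps (w θ) e (fun _ y => T y - p) = 0 := by
      have := EE_add ps (w θ) e (fun _ y => T y) (fun _ _ => -p)
      rw [EE_const ps (w θ) e hps1 (hw1 θ) he] at this
      simp only [← sub_eq_add_neg] at this
      rw [this]; rw [hp]; ring
    rw [EE_cat, EE_cat]
    simp only [Fin.append_left, Fin.append_right]
    have e1 : ∀ y1 : Fin L' → Y, EE ps (w θ) e (fun _ y => T' y1 + T y - ((k + 1 : ℕ) : ℝ) * p) =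
        T' y1 - k * p := by
      intro y1
      have := EE_add ps (w θ) e (fun _ y => T y - p) (fun _ _ => T' y1 - k * p)
      rw [EE_const ps (w θ) e hps1 (hw1 θ) he, hz, zero_add] at this
      rw [← this]
      congr 1; funext _ y; push_cast; ring
    have e2 : ∀ y1 : Fin L' → Y, EE ps (w θ) e (fun _ y => (T' y1 + T y - ((k + 1 : ℕ) : ℝ) * p) ^ 2) =
        (T' y1 - k * p) ^ 2 + EE ps (w θ) e (fun _ y => (T y - p) ^ 2) := by
      intro y1
      have a1 := EE_add ps (w θ) e (fun _ y => 2 * (T' y1 - k * p) * (T y - p) + (T' y1 - k * p) ^ 2) (fun _ y => (T y - p) ^ 2)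
      have a2 := EE_add ps (w θ) e (fun _ y => 2 * (T' y1 - k * p) * (T y - p)) (fun _ y => (T' y1 - k * p) ^ 2)
      rw [EE_const ps (w θ) e hps1 (hw1 θ) he, EE_mul ps (w θ) e, hz, mul_zero, zero_add] at a2
      rw [a2] at a1
      rw [← a1]
      congr 1; funext _ y; push_cast; ring
    simp_rw [e1, e2]
    refine ⟨h1, ?_⟩
    rw [EE_add ps (w θ) e', EE_const ps (w θ) e' hps1 (hw1 θ) he', h2]
    push_cast; ring

include hps hps1 hw hw1 in
lemma pair_test (a b : Θ)
    (s0 : S) (x x' : X) (hs0 : ps s0 ≠ 0) (hx : w a x s0 ≠ w a x' s0)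
    (hne : ¬ ∀ s, ps s ≠ 0 → ∀ x, w a x s = w b x s) (δ : ℝ) (hδ : 0 < δ) :
    ∃ (L : ℕ) (e : (Fin L → S) → (Fin L → Y) → Fin L → X) (D : (Fin L → Y) → Prop), Causal e ∧
      EE ps (w a) e (fun _ y => if D y then 0 else 1) ≤ δ ∧
      EE ps (w b) e (fun _ y => if D y then 1 else 0) ≤ δ := by
  obtain ⟨L, e, T, he, hT⟩ := separable ps (w a) (w b) s0 x x' hs0 hx hne
  set pa := EE ps (w a) e (fun _ y => T y) with hpa
  set pb := EE ps (w b) e (fun _ y => T y) with hpb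
  set va := EE ps (w a) e (fun _ y => (T y - pa) ^ 2) with hva
  set vb := EE ps (w b) e (fun _ y => (T y - pb) ^ 2) with hvb
  have hg : 0 < (pa - pb) ^ 2 := by
    have := sub_ne_zero.2 hT
    positivity
  obtain ⟨k, hk⟩ := exists_nat_gt (max (4 * va / ((pa - pb) ^ 2 * δ)) (max (4 * vb / ((pa - pb) ^ 2 * δ)) 0))
  have hk1 := (le_max_left _ _).trans_lt hk
  have hk2 := ((le_max_left _ _).trans (le_max_right _ _)).trans_lt hk
  have hk0 := ((le_max_right _ _).trans (le_max_right _ _)).trans_lt hk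
  rw [div_lt_iff₀ (by positivity)] at hk1 hk2
  obtain ⟨L', e', T', he', h⟩ := repeat_test ps w hps1 hw1 e T he k
  obtain ⟨-, h1⟩ := h a
  obtain ⟨-, h2⟩ := h b
  rw [← hpa, ← hva] at h1
  rw [← hpb, ← hvb] at h2
  have hgk : 0 < (k:ℝ) ^ 2 * (pa - pb) ^ 2 := by positivity
  have key : ∀ u v : ℝ, ∀ t : ℝ, |t - k * v| ≤ |t - k * u| → 1 ≤ 4 / (k ^ 2 * (u - v) ^ 2) * (t - k * u) ^ 2 ∨ u = v := by
    intro u v t ht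
    by_cases huv : u = v
    · right; exact huv
    left
    have : 0 < (k:ℝ) ^ 2 * (u - v) ^ 2 := by
      have := sub_ne_zero.2 huv
      positivity
    rw [div_mul_eq_mul_div, le_div_iff₀ this, one_mul]
    have h3 := sq_le_sq.2 ht
    nlinarith [sq_nonneg ((t - k * v) + (t - k * u))]
  refine ⟨L', e', fun y => |T' y - k * pa| ≤ |T' y - k * pb|, he', ?_, ?_⟩
  · have := EE_mono ps (w a) e' hps (hw a) (fun _ y => if |T' y - k * pa| ≤ |T' y - k * pb| then 0 else 1)
      (fun _ y => 4 / (k ^ 2 * (pa - pb) ^ 2) * (T' y - k * pa) ^ 2) (by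
        intro s y
        by_cases hh : |T' y - k * pa| ≤ |T' y - k * pb|
        · simp only [hh, if_true]; positivity
        · simp only [hh, if_false]
          rcases key pa pb (T' y) (le_of_lt (not_le.1 hh)) with h | h
          · exact h
          · exact absurd h hT)
    refine this.trans ?_
    rw [EE_mul, h1, div_mul_eq_mul_div, div_le_iff₀ hgk]
    nlinarith
  · have := EE_mono ps (w b) e' hps (hw b) (fun _ y => if |T' y - k * pa| ≤ |T' y - k * pb| then 1 else 0)
      (fun _ y => 4 / (k ^ 2 * (pb - pa) ^ 2) * (T' y - k * pb) ^ 2) (by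
        intro s y
        by_cases hh : |T' y - k * pa| ≤ |T' y - k * pb|
        · simp only [hh, if_true]
          rcases key pb pa (T' y) hh with h | h
          · exact h
          · exact absurd h.symm hT
        · simp only [hh, if_false]; positivity)
    refine this.trans ?_
    rw [EE_mul, h2, div_mul_eq_mul_div, div_le_iff₀ (by rwa [← neg_sub pa pb, neg_sq])]
    nlinarith

include hps1 hw1 in
lemma all_tests (R : Θ → Θ → Prop) (δ : ℝ)
    (hR : ∀ a b, R a b → ∃ (L : ℕ) (e : (Fin L → S) → (Fin L → Y) → Fin L → X) (D : (Fin L → Y) → Prop), Causal e ∧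
      EE ps (w a) e (fun _ y => if D y then 0 else 1) ≤ δ ∧
      EE ps (w b) e (fun _ y => if D y then 1 else 0) ≤ δ) (t : Finset (Θ × Θ)) :
    ∃ (L : ℕ) (e : (Fin L → S) → (Fin L → Y) → Fin L → X) (D : Θ → Θ → (Fin L → Y) → Prop), Causal e ∧
      ∀ a b, (a, b) ∈ t → R a b → EE ps (w a) e (fun _ y => if D a b y then 0 else 1) ≤ δ ∧
      EE ps (w b) e (fun _ y => if D a b y then 1 else 0) ≤ δ := by
  induction t using Finset.induction_on with
  | empty => exact ⟨0, fun _ _ i => i.elim0, fun _ _ _ => True, fun _ _ _ i => i.elim0, by simp⟩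
  | insert p t hp ih =>
    obtain ⟨L, e, D, he, h⟩ := ih
    by_cases hRp : R p.1 p.2
    · obtain ⟨L', e', D', he', h1, h2⟩ := hR p.1 p.2 hRp
      refine ⟨L + L', cat e (fun _ _ => e'), fun a b y => if (a, b) = p then D' (fun i => y (Fin.natAdd L i)) else
        D a b (fun i => y (Fin.castAdd L' i)), cat_causal _ _ he (fun _ _ => he'), ?_⟩
      intro a b hab hr
      rw [EE_cat, EE_cat]
      simp only [Fin.append_left, Fin.append_right]
      by_cases hpp : (a, b) = p
      · simp only [hpp, if_true]
        rw [EE_const ps (w a) e hps1 (hw1 a) he, EE_const ps (w b) e hps1 (hw1 b) he]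
        subst hpp
        exact ⟨h1, h2⟩
      · simp only [hpp, if_false]
        simp_rw [EE_const ps (w a) e' hps1 (hw1 a) he', EE_const ps (w b) e' hps1 (hw1 b) he']
        exact h a b ((Finset.mem_insert.1 hab).resolve_left hpp) hr
    · refine ⟨L, e, D, he, ?_⟩
      intro a b hab hr
      rcases Finset.mem_insert.1 hab with h3 | h3
      · subst h3; exact absurd hr hRp
      · exact h a b h3 hr

include hps hps1 hw hw1 in
lemma identify [Fintype Θ] [Nonempty Θ]
    (hsep : ∀ a, ∃ s0 x x', ps s0 ≠ 0 ∧ w a x s0 ≠ w a x' s0) (ε : ℝ) (hε : 0 < ε) :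
    ∃ (L : ℕ) (e : (Fin L → S) → (Fin L → Y) → Fin L → X) (d : (Fin L → Y) → Θ), Causal e ∧
      ∀ θ, EE ps (w θ) e (fun _ y => if ∀ s, ps s ≠ 0 → ∀ x, w (d y) x s = w θ x s then 0 else 1) ≤ ε := by
  set R : Θ → Θ → Prop := fun a b => ¬ ∀ s, ps s ≠ 0 → ∀ x, w a x s = w b x s with hRdef
  have hcard : (0:ℝ) < Fintype.card Θ := by exact_mod_cast Fintype.card_pos
  obtain ⟨L, e, D, he, h⟩ := all_tests ps w hps1 hw1 R (ε / (2 * Fintype.card Θ)) (by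
    intro a b hab
    obtain ⟨s0, x, x', h1, h2⟩ := hsep a
    exact pair_test ps w hps hps1 hw hw1 a b s0 x x' h1 h2 hab _ (by positivity)) Finset.univ
  set win : (Fin L → Y) → Θ → Prop := fun y a => ∀ b, R a b → D a b y ∧ ¬ D b a y with hwin
  have hsymm : ∀ a b, R a b → R b a := by
    intro a b h1 h2
    exact h1 fun s hs x => (h2 s hs x).symm
  obtain ⟨θ0⟩ := ‹Nonempty Θ›
  refine ⟨L, e, fun y => if hy : ∃ a, win y a then hy.choose else θ0, he, fun θ => ?_⟩
  have := EE_mono ps (w θ) e hps (hw θ) (fun _ y => if ∀ s, ps s ≠ 0 → ∀ x, w (if hy : ∃ a, win y a then hy.choose else θ0) x s = w θ x s then 0 else 1)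
    (fun _ y => ∑ b, ((if R θ b then (if D θ b y then 0 else 1) else 0) + (if R θ b then (if D b θ y then 1 else 0) else 0))) (by
      intro s y
      have hnn : ∀ b, (0:ℝ) ≤ ((if R θ b then (if D θ b y then 0 else 1) else 0) + (if R θ b then (if D b θ y then 1 else 0) else 0)) := by
        intro b; split_ifs <;> norm_num
      by_cases hwt : win y θ
      · have hex : ∃ a, win y a := ⟨θ, hwt⟩
        have hc := hex.choose_spec
        have : ¬ R hex.choose θ := by
          intro hr
          exact (hwt _ (hsymm _ _ hr)).2 (hc _ hr).1
        simp only [hRdef, not_not] at this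
        simp only [hex, dif_pos]
        rw [if_pos this]
        exact Finset.sum_nonneg fun b _ => hnn b
      · obtain ⟨b, hb, hb2⟩ : ∃ b, R θ b ∧ (D θ b y → D b θ y) := by
          by_contra hcon
          apply hwt
          intro b hb
          by_contra h3
          exact hcon ⟨b, hb, fun h4 => by_contra fun h5 => h3 ⟨h4, h5⟩⟩
        refine le_trans ?_ (Finset.single_le_sum (fun b _ => hnn b) (Finset.mem_univ b))
        by_cases h1 : D θ b y
        · have := hb2 h1
          simp only [hb, h1, this, if_true]
          split_ifs <;> norm_num
        · simp only [hb, h1, if_true, if_false]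
          split_ifs <;> norm_num)
  refine this.trans ?_
  rw [EE_sum]
  calc _ ≤ ∑ b : Θ, ε / Fintype.card Θ := by
        apply Finset.sum_le_sum
        intro b _
        rw [EE_add]
        by_cases hb : R θ b
        · simp only [hb, if_true]
          have h1 := (h θ b (Finset.mem_univ _) hb).1
          have h2 := (h b θ (Finset.mem_univ _) (hsymm _ _ hb)).2
          have : ε / Fintype.card Θ = ε / (2 * Fintype.card Θ) + ε / (2 * Fintype.card Θ) := by
            field_simp; norm_num
          rw [this]
          exact add_le_add h1 h2
        · simp only [hb, if_false]
          rw [EE_const ps (w θ) e hps1 (hw1 θ) he]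
          simp; positivity
    _ = ε := by simp; field_simp

end rep
end PartE

section PartF
open Classical

lemma EE_noncausal {S X Y : Type} [Fintype S] [Fintype Y] (ps : S → ℝ) (w : X → S → Y → ℝ) {n : ℕ}
    (e : (Fin n → S) → (Fin n → Y) → Fin n → X) (F : (Fin n → S) → (Fin n → Y) → ℝ) :
    EE ps w e F = ∑ s : Fin n → S, (∏ i, ps (s i)) * ∑ y : Fin n → Y, (∏ i, w (e s y i) (s i) (y i)) * F s y := by
  unfold EE
  refine Finset.sum_congr rfl fun s _ => ?_
  rw [Finset.mul_sum]
  refine Finset.sum_congr rfl fun y _ => ?_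
  rw [Finset.prod_mul_distrib, mul_assoc]

lemma EE_eqv {S X Y : Type} [Fintype S] [Fintype Y] (ps : S → ℝ) (w w' : X → S → Y → ℝ) {n : ℕ}
    (e e' : (Fin n → S) → (Fin n → Y) → Fin n → X) (F : (Fin n → S) → (Fin n → Y) → ℝ)
    (h : ∀ s, ps s ≠ 0 → ∀ u y i, w (e u y i) s = w' (e' u y i) s) :
    EE ps w e F = EE ps w' e' F := by
  unfold EE
  refine Finset.sum_congr rfl fun s _ => Finset.sum_congr rfl fun y _ => ?_
  congr 1
  refine Finset.prod_congr rfl fun i _ => ?_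
  by_cases hs : ps (s i) = 0
  · simp [hs]
  · rw [h _ hs]

def VV {U S X Y : Type} [Fintype U] [Fintype S] [Fintype X] [Fintype Y]
    (w : X → S → Y → ℝ) (q : U → S → X → ℝ) : ℝ :=
  mutualInfo (fun z : U × Y => ∑ s, ∑ x, q z.1 s x * w x s z.2) - mutualInfo (fun z : U × S => ∑ x, q z.1 z.2 x)

lemma sep_of_pos {U S X Y : Type} [Fintype U] [Fintype S] [Fintype X] [Fintype Y] [Nonempty X] [Nonempty Y]
    (ps : S → ℝ) (hps1 : ∑ s, ps s = 1) (w : X → S → Y → ℝ) (hps : ∀ s, 0 ≤ ps s)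
    (hw0 : ∀ x s y, 0 ≤ w x s y) (hw : ∀ x s, ∑ y, w x s y = 1) (q : U → S → X → ℝ)
    (hq0 : ∀ u s x, 0 ≤ q u s x) (hq : ∀ s, ∑ u, ∑ x, q u s x = ps s) (hV : 0 < VV w q) :
    ∃ s0 x x', ps s0 ≠ 0 ∧ w x s0 ≠ w x' s0 := by
  by_contra hcon
  push Not at hcon
  obtain ⟨n₀, h⟩ := gp_code ps hps1 w hw0 hw q hq0 hq (VV w q / 2) (1/4) (by unfold VV at hV ⊢; linarith) (by norm_num)
  obtain ⟨n1, hn1⟩ := exists_nat_gt (2 / (VV w q / 2))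
  set n := max n₀ n1
  have hn : 2 ≤ (n:ℝ) * (VV w q / 2) := by
    have h1 : (n1:ℝ) ≤ n := by exact_mod_cast le_max_right _ _
    rw [div_lt_iff₀ (by positivity)] at hn1
    nlinarith
  obtain ⟨xe, ψ, hc⟩ := h n (le_max_left _ _) 2 (by norm_num) (by
    have := Real.add_one_le_exp ((n:ℝ) * (VV w q / 2))
    push_cast; linarith)
  have h0 := hc 0
  have h1 := hc 1
  rw [← EE_noncausal ps w (fun s _ => xe 0 s) (fun _ y => if ψ y ≠ 0 then 1 else 0)] at h0
  rw [← EE_noncausal ps w (fun s _ => xe 1 s) (fun _ y => if ψ y ≠ 1 then 1 else 0)] at h1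
  rw [EE_eqv ps w w (fun s _ => xe 1 s) (fun s _ => xe 0 s) _ (by
    intro s hs u y i; exact hcon s _ _ hs)] at h1
  have h2 := EE_add ps w (fun s _ => xe 0 s) (fun _ y => if ψ y ≠ 0 then 1 else 0) (fun _ y => if ψ y ≠ 1 then 1 else 0)
  have h3 := EE_mono ps w (fun s _ => xe 0 s) hps hw0 (fun _ _ => 1)
    (fun _ y => (if ψ y ≠ 0 then 1 else 0) + (if ψ y ≠ 1 then 1 else 0)) (by
      intro s y
      by_cases h : ψ y = 0
      · rw [h]; simp
      · rw [if_pos h]; split_ifs <;> norm_num)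
  rw [EE_const ps w (fun s _ => xe 0 s) hps1 hw (by intro s y y' i _; rfl)] at h3
  linarith

lemma achiev {Θ U S X Y : Type} [Fintype Θ] [Nonempty Θ] [Fintype U] [Fintype S] [Fintype X] [Fintype Y]
    [Nonempty X] [Nonempty Y] (ps : S → ℝ) (w : Θ → X → S → Y → ℝ)
    (hps : ∀ s, 0 ≤ ps s) (hps1 : ∑ s, ps s = 1) (hw : ∀ θ x s y, 0 ≤ w θ x s y)
    (hw1 : ∀ θ x s, ∑ y, w θ x s y = 1) (r : ℝ) (hr : 0 ≤ r)
    (q : Θ → U → S → X → ℝ)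
    (hq0 : ∀ θ u s x, 0 ≤ q θ u s x) (hq : ∀ θ s, ∑ u, ∑ x, q θ u s x = ps s)
    (hV : ∀ θ, r < VV (w θ) (q θ)) (ε : ℝ) (hε : 0 < ε) :
    ∃ n₀ : ℕ, ∀ n ≥ n₀, ∃ M : ℕ, 1 ≤ M ∧ ∃ (e : Fin M → (Fin n → S) → (Fin n → Y) → Fin n → X)
      (ψ : (Fin n → Y) → Fin M), r ≤ Real.log M / n ∧ (∀ m, Causal (e m)) ∧
      ∀ m θ, EE ps (w θ) (e m) (fun _ y => if ψ y ≠ m then 1 else 0) ≤ ε := by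
  obtain ⟨L, e1, d, he1, hd⟩ := identify ps w hps hps1 hw hw1 (by
    intro θ
    exact sep_of_pos ps hps1 (w θ) hps (hw θ) (hw1 θ) (q θ) (hq0 θ) (hq θ) (hr.trans_lt (hV θ))) (ε / 2) (by positivity)
  obtain ⟨r', hr1, hr2⟩ : ∃ r', r < r' ∧ ∀ θ, r' < VV (w θ) (q θ) := by
    have : r < Finset.univ.inf' Finset.univ_nonempty (fun θ => VV (w θ) (q θ)) := by
      rw [Finset.lt_inf'_iff]; intro θ _; exact hV θ
    obtain ⟨r', h1, h2⟩ := exists_between this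
    rw [Finset.lt_inf'_iff] at h2
    exact ⟨r', h1, fun θ => h2 θ (Finset.mem_univ _)⟩
  have hg : ∀ θ, _ := fun θ => gp_code ps hps1 (w θ) (hw θ) (hw1 θ) (q θ) (hq0 θ) (hq θ) r' (ε / 2) (hr2 θ) (by positivity)
  choose n0 hn0 using hg
  obtain ⟨n1, hn1⟩ := exists_nat_gt ((r * L + Real.log 2) / (r' - r))
  set N := max (Finset.univ.sup n0) (n1 + 1) with hN
  refine ⟨L + N, fun n hn => ?_⟩
  obtain ⟨k, rfl⟩ := Nat.exists_eq_add_of_le (show L ≤ n by omega)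
  have hk : N ≤ k := by omega
  have hk1 : n1 < k := by have := (le_max_right (Finset.univ.sup n0) (n1 + 1)); omega
  have hexp1 : 1 ≤ Real.exp (k * r') := Real.one_le_exp (by have := hr.trans hr1.le; positivity)
  set M := ⌊Real.exp (k * r')⌋₊ with hM
  have hM1 : 1 ≤ M := by rw [hM]; exact Nat.one_le_floor_iff _ |>.2 hexp1
  have hMle : (M:ℝ) ≤ Real.exp (k * r') := Nat.floor_le (by positivity)
  have hMge : Real.exp (k * r') / 2 ≤ M := by
    have h1 := Nat.lt_floor_add_one (Real.exp (k * r'))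
    rw [← hM] at h1
    have h2 : (1:ℝ) ≤ M := by exact_mod_cast hM1
    linarith
  have hc : ∀ θ, _ := fun θ => hn0 θ k ((Finset.le_sup (f := n0) (Finset.mem_univ θ)).trans ((le_max_left _ _).trans hk)) M hM1 hMle
  choose xe ψ hxe using hc
  refine ⟨M, hM1, fun m => cat e1 (fun _ y1 s2 _ => xe (d y1) m s2),
    fun y => ψ (d (fun i => y (Fin.castAdd k i))) (fun i => y (Fin.natAdd L i)), ?_, ?_, ?_⟩
  · have h1 := Real.log_le_log (by positivity) hMge
    rw [Real.log_div (Real.exp_pos _).ne' (by norm_num), Real.log_exp] at h1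
    have hk2 : (n1:ℝ) < k := by exact_mod_cast hk1
    rw [div_lt_iff₀ (by linarith)] at hn1
    rw [le_div_iff₀ (by push_cast; have : (0:ℝ) ≤ n1 := by positivity
                        have : (0:ℝ) ≤ L := by positivity
                        linarith)]
    push_cast
    nlinarith
  · intro m
    exact cat_causal _ _ he1 (fun _ _ => by intro s y y' i _; rfl)
  · intro m θ
    rw [EE_cat]
    simp only [Fin.append_left, Fin.append_right]
    have hb : ∀ y1 : Fin L → Y, EE ps (w θ) (fun s2 _ => xe (d y1) m s2) (fun _ y2 => if ψ (d y1) y2 ≠ m then 1 else 0) ≤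
        (if ∀ s, ps s ≠ 0 → ∀ x, w (d y1) x s = w θ x s then 0 else 1) + ε / 2 := by
      intro y1
      by_cases h : ∀ s, ps s ≠ 0 → ∀ x, w (d y1) x s = w θ x s
      · rw [if_pos h, zero_add]
        rw [EE_eqv ps (w θ) (w (d y1)) _ (fun s2 _ => xe (d y1) m s2) _ (by
          intro s hs u y i; exact (h s hs _).symm), EE_noncausal]
        exact hxe (d y1) m
      · rw [if_neg h]
        have := EE_mono ps (w θ) (fun s2 _ => xe (d y1) m s2) hps (hw θ)
          (fun _ y2 => if ψ (d y1) y2 ≠ m then 1 else 0) (fun _ _ => 1) (by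
            intro s y; split_ifs <;> norm_num)
        rw [EE_const ps (w θ) (fun s2 _ => xe (d y1) m s2) hps1 (hw1 θ) (by intro s y y' i _; rfl)] at this
        linarith
    refine (EE_mono ps (w θ) e1 hps (hw θ) _ _ (fun _ y1 => hb y1)).trans ?_
    rw [EE_add, EE_const ps (w θ) e1 hps1 (hw1 θ) he1]
    refine (add_le_add (?_ : _ ≤ ε / 2) le_rfl).trans (by linarith)
    convert hd θ

end PartF

section PartH
open Classical
open Real (negMulLog)

lemma mi_ent {A B : Type} [Fintype A] [Fintype B] (p : A × B → ℝ) (h0 : ∀ z, 0 ≤ p z) :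
    mutualInfo p = (∑ a, negMulLog (∑ b, p (a, b))) + (∑ b, negMulLog (∑ a, p (a, b)))
      - ∑ a, ∑ b, negMulLog (p (a, b)) := by
  have e1 : ∑ a, negMulLog (∑ b, p (a, b)) = ∑ a, ∑ b, - (p (a, b) * Real.log (∑ b', p (a, b'))) := by
    refine Finset.sum_congr rfl fun a _ => ?_
    rw [negMulLog, neg_mul, Finset.sum_mul, Finset.sum_neg_distrib]
  have e2 : ∑ b, negMulLog (∑ a, p (a, b)) = ∑ a, ∑ b, - (p (a, b) * Real.log (∑ a', p (a', b))) := by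
    rw [Finset.sum_comm]
    refine Finset.sum_congr rfl fun a _ => ?_
    rw [negMulLog, neg_mul, Finset.sum_mul, Finset.sum_neg_distrib]
  rw [e1, e2, mutualInfo, ← Finset.sum_add_distrib, ← Finset.sum_sub_distrib]
  refine Finset.sum_congr rfl fun a _ => ?_
  rw [← Finset.sum_add_distrib, ← Finset.sum_sub_distrib]
  refine Finset.sum_congr rfl fun b _ => ?_
  by_cases hp : p (a, b) = 0
  · simp [hp]
  have hpp : 0 < p (a, b) := lt_of_le_of_ne (h0 _) (Ne.symm hp)
  have ha : 0 < ∑ b', p (a, b') := hpp.trans_le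
    (Finset.single_le_sum (f := fun b' => p (a, b')) (fun b' _ => h0 _) (Finset.mem_univ b))
  have hb : 0 < ∑ a', p (a', b) := hpp.trans_le
    (Finset.single_le_sum (f := fun a' => p (a', b)) (fun b' _ => h0 _) (Finset.mem_univ a))
  rw [Real.log_div hp (mul_pos ha hb).ne', Real.log_mul ha.ne' hb.ne', negMulLog]
  ring

section
variable {U S X Y : Type} [Fintype U] [Fintype S] [Fintype X] [Fintype Y]
    (w : X → S → Y → ℝ)

def hh (z : S → X → ℝ) : ℝ :=
  (∑ s, negMulLog (∑ x, z s x)) - ∑ y, negMulLog (∑ s, ∑ x, z s x * w x s y)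

lemma hh_zero : hh w (0 : S → X → ℝ) = 0 := by simp [hh]

lemma hh_smul (hw : ∀ x s, ∑ y, w x s y = 1) (c : ℝ) (z : S → X → ℝ) :
    hh w (c • z) = c * hh w z := by
  have e : ∑ y, ∑ s, ∑ x, z s x * w x s y = ∑ s, ∑ x, z s x := by
    rw [Finset.sum_comm]
    refine Finset.sum_congr rfl fun s _ => ?_
    rw [Finset.sum_comm]
    refine Finset.sum_congr rfl fun x _ => ?_
    rw [← Finset.mul_sum, hw, mul_one]
  simp only [hh, Pi.smul_apply, smul_eq_mul, mul_assoc, ← Finset.mul_sum, Real.negMulLog_mul,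
    Finset.sum_add_distrib, ← Finset.sum_mul]
  rw [e]; ring

lemma VV_eq (hw0 : ∀ x s y, 0 ≤ w x s y) (hw : ∀ x s, ∑ y, w x s y = 1) (q : U → S → X → ℝ)
    (hq0 : ∀ u s x, 0 ≤ q u s x) :
    VV w q = (∑ y, negMulLog (∑ s, ∑ x, (∑ u, q u s x) * w x s y)) - (∑ s, negMulLog (∑ x, ∑ u, q u s x))
      + ∑ u, hh w (q u) := by
  rw [VV, mi_ent _ (fun z => Finset.sum_nonneg fun s _ => Finset.sum_nonneg fun x _ => mul_nonneg (hq0 _ _ _) (hw0 _ _ _)),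
    mi_ent _ (fun z => Finset.sum_nonneg fun x _ => hq0 _ _ _)]
  have e1 : ∀ u, ∑ y, ∑ s, ∑ x, q u s x * w x s y = ∑ s, ∑ x, q u s x := by
    intro u
    rw [Finset.sum_comm]
    refine Finset.sum_congr rfl fun s _ => ?_
    rw [Finset.sum_comm]
    refine Finset.sum_congr rfl fun x _ => ?_
    rw [← Finset.mul_sum, hw, mul_one]
  have e2 : ∀ y, ∑ u, ∑ s, ∑ x, q u s x * w x s y = ∑ s, ∑ x, (∑ u, q u s x) * w x s y := by
    intro y
    rw [Finset.sum_comm]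
    refine Finset.sum_congr rfl fun s _ => ?_
    rw [Finset.sum_comm]
    refine Finset.sum_congr rfl fun x _ => ?_
    rw [Finset.sum_mul]
  have e3 : ∀ s, ∑ u, ∑ x, q u s x = ∑ x, ∑ u, q u s x := fun s => Finset.sum_comm
  simp only [e1, e2, e3, hh, Finset.sum_sub_distrib]
  ring
end

lemma caratheodory {V E : Type} [Fintype V] [AddCommGroup E] [Module ℝ E] [FiniteDimensional ℝ E]
    (g : V → E) (c : V → ℝ) (hc : ∀ v, 0 ≤ c v) :
    ∃ c' : V → ℝ, (∀ v, 0 ≤ c' v) ∧ ∑ v, c' v • g v = ∑ v, c v • g v ∧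
      (Finset.univ.filter fun v => c' v ≠ 0).card ≤ Module.finrank ℝ E := by
  have key : ∀ k : ℕ, ∀ c : V → ℝ, (∀ v, 0 ≤ c v) → (Finset.univ.filter fun v => c v ≠ 0).card ≤ k →
    ∃ c' : V → ℝ, (∀ v, 0 ≤ c' v) ∧ ∑ v, c' v • g v = ∑ v, c v • g v ∧
      (Finset.univ.filter fun v => c' v ≠ 0).card ≤ Module.finrank ℝ E := by
    intro k
    induction k with
    | zero => intro c hc hk; exact ⟨c, hc, rfl, hk.trans (Nat.zero_le _)⟩
    | succ k ih =>
      intro c hc hk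
      by_cases hle : (Finset.univ.filter fun v => c v ≠ 0).card ≤ Module.finrank ℝ E
      · exact ⟨c, hc, rfl, hle⟩
      have hnli : ¬ LinearIndependent ℝ (fun v : {v // c v ≠ 0} => g v) := by
        intro hli
        have := hli.fintype_card_le_finrank
        rw [Fintype.card_subtype] at this
        exact hle this
      rw [Fintype.not_linearIndependent_iff] at hnli
      obtain ⟨a, ha0, i, hi⟩ := hnli
      obtain ⟨a, ha0, i, hi⟩ : ∃ a : {v // c v ≠ 0} → ℝ, ∑ i, a i • g i = 0 ∧ ∃ i, 0 < a i := by
        rcases lt_or_gt_of_ne hi with h | h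
        · exact ⟨fun v => - a v, by simp [ha0], i, by linarith⟩
        · exact ⟨a, ha0, i, h⟩
      obtain ⟨j, hj, hjmin⟩ := Finset.exists_min_image (Finset.univ.filter fun v => 0 < a v)
        (fun v => c v / a v) ⟨i, by simp [hi]⟩
      simp only [Finset.mem_filter, Finset.mem_univ, true_and] at hj hjmin
      set t := c j / a j with ht
      have ht0 : 0 ≤ t := div_nonneg (hc _) hj.le
      set a' : V → ℝ := fun v => if h : c v ≠ 0 then a ⟨v, h⟩ else 0 with ha'
      have hs : ∑ v, a' v • g v = 0 := by
        rw [← ha0]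
        symm
        apply Fintype.sum_of_injective (Subtype.val : {v // c v ≠ 0} → V) Subtype.val_injective
        · intro v hv
          have : ¬ c v ≠ 0 := by intro h; exact hv ⟨⟨v, h⟩, rfl⟩
          simp [ha', this]
        · intro v
          simp [ha', v.2]
      have hnn : ∀ v, 0 ≤ c v - t * a' v := by
        intro v
        by_cases h : c v ≠ 0
        · simp only [ha', h, dif_pos, ne_eq, not_false_eq_true]
          by_cases h2 : 0 < a ⟨v, h⟩
          · have := hjmin ⟨v, h⟩ h2
            rw [le_div_iff₀ h2] at this
            linarith
          · have := mul_nonneg ht0 (neg_nonneg.2 (not_lt.1 h2))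
            have := hc v
            linarith
        · simp only [ha', h, dif_neg, not_false_eq_true]
          simp [hc v]
      obtain ⟨c', h1, h2, h3⟩ := ih (fun v => c v - t * a' v) hnn (by
        have hlt : (Finset.univ.filter fun v => c v - t * a' v ≠ 0).card < (Finset.univ.filter fun v => c v ≠ 0).card := by
          apply Finset.card_lt_card
          rw [Finset.ssubset_iff_of_subset]
          · refine ⟨j.1, by simp [j.2], ?_⟩
            simp [ha', j.2, ht]
            field_simp; simp
          · intro v hv
            simp only [Finset.mem_filter, Finset.mem_univ, true_and] at hv ⊢
            intro h
            apply hv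
            simp [ha', h]
        omega)
      refine ⟨c', h1, ?_, h3⟩
      rw [h2]
      simp only [sub_smul, Finset.sum_sub_distrib, mul_smul, ← Finset.smul_sum, hs, smul_zero, sub_zero]
  exact key _ c hc le_rfl

lemma card_reduce {V S X Y : Type} [Fintype V] [Fintype S] [Fintype X] [Fintype Y]
    (w : X → S → Y → ℝ) (hw0 : ∀ x s y, 0 ≤ w x s y) (hw : ∀ x s, ∑ y, w x s y = 1) (q : V → S → X → ℝ)
    (hq0 : ∀ u s x, 0 ≤ q u s x) (N : ℕ) (hN : Fintype.card X * Fintype.card S + 1 ≤ N) :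
    ∃ q' : Fin N → S → X → ℝ, (∀ u s x, 0 ≤ q' u s x) ∧ (∀ s x, ∑ u, q' u s x = ∑ v, q v s x) ∧
      VV w q' = VV w q := by
  obtain ⟨c, hc0, hcs, hcard⟩ := caratheodory (E := (S × X → ℝ) × ℝ)
    (fun v => ((fun p => q v p.1 p.2), hh w (q v))) (fun _ => 1) (fun _ => zero_le_one)
  simp only [Module.finrank_prod, Module.finrank_fintype_fun_eq_card, Module.finrank_self, Fintype.card_prod] at hcard
  have hc1 : ∀ s x, ∑ v, c v * q v s x = ∑ v, q v s x := by
    intro s x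
    have := congrFun (congrArg Prod.fst hcs) (s, x)
    simpa [Prod.fst_sum, Finset.sum_apply] using this
  have hc2 : ∑ v, c v * hh w (q v) = ∑ v, hh w (q v) := by
    have := congrArg Prod.snd hcs
    simpa [Prod.snd_sum] using this
  obtain ⟨f⟩ : Nonempty ({v // c v ≠ 0} ↪ Fin N) := by
    apply Function.Embedding.nonempty_of_card_le
    rw [Fintype.card_subtype, Fintype.card_fin]
    have : Fintype.card X * Fintype.card S = Fintype.card S * Fintype.card X := mul_comm _ _
    omega
  set q' : Fin N → S → X → ℝ := Function.extend f (fun v => c v • q v) 0 with hq'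
  have hsum : ∀ G : (S → X → ℝ) → ℝ, G 0 = 0 → ∑ u, G (q' u) = ∑ v, G (c v • q v) := by
    intro G hG
    rw [← Fintype.sum_of_injective f f.injective (fun v => G (c v • q v)) (fun u => G (q' u))]
    · apply Fintype.sum_of_injective (Subtype.val : {v // c v ≠ 0} → V) Subtype.val_injective
      · intro v hv
        have : ¬ c v ≠ 0 := by intro h; exact hv ⟨⟨v, h⟩, rfl⟩
        simp only [ne_eq, not_not] at this
        simp [this, hG]
      · intro v; rfl
    · intro u hu
      simp only [hq']
      rw [Function.extend_apply' _ _ _ hu]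
      exact hG
    · intro v
      simp only [hq']
      rw [f.injective.extend_apply]
  have h0 : ∀ u s x, 0 ≤ q' u s x := by
    intro u s x
    simp only [hq']
    by_cases hu : ∃ v, f v = u
    · obtain ⟨v, rfl⟩ := hu
      rw [f.injective.extend_apply]
      exact mul_nonneg (hc0 _) (hq0 _ _ _)
    · rw [Function.extend_apply' _ _ _ hu]; simp
  have hm : ∀ s x, ∑ u, q' u s x = ∑ v, q v s x := by
    intro s x
    rw [hsum (fun z => z s x) rfl, ← hc1]
    rfl
  refine ⟨q', h0, hm, ?_⟩
  rw [VV_eq w hw0 hw q' h0, VV_eq w hw0 hw q hq0, hsum _ (hh_zero w)]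
  simp_rw [hh_smul w hw, hc2, hm]

lemma nml_le_one (x : ℝ) (hx : 0 ≤ x) : negMulLog x ≤ 1 := by
  rcases hx.eq_or_lt with rfl | hx
  · simp
  · have := Real.one_sub_inv_le_log_of_pos hx
    have h2 := mul_le_mul_of_nonneg_left this hx.le
    rw [mul_sub, mul_inv_cancel₀ hx.ne'] at h2
    rw [negMulLog]; linarith

lemma VV_bdd {U S X Y : Type} [Fintype U] [Fintype S] [Fintype X] [Fintype Y]
    (ps : S → ℝ) (hps1 : ∑ s, ps s = 1)
    (w : X → S → Y → ℝ) (hw0 : ∀ x s y, 0 ≤ w x s y) (hw : ∀ x s, ∑ y, w x s y = 1) (q : U → S → X → ℝ)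
    (hq0 : ∀ u s x, 0 ≤ q u s x) (hq : ∀ s, ∑ u, ∑ x, q u s x = ps s) :
    VV w q ≤ Fintype.card Y + Fintype.card U * Fintype.card S := by
  have hps : ∀ s, 0 ≤ ps s := fun s => by
    rw [← hq]; exact Finset.sum_nonneg fun u _ => Finset.sum_nonneg fun x _ => hq0 _ _ _
  have hps' : ∀ s, ps s ≤ 1 := fun s => by
    rw [← hps1]; exact Finset.single_le_sum (fun s _ => hps s) (Finset.mem_univ s)
  rw [VV_eq w hw0 hw q hq0]
  have h1 : (∑ y, negMulLog (∑ s, ∑ x, (∑ u, q u s x) * w x s y)) ≤ Fintype.card Y := by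
    calc _ ≤ ∑ y : Y, (1:ℝ) := Finset.sum_le_sum fun y _ => nml_le_one _
          (Finset.sum_nonneg fun s _ => Finset.sum_nonneg fun x _ => mul_nonneg (Finset.sum_nonneg fun u _ => hq0 _ _ _) (hw0 _ _ _))
      _ = _ := by simp
  have h2 : 0 ≤ (∑ s, negMulLog (∑ x, ∑ u, q u s x)) := by
    refine Finset.sum_nonneg fun s _ => ?_
    rw [Finset.sum_comm, hq]
    exact Real.negMulLog_nonneg (hps s) (hps' s)
  have hle : ∀ u, ∑ s, ∑ x, q u s x ≤ 1 := by
    intro u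
    rw [← hps1]
    refine Finset.sum_le_sum fun s _ => ?_
    rw [← hq]
    exact Finset.single_le_sum (f := fun u => ∑ x, q u s x) (fun u _ => Finset.sum_nonneg fun x _ => hq0 _ _ _) (Finset.mem_univ u)
  have h3 : ∀ u, hh w (q u) ≤ Fintype.card S := by
    intro u
    have a1 : ∑ s, negMulLog (∑ x, q u s x) ≤ Fintype.card S := by
      calc _ ≤ ∑ s : S, (1:ℝ) := Finset.sum_le_sum fun s _ => nml_le_one _ (Finset.sum_nonneg fun x _ => hq0 _ _ _)
        _ = _ := by simp
    have a2 : 0 ≤ ∑ y, negMulLog (∑ s, ∑ x, q u s x * w x s y) := by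
      refine Finset.sum_nonneg fun y _ => Real.negMulLog_nonneg ?_ ?_
      · exact Finset.sum_nonneg fun s _ => Finset.sum_nonneg fun x _ => mul_nonneg (hq0 _ _ _) (hw0 _ _ _)
      · refine le_trans ?_ (hle u)
        refine Finset.sum_le_sum fun s _ => Finset.sum_le_sum fun x _ => ?_
        refine mul_le_of_le_one_right (hq0 _ _ _) ?_
        rw [← hw x s]
        exact Finset.single_le_sum (fun y _ => hw0 x s y) (Finset.mem_univ y)
    unfold hh; linarith
  have h4 : ∑ u, hh w (q u) ≤ Fintype.card U * Fintype.card S := by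
    calc _ ≤ ∑ u : U, (Fintype.card S : ℝ) := Finset.sum_le_sum fun u _ => h3 u
      _ = _ := by simp
  linarith

end PartH

section PartG
open Classical
open Real (negMulLog)

section ent
variable {Ω : Type} [Fintype Ω] (P : Ω → ℝ)

def mass {A : Type} (f : Ω → A) (a : A) : ℝ := ∑ ω, if f ω = a then P ω else 0

def Hk {A : Type} (f : Ω → A) : ℝ := ∑ ω, P ω * - Real.log (mass P f (f ω))

lemma mass_sum {A : Type} [Fintype A] (f : Ω → A) (G : A → ℝ) :
    ∑ ω, P ω * G (f ω) = ∑ a, mass P f a * G a := by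
  simp only [mass, Finset.sum_mul]
  rw [Finset.sum_comm]
  refine Finset.sum_congr rfl fun ω _ => ?_
  simp [ite_mul]

lemma Hk_eq {A : Type} [Fintype A] (f : Ω → A) : Hk P f = ∑ a, negMulLog (mass P f a) := by
  unfold Hk
  rw [mass_sum P f (fun a => - Real.log (mass P f a))]
  refine Finset.sum_congr rfl fun a _ => ?_
  rw [negMulLog]; ring

lemma Hk_congr {A B : Type} (f : Ω → A) (g : Ω → B) (h : ∀ ω ω', f ω = f ω' ↔ g ω = g ω') :
    Hk P f = Hk P g := by
  unfold Hk mass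
  simp only [h]

variable (hP : ∀ ω, 0 ≤ P ω) (hP1 : ∑ ω, P ω = 1)

include hP in
lemma mass_nonneg {A : Type} (f : Ω → A) (a : A) : 0 ≤ mass P f a :=
  Finset.sum_nonneg fun ω _ => by split_ifs; exacts [hP ω, le_rfl]

include hP in
lemma mass_pos {A : Type} (f : Ω → A) (ω : Ω) (h : P ω ≠ 0) : 0 < mass P f (f ω) := by
  have h1 : 0 < P ω := lt_of_le_of_ne (hP ω) (Ne.symm h)
  refine h1.trans_le ?_
  have := Finset.single_le_sum (f := fun ω' => if f ω' = f ω then P ω' else 0)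
    (fun ω' _ => by split_ifs; exacts [hP ω', le_rfl]) (Finset.mem_univ ω)
  simp only [if_true] at this
  exact this

include hP1 in
lemma mass_total {A : Type} [Fintype A] (f : Ω → A) : ∑ a, mass P f a = 1 := by
  have := mass_sum P f (fun _ => 1)
  simp only [mul_one] at this
  rw [← this, hP1]

include hP hP1 in
lemma gibbs {A : Type} [Fintype A] (f : Ω → A) (Q : A → ℝ) (hQ : ∀ a, 0 ≤ Q a) (hQ1 : ∑ a, Q a ≤ 1)
    (hpos : ∀ ω, P ω ≠ 0 → 0 < Q (f ω)) :
    Hk P f ≤ ∑ ω, P ω * - Real.log (Q (f ω)) := by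
  have h1 : ∀ ω, P ω * - Real.log (mass P f (f ω)) ≤ P ω * - Real.log (Q (f ω)) +
      (P ω * (Q (f ω) / mass P f (f ω)) - P ω) := by
    intro ω
    by_cases h : P ω = 0
    · simp [h]
    have hm := mass_pos P hP f ω h
    have hq := hpos ω h
    have := Real.log_le_sub_one_of_pos (div_pos hq hm)
    rw [Real.log_div hq.ne' hm.ne'] at this
    nlinarith [mul_le_mul_of_nonneg_left this (hP ω)]
  refine (Finset.sum_le_sum fun ω _ => h1 ω).trans ?_
  rw [Finset.sum_add_distrib, Finset.sum_sub_distrib, hP1, mass_sum P f (fun a => Q a / mass P f a)]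
  have : ∑ a, mass P f a * (Q a / mass P f a) ≤ ∑ a, Q a := by
    refine Finset.sum_le_sum fun a _ => ?_
    by_cases h : mass P f a = 0
    · simp [h, hQ a]
    · rw [mul_div_cancel₀ _ h]
  linarith

include hP hP1 in
lemma Hk_pi {n : ℕ} {A : Type} [Fintype A] (f : Ω → Fin n → A) :
    Hk P f ≤ ∑ i, Hk P (fun ω => f ω i) := by
  have := gibbs P hP hP1 f (fun a => ∏ i, mass P (fun ω => f ω i) (a i))
    (fun a => Finset.prod_nonneg fun i _ => mass_nonneg P hP _ _)
    (by rw [pi_sum_prod (fun i a => mass P (fun ω => f ω i) a)]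
        simp [mass_total P hP1])
    (fun ω h => Finset.prod_pos fun i _ => mass_pos P hP (fun ω => f ω i) ω h)
  refine this.trans (le_of_eq ?_)
  simp only [Hk]
  rw [Finset.sum_comm]
  refine Finset.sum_congr rfl fun ω _ => ?_
  by_cases h : P ω = 0
  · simp [h]
  rw [Real.log_prod (fun i _ => (mass_pos P hP (fun ω => f ω i) ω h).ne'), ← Finset.sum_neg_distrib, Finset.mul_sum]

include hP hP1 in
lemma fano {B : Type} [Fintype B] {M : ℕ} (hM : 1 ≤ M) (mm : Ω → Fin M) (f : Ω → B) (ψ : B → Fin M) (ε : ℝ)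
    (hε : ∑ ω, P ω * (if ψ (f ω) ≠ mm ω then 1 else 0) ≤ ε) :
    Hk P (fun ω => (mm ω, f ω)) ≤ Hk P f + Real.log 2 + ε * Real.log M := by
  have hM0 : (0:ℝ) < M := by exact_mod_cast hM
  have := gibbs P hP hP1 (fun ω => (mm ω, f ω)) (fun z => mass P f z.2 * (if ψ z.2 = z.1 then (1 / 2 : ℝ) else 1 / (2 * (M : ℝ))))
    (fun z => mul_nonneg (mass_nonneg P hP _ _) (by split_ifs <;> positivity))
    (by
      rw [Fintype.sum_prod_type, Finset.sum_comm]
      simp only [← Finset.mul_sum]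
      calc _ ≤ ∑ b, mass P f b * 1 := by
            refine Finset.sum_le_sum fun b _ => mul_le_mul_of_nonneg_left ?_ (mass_nonneg P hP _ _)
            calc _ ≤ ∑ m : Fin M, ((if ψ b = m then 1 / 2 else 0) + 1 / (2 * (M:ℝ))) := by
                  refine Finset.sum_le_sum fun m _ => ?_
                  split_ifs
                  · have : (0:ℝ) ≤ 1 / (2 * M) := by positivity
                    linarith
                  · linarith
              _ = 1 := by
                  rw [Finset.sum_add_distrib]; simp; field_simp; norm_num
        _ = 1 := by simp [mass_total P hP1]
        _ ≤ 1 := le_rfl)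
    (fun ω h => mul_pos (mass_pos P hP f ω h) (by split_ifs <;> positivity))
  refine this.trans ?_
  have e : ∀ ω, P ω * - Real.log (mass P f (f ω) * (if ψ (f ω) = mm ω then (1 / 2 : ℝ) else 1 / (2 * (M : ℝ)))) =
      P ω * - Real.log (mass P f (f ω)) + P ω * Real.log 2 + P ω * (if ψ (f ω) ≠ mm ω then 1 else 0) * Real.log M := by
    intro ω
    by_cases h : P ω = 0
    · simp [h]
    rw [Real.log_mul (mass_pos P hP f ω h).ne' (by split_ifs <;> positivity)]
    by_cases h2 : ψ (f ω) = mm ω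
    · simp [h2]; ring
    · simp only [h2, if_false, ne_eq, not_false_eq_true, if_true]
      rw [one_div, Real.log_inv, Real.log_mul (by norm_num) hM0.ne']
      ring
  simp only [e]
  rw [Finset.sum_add_distrib, Finset.sum_add_distrib, ← Finset.sum_mul, ← Finset.sum_mul, hP1, one_mul]
  have hl : 0 ≤ Real.log M := Real.log_nonneg (by exact_mod_cast hM)
  have := mul_le_mul_of_nonneg_right hε hl
  unfold Hk
  linarith

end ent
end PartG

section PartI
open Classical
open Real (negMulLog)

lemma mass_eq' {Ω A : Type} [Fintype Ω] (P : Ω → ℝ) (f : Ω → A) (a : A) :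
    mass P f a = ∑ ω, P ω * (if f ω = a then 1 else 0) := by
  unfold mass
  refine Finset.sum_congr rfl fun ω _ => ?_
  split_ifs <;> simp

section conv
set_option linter.unusedSectionVars false
variable {S X Y : Type} [Fintype S] [Fintype X] [Fintype Y] [Nonempty Y] (ps : S → ℝ) (w : X → S → Y → ℝ)
  (hps : ∀ s, 0 ≤ ps s) (hps1 : ∑ s, ps s = 1) (hw : ∀ x s y, 0 ≤ w x s y)
  (hw1 : ∀ x s, ∑ y, w x s y = 1) {n M : ℕ} (hM : 1 ≤ M)
  (e : Fin M → (Fin n → S) → (Fin n → Y) → Fin n → X) (he : ∀ m, Causal (e m))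

def PP (ω : Fin M × (Fin n → S) × (Fin n → Y)) : ℝ :=
  (1 / M) * ∏ i, ps (ω.2.1 i) * w (e ω.1 ω.2.1 ω.2.2 i) (ω.2.1 i) (ω.2.2 i)

lemma PP_sum (F : Fin M × (Fin n → S) × (Fin n → Y) → ℝ) :
    ∑ ω, PP ps w e ω * F ω = (1 / M) * ∑ m, EE ps w (e m) (fun s y => F (m, s, y)) := by
  simp only [PP, Fintype.sum_prod_type, EE, Finset.mul_sum]
  refine Finset.sum_congr rfl fun m _ => Finset.sum_congr rfl fun s _ => Finset.sum_congr rfl fun y _ => ?_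
  ring

include hps hw in
lemma PP_nonneg (ω : Fin M × (Fin n → S) × (Fin n → Y)) : 0 ≤ PP ps w e ω :=
  mul_nonneg (by positivity) (Finset.prod_nonneg fun i _ => mul_nonneg (hps _) (hw _ _ _))

include hw1 he in
lemma PP_sum_S (F : Fin M → (Fin n → S) → ℝ) :
    ∑ ω, PP ps w e ω * F ω.1 ω.2.1 = (1 / M) * ∑ m, ∑ s : Fin n → S, (∏ i, ps (s i)) * F m s := by
  rw [PP_sum]
  congr 1
  refine Finset.sum_congr rfl fun m _ => ?_
  rw [EE_noncausal]
  refine Finset.sum_congr rfl fun s _ => ?_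
  dsimp only
  rw [← Finset.sum_mul, causal_sum (fun i y b => w (e m s y i) (s i) b), one_mul]
  · intro i y y' h; simp only [he m s y y' i h]
  · intro i y; exact hw1 _ _

include hps1 hw1 he hM in
lemma PP_one : ∑ ω, PP ps w e ω = 1 := by
  have := PP_sum_S ps w hw1 e he (fun _ _ => 1)
  simp only [mul_one] at this
  rw [this]
  simp only [pi_sum_one ps hps1]
  have hM0 : (M:ℝ) ≠ 0 := by positivity
  simp [hM0]

include hw1 he in
lemma PP_tail (i : Fin n) (G : Fin M → (Fin n → S) → (Fin n → Y) → Y → ℝ)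
    (hG : ∀ m s y y', (∀ j < i, y j = y' j) → G m s y = G m s y') :
    ∑ ω, PP ps w e ω * G ω.1 ω.2.1 ω.2.2 (ω.2.2 i) =
    ∑ ω, PP ps w e ω * ∑ b, w (e ω.1 ω.2.1 ω.2.2 i) (ω.2.1 i) b * G ω.1 ω.2.1 ω.2.2 b := by
  rw [PP_sum, PP_sum]
  congr 1
  refine Finset.sum_congr rfl fun m _ => ?_
  rw [EE_noncausal, EE_noncausal]
  refine Finset.sum_congr rfl fun s _ => ?_
  congr 1
  apply causal_tail (fun i y b => w (e m s y i) (s i) b)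
  · intro i y y' h; simp only [he m s y y' i h]
  · intro i y; exact hw1 _ _
  · exact hG m s

include hps1 hw1 he hM in
lemma mass_Si (i : Fin n) (a : S) : mass (PP ps w e) (fun ω => ω.2.1 i) a = ps a := by
  rw [mass_eq', PP_sum_S ps w hw1 e he (fun _ s => if s i = a then 1 else 0)]
  have : ∑ s : Fin n → S, (∏ i, ps (s i)) * (if s i = a then 1 else 0) = ps a := by
    rw [pi_marg1 ps hps1 (fun b => if b = a then 1 else 0) i]
    simp
  rw [this]
  have hM0 : (M:ℝ) ≠ 0 := by positivity
  simp [hM0]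

include hw1 he in
lemma mass_MS (m : Fin M) (t : Fin n → S) :
    mass (PP ps w e) (fun ω => (ω.1, ω.2.1)) (m, t) = (1 / M) * ∏ i, ps (t i) := by
  have h0 := PP_sum_S ps w hw1 e he (fun m' s => if m' = m then (if s = t then 1 else 0) else 0)
  have h1 : mass (PP ps w e) (fun ω => (ω.1, ω.2.1)) (m, t) = ∑ ω, PP ps w e ω *
      if ω.1 = m then (if ω.2.1 = t then 1 else 0) else 0 := by
    rw [mass_eq']
    refine Finset.sum_congr rfl fun ω _ => ?_
    simp only [Prod.mk.injEq, ite_and]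
  rw [h1, h0]
  simp only [mul_ite, mul_one, mul_zero]
  congr 1
  rw [Finset.sum_eq_single m]
  · simp
  · intro b _ hb; simp [hb]
  · simp

include hps1 hps hw hw1 he hM in
lemma Hk_MS : Hk (PP ps w e) (fun ω => (ω.1, ω.2.1)) =
    Real.log M + ∑ i, Hk (PP ps w e) (fun ω => ω.2.1 i) := by
  have hM0 : (M:ℝ) ≠ 0 := by positivity
  simp only [Hk, mass_Si ps w hps1 hw1 hM e he, mass_MS ps w hw1 e he]
  have h1 := PP_one ps w hps1 hw1 hM e he
  rw [Finset.sum_comm]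
  have h2 : Real.log M = ∑ ω, PP ps w e ω * Real.log M := by rw [← Finset.sum_mul, h1, one_mul]
  refine Eq.trans ?_ (congrArg (· + _) h2.symm)
  rw [← Finset.sum_add_distrib]
  refine Finset.sum_congr rfl fun ω _ => ?_
  by_cases h : PP ps w e ω = 0
  · simp [h]
  have hp : ∀ i, ps (ω.2.1 i) ≠ 0 := by
    intro i hi
    apply h
    rw [PP, Finset.prod_eq_zero (Finset.mem_univ i) (by rw [hi, zero_mul]), mul_zero]
  rw [one_div, Real.log_mul (inv_ne_zero hM0) (Finset.prod_ne_zero_iff.2 fun i _ => hp i), Real.log_inv,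
    Real.log_prod (fun i _ => hp i), ← Finset.mul_sum, Finset.sum_neg_distrib]
  ring

def TT (k : ℕ) (ω : Fin M × (Fin n → S) × (Fin n → Y)) : Fin M × (Fin n → Y ⊕ S) :=
  (ω.1, fun j => if j.1 < k then Sum.inl (ω.2.2 j) else Sum.inr (ω.2.1 j))

def UU (i : Fin n) (ω : Fin M × (Fin n → S) × (Fin n → Y)) : Fin M × (Fin n → Option (Y ⊕ S)) :=
  (ω.1, fun j => if j < i then some (Sum.inl (ω.2.2 j)) else if j = i then none else some (Sum.inr (ω.2.1 j)))

lemma UU_S (P : Fin M × (Fin n → S) × (Fin n → Y) → ℝ) (i : Fin n) :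
    Hk P (fun ω => (UU i ω, ω.2.1 i)) = Hk P (TT i.1) := by
  apply Hk_congr
  rintro ⟨m, s, y⟩ ⟨m', s', y'⟩
  simp only [UU, TT, Prod.mk.injEq, funext_iff]
  constructor
  · rintro ⟨⟨h1, h2⟩, h3⟩
    refine ⟨h1, fun j => ?_⟩
    have h := h2 j
    by_cases hj : j < i
    · have hj' := Fin.lt_def.1 hj
      simp only [hj, hj', if_true, Option.some.injEq] at h ⊢; exact h
    · have hj' := mt Fin.lt_def.2 hj
      by_cases hji : j = i
      · subst hji; simp only [hj', if_false, h3]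
      · simp only [hj, hji, hj', if_false, Option.some.injEq] at h ⊢; exact h
  · rintro ⟨h1, h2⟩
    refine ⟨⟨h1, fun j => ?_⟩, ?_⟩
    · have h := h2 j
      by_cases hj : j < i
      · have hj' := Fin.lt_def.1 hj
        simp only [hj, hj', if_true, Option.some.injEq] at h ⊢; exact h
      · have hj' := mt Fin.lt_def.2 hj
        by_cases hji : j = i
        · subst hji; simp
        · simp only [hj, hji, hj', if_false, Option.some.injEq] at h ⊢; exact h
    · have h := h2 i
      simpa using h

lemma UU_Y (P : Fin M × (Fin n → S) × (Fin n → Y) → ℝ) (i : Fin n) :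
    Hk P (fun ω => (UU i ω, ω.2.2 i)) = Hk P (TT (i.1 + 1)) := by
  apply Hk_congr
  rintro ⟨m, s, y⟩ ⟨m', s', y'⟩
  simp only [UU, TT, Prod.mk.injEq, funext_iff]
  constructor
  · rintro ⟨⟨h1, h2⟩, h3⟩
    refine ⟨h1, fun j => ?_⟩
    have h := h2 j
    by_cases hj : j < i
    · have hj' : j.1 < i.1 + 1 := by have := Fin.lt_def.1 hj; omega
      simp only [hj, hj', if_true, Option.some.injEq] at h ⊢; exact h
    · by_cases hji : j = i
      · subst hji; simp [h3]
      · have hj' : ¬ j.1 < i.1 + 1 := by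
          have := mt Fin.lt_def.2 hj; have := mt Fin.ext hji; omega
        simp only [hj, hji, hj', if_false, Option.some.injEq] at h ⊢; exact h
  · rintro ⟨h1, h2⟩
    refine ⟨⟨h1, fun j => ?_⟩, ?_⟩
    · have h := h2 j
      by_cases hj : j < i
      · have hj' : j.1 < i.1 + 1 := by have := Fin.lt_def.1 hj; omega
        simp only [hj, hj', if_true, Option.some.injEq] at h ⊢; exact h
      · by_cases hji : j = i
        · subst hji; simp
        · have hj' : ¬ j.1 < i.1 + 1 := by
            have := mt Fin.lt_def.2 hj; have := mt Fin.ext hji; omega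
          simp only [hj, hji, hj', if_false, Option.some.injEq] at h ⊢; exact h
    · have h := h2 i
      simpa using h

lemma TT_zero (P : Fin M × (Fin n → S) × (Fin n → Y) → ℝ) :
    Hk P (TT 0) = Hk P (fun ω => (ω.1, ω.2.1)) := by
  apply Hk_congr
  rintro ⟨m, s, y⟩ ⟨m', s', y'⟩
  simp [TT, funext_iff]

lemma TT_n (P : Fin M × (Fin n → S) × (Fin n → Y) → ℝ) :
    Hk P (TT n) = Hk P (fun ω => (ω.1, ω.2.2)) := by
  apply Hk_congr
  rintro ⟨m, s, y⟩ ⟨m', s', y'⟩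
  simp [TT, funext_iff]

def QQ (i : Fin n) (u : Fin M × (Fin n → Option (Y ⊕ S))) (s : S) (x : X) : ℝ :=
  mass (PP ps w e) (fun ω => (UU i ω, ω.2.1 i, e ω.1 ω.2.1 ω.2.2 i)) (u, s, x)

lemma QQ_sum (i : Fin n) (G : S → X → ℝ) (u : Fin M × (Fin n → Option (Y ⊕ S))) :
    ∑ s, ∑ x, QQ ps w e i u s x * G s x =
      ∑ ω, PP ps w e ω * (if UU i ω = u then G (ω.2.1 i) (e ω.1 ω.2.1 ω.2.2 i) else 0) := by
  have := mass_sum (PP ps w e) (fun ω => (UU i ω, ω.2.1 i, e ω.1 ω.2.1 ω.2.2 i))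
    (fun z => if z.1 = u then G z.2.1 z.2.2 else 0)
  simp only at this
  rw [this, Fintype.sum_prod_type, Finset.sum_eq_single u]
  · rw [Fintype.sum_prod_type]; simp [QQ]
  · intro b _ hb; simp [hb]
  · simp

lemma QQ_S (i : Fin n) (u : Fin M × (Fin n → Option (Y ⊕ S))) (s : S) :
    ∑ x, QQ ps w e i u s x = mass (PP ps w e) (fun ω => (UU i ω, ω.2.1 i)) (u, s) := by
  have := QQ_sum ps w e i (fun s' _ => if s' = s then 1 else 0) u
  rw [Finset.sum_eq_single s (by intro b _ hb; simp [hb]) (by simp)] at this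
  simp only [if_true, mul_one] at this
  rw [this, mass_eq']
  refine Finset.sum_congr rfl fun ω _ => ?_
  simp only [Prod.mk.injEq, ite_and]

include hw1 he in
lemma QQ_Y (i : Fin n) (u : Fin M × (Fin n → Option (Y ⊕ S))) (y : Y) :
    ∑ s, ∑ x, QQ ps w e i u s x * w x s y = mass (PP ps w e) (fun ω => (UU i ω, ω.2.2 i)) (u, y) := by
  rw [QQ_sum ps w e i (fun s x => w x s y) u, mass_eq']
  have := PP_tail ps w hw1 e he i (fun m s yy b => if (UU i (m, s, yy), b) = (u, y) then 1 else 0) (by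
    intro m s y1 y2 h
    have : UU i (m, s, y1) = UU i (m, s, y2) := by
      simp only [UU, Prod.mk.injEq, true_and]
      funext j
      by_cases hj : j < i
      · simp [hj, h j hj]
      · simp [hj]
    simp only [this])
  simp only [Prod.mk.eta] at this
  refine Eq.trans ?_ (this.symm.trans (Finset.sum_congr rfl fun ω _ => by congr))
  refine Finset.sum_congr rfl fun ω _ => ?_
  congr 1
  by_cases h : UU i ω = u
  · simp [h]
  · simp [h]

include hps hw hw1 he in
lemma VV_QQ (i : Fin n) : VV w (QQ ps w e i) =
    Hk (PP ps w e) (fun ω => ω.2.2 i) - Hk (PP ps w e) (fun ω => ω.2.1 i) +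
      (Hk (PP ps w e) (TT i.1) - Hk (PP ps w e) (TT (i.1 + 1))) := by
  have hP := PP_nonneg ps w hps hw e
  rw [VV_eq w hw hw1 (QQ ps w e i) (fun u s x => mass_nonneg _ hP _ _)]
  rw [← UU_S, ← UU_Y, Hk_eq, Hk_eq, Hk_eq, Hk_eq]
  have hm : ∀ {A : Type} [Fintype A] (f : Fin M × (Fin n → S) × (Fin n → Y) → A) (a : A),
      ∑ u, mass (PP ps w e) (fun ω => (UU i ω, f ω)) (u, a) = mass (PP ps w e) f a := by
    intro A _ f a
    simp only [mass_eq']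
    rw [Finset.sum_comm]
    refine Finset.sum_congr rfl fun ω _ => ?_
    rw [← Finset.mul_sum]
    congr 1
    simp [ite_and]
  have e1 : ∀ y, ∑ s, ∑ x, (∑ u, QQ ps w e i u s x) * w x s y = mass (PP ps w e) (fun ω => ω.2.2 i) y := by
    intro y
    rw [← hm (fun ω => ω.2.2 i) y]
    simp only [← QQ_Y ps w hw1 e he i]
    symm
    rw [Finset.sum_comm]
    refine Finset.sum_congr rfl fun s _ => ?_
    rw [Finset.sum_comm]
    refine Finset.sum_congr rfl fun x _ => ?_
    rw [Finset.sum_mul]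
  have e2 : ∀ s, ∑ x, ∑ u, QQ ps w e i u s x = mass (PP ps w e) (fun ω => ω.2.1 i) s := by
    intro s
    rw [← hm (fun ω => ω.2.1 i) s, Finset.sum_comm]
    simp only [QQ_S]
  simp only [e1, e2, hh, QQ_S, QQ_Y ps w hw1 e he, Finset.sum_sub_distrib]
  simp only [Fintype.sum_prod_type]

include hps1 hw1 he hM in
lemma QQ_marg (i : Fin n) (s : S) : ∑ u, ∑ x, QQ ps w e i u s x = ps s := by
  rw [← mass_Si ps w hps1 hw1 hM e he i s]
  simp only [QQ_S, mass_eq']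
  rw [Finset.sum_comm]
  refine Finset.sum_congr rfl fun ω _ => ?_
  rw [← Finset.mul_sum]
  congr 1
  simp [ite_and]

include hps hps1 hw hw1 he hM in
lemma converse_bound (ψ : (Fin n → Y) → Fin M) (ε : ℝ)
    (hε : ∀ m, EE ps w (e m) (fun _ y => if ψ y ≠ m then 1 else 0) ≤ ε) :
    (1 - ε) * Real.log M - Real.log 2 ≤ ∑ i : Fin n, VV w (QQ ps w e i) := by
  have hP := PP_nonneg ps w hps hw e
  have hP1 := PP_one ps w hps1 hw1 hM e he
  have hM0 : (0:ℝ) < M := by positivity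
  simp only [VV_QQ ps w hps hw hw1 e he, Finset.sum_add_distrib, Finset.sum_sub_distrib]
  have htel : ∑ i : Fin n, Hk (PP ps w e) (TT i.1) - ∑ i : Fin n, Hk (PP ps w e) (TT (i.1 + 1)) =
      Hk (PP ps w e) (TT 0) - Hk (PP ps w e) (TT n) := by
    rw [← Finset.sum_sub_distrib, Fin.sum_univ_eq_sum_range (fun k => Hk (PP ps w e) (TT k) - Hk (PP ps w e) (TT (k + 1))),
      Finset.sum_range_sub']
  have h1 := Hk_MS ps w hps hps1 hw hw1 hM e he
  have h2 := fano (PP ps w e) hP hP1 hM (fun ω => ω.1) (fun ω => ω.2.2) ψ ε (by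
    rw [PP_sum]
    calc _ ≤ (1 / (M:ℝ)) * ∑ m : Fin M, ε := by
          refine mul_le_mul_of_nonneg_left (Finset.sum_le_sum fun m _ => ?_) (by positivity)
          convert hε m
      _ = ε := by simp; field_simp)
  have h3 := Hk_pi (PP ps w e) hP hP1 (fun ω => ω.2.2)
  rw [htel, TT_zero, TT_n, h1]
  linarith

include hps hps1 hw hw1 he hM in
lemma converse (ψ : (Fin n → Y) → Fin M) (ε : ℝ)
    (hε : ∀ m, EE ps w (e m) (fun _ y => if ψ y ≠ m then 1 else 0) ≤ ε) (N : ℕ)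
    (hN : Fintype.card X * Fintype.card S + 1 ≤ N) (C : ℝ)
    (hC : ∀ q : Fin N → S → X → ℝ, (∀ u s x, 0 ≤ q u s x) → (∀ s, ∑ u, ∑ x, q u s x = ps s) → VV w q ≤ C) :
    (1 - ε) * Real.log M - Real.log 2 ≤ n * C := by
  refine (converse_bound ps w hps hps1 hw hw1 hM e he ψ ε hε).trans ?_
  calc _ ≤ ∑ i : Fin n, C := by
        refine Finset.sum_le_sum fun i _ => ?_
        obtain ⟨q', h0, hs, hv⟩ := card_reduce w hw hw1 (QQ ps w e i)
          (fun u s x => mass_nonneg _ (PP_nonneg ps w hps hw e) _ _) N hN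
        rw [← hv]
        apply hC q' h0
        intro s
        rw [Finset.sum_comm]
        simp only [hs]
        rw [Finset.sum_comm]
        exact QQ_marg ps w hps1 hw1 hM e he i s
    _ = n * C := by simp

end conv
end PartI

section PartJ
open Classical

lemma pmf_sum {A : Type} [Fintype A] (p : PMF A) : ∑ a, (p a).toReal = 1 := by
  have := p.tsum_coe
  rw [tsum_fintype] at this
  rw [← ENNReal.toReal_sum (fun a _ => p.apply_ne_top a), this, ENNReal.toReal_one]

def RSet {S X Y : Type} [Fintype S] [Fintype X] [Fintype Y] (ps : S → ℝ) (w : X → S → Y → ℝ) (N : ℕ) : Set ℝ :=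
  {r | ∃ q : Fin N → S → X → ℝ, (∀ u s x, 0 ≤ q u s x) ∧ (∀ s, ∑ u, ∑ x, q u s x = ps s) ∧ r = VV w q}

lemma set_eq {S X Y : Type} [Fintype S] [Fintype X] [Fintype Y] [Nonempty X] (PS : PMF S)
    (W : X → S → PMF Y) (N : ℕ) (hN : 0 < N) :
    {r : ℝ | ∃ PXU : S → PMF (X × Fin N), r =
      mutualInfo (fun q : Fin N × Y => ∑ s : S, ∑ x : X,
        (PS s).toReal * ((PXU s) (x, q.1)).toReal * ((W x s) q.2).toReal) -
      mutualInfo (fun q : Fin N × S => ∑ x : X, ∑ y : Y,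
        (PS q.2).toReal * ((PXU q.2) (x, q.1)).toReal * ((W x q.2) y).toReal)} =
    RSet (fun s => (PS s).toReal) (fun x s y => (W x s y).toReal) N := by
  have hval : ∀ PXU : S → PMF (X × Fin N), 
      mutualInfo (fun q : Fin N × Y => ∑ s : S, ∑ x : X,
        (PS s).toReal * ((PXU s) (x, q.1)).toReal * ((W x s) q.2).toReal) -
      mutualInfo (fun q : Fin N × S => ∑ x : X, ∑ y : Y,
        (PS q.2).toReal * ((PXU q.2) (x, q.1)).toReal * ((W x q.2) y).toReal) =
      VV (fun x s y => (W x s y).toReal) (fun u s x => (PS s).toReal * ((PXU s) (x, u)).toReal) := by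
    intro PXU
    simp only [VV, ← Finset.mul_sum, pmf_sum, mul_one]
  ext r
  constructor
  · rintro ⟨PXU, rfl⟩
    rw [hval]
    refine ⟨_, fun u s x => by positivity, ?_, rfl⟩
    intro s
    have := pmf_sum (PXU s)
    rw [Fintype.sum_prod_type, Finset.sum_comm] at this
    simp only [← Finset.mul_sum, this, mul_one]
  · rintro ⟨q, hq0, hq, rfl⟩
    obtain ⟨x0⟩ := ‹Nonempty X›
    have hex : ∀ s, ∃ p : PMF (X × Fin N), ∀ x u, (PS s).toReal * (p (x, u)).toReal = q u s x := by
      intro s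
      have hq' : ∑ u, ∑ x, q u s x = (PS s).toReal := hq s
      by_cases hs : (PS s).toReal = 0
      · refine ⟨PMF.pure (x0, ⟨0, hN⟩), fun x u => ?_⟩
        rw [hs, zero_mul]
        rw [hs] at hq'
        rw [Finset.sum_eq_zero_iff_of_nonneg (fun u _ => Finset.sum_nonneg fun x _ => hq0 _ _ _)] at hq'
        have := hq' u (Finset.mem_univ _)
        rw [Finset.sum_eq_zero_iff_of_nonneg (fun x _ => hq0 _ _ _)] at this
        exact (this x (Finset.mem_univ _)).symm
      · have hp : 0 < (PS s).toReal := lt_of_le_of_ne ENNReal.toReal_nonneg (Ne.symm hs)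
        refine ⟨PMF.ofFintype (fun z => ENNReal.ofReal (q z.2 s z.1 / (PS s).toReal)) ?_, fun x u => ?_⟩
        · rw [← ENNReal.ofReal_sum_of_nonneg (fun z _ => div_nonneg (hq0 _ _ _) hp.le), ← Finset.sum_div,
            Fintype.sum_prod_type, Finset.sum_comm, hq', div_self hs, ENNReal.ofReal_one]
        · rw [PMF.ofFintype_apply, ENNReal.toReal_ofReal (div_nonneg (hq0 _ _ _) hp.le)]
          field_simp
    choose PXU hPXU using hex
    refine ⟨PXU, ?_⟩
    rw [hval]
    congr 1
    funext u s x
    rw [hPXU]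

lemma avgError_eq {S X Y Θ : Type} [Fintype S] [Fintype X] [Fintype Y]
    (W : Θ → X → S → PMF Y) (PS : PMF S) {n M : ℕ}
    (φ : (i : Fin n) → Fin M → (Fin i.val → Y) → (Fin n → S) → X)
    (ψ : (Fin n → Y) → Fin M) (m : Fin M) (θ : Θ) :
    avgErrorFB W PS φ ψ m θ = EE (fun s => (PS s).toReal) (fun x s y => (W θ x s y).toReal)
      (fun s y i => φ i m (fun j => y ⟨j.1, lt_trans j.2 i.2⟩) s) (fun _ y => if ψ y ≠ m then 1 else 0) := by
  rw [EE_noncausal, avgErrorFB]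

lemma main_conv {S X Y Θ : Type} [Fintype S] [Fintype X] [Fintype Y] [Nonempty Y]
    (W : Θ → X → S → PMF Y) (PS : PMF S) (N : ℕ) (hN : Fintype.card X * Fintype.card S + 1 ≤ N)
    (R : ℝ) (hR : IsAchievableFB W PS R) (θ : Θ) :
    R ≤ sSup (RSet (fun s => (PS s).toReal) (fun x s y => (W θ x s y).toReal) N) := by
  set C := sSup (RSet (fun s => (PS s).toReal) (fun x s y => (W θ x s y).toReal) N) with hC
  have hbdd : BddAbove (RSet (fun s => (PS s).toReal) (fun x s y => (W θ x s y).toReal) N) := by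
    refine ⟨Fintype.card Y + Fintype.card (Fin N) * Fintype.card S, ?_⟩
    rintro r ⟨q, h0, h1, rfl⟩
    exact VV_bdd _ (pmf_sum PS) _ (fun _ _ _ => ENNReal.toReal_nonneg) (fun x s => pmf_sum _) q h0 h1
  obtain ⟨hR0, hR⟩ := hR
  by_contra hlt
  push Not at hlt
  set g := R - C with hg
  have hg0 : 0 < g := sub_pos.2 hlt
  set η := min (1 / 2) (g / (2 * (1 + R))) with hη
  have hη0 : 0 < η := lt_min (by norm_num) (by positivity)
  have hη1 : η ≤ 1 / 2 := min_le_left _ _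
  have hη2 : η * (1 + R) ≤ g / 2 := by
    have := min_le_right (1 / 2) (g / (2 * (1 + R)))
    rw [← hη, le_div_iff₀ (by positivity)] at this
    linarith
  obtain ⟨n₀, hn₀⟩ := hR η ⟨hη0, by linarith⟩ η ⟨hη0, by linarith⟩
  obtain ⟨n1, hn1⟩ := exists_nat_gt (Real.log 2 / (g / 2))
  set n := max n₀ (n1 + 1) with hn
  have hnn : (n1:ℝ) + 1 ≤ n := by exact_mod_cast le_max_right n₀ (n1 + 1)
  have hnpos : (0:ℝ) < n := by have : (0:ℝ) ≤ n1 := by positivity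
                               linarith
  obtain ⟨M, hM, φ, ψ, hrate, herr⟩ := hn₀ n (le_max_left _ _)
  have hcv := converse (fun s => (PS s).toReal) (fun x s y => (W θ x s y).toReal)
    (fun _ => ENNReal.toReal_nonneg) (pmf_sum PS) (fun _ _ _ => ENNReal.toReal_nonneg) (fun x s => pmf_sum _) hM
    (fun m s y i => φ i m (fun j => y ⟨j.1, lt_trans j.2 i.2⟩) s) (by
      intro m s y y' i h
      dsimp only
      congr 1
      funext j
      exact h _ (Fin.lt_def.2 j.2)) ψ η (by
      intro m
      rw [← avgError_eq]
      exact herr m θ) N hN C (by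
      intro q h0 h1
      exact le_csSup hbdd ⟨q, h0, h1, rfl⟩)
  rw [ge_iff_le, le_div_iff₀ hnpos] at hrate
  rw [div_lt_iff₀ (by positivity)] at hn1
  have h1 : (1 - η) * ((R - η) * n) ≤ (1 - η) * Real.log M :=
    mul_le_mul_of_nonneg_left hrate (by linarith)
  have h2 : C + g / 2 ≤ (1 - η) * (R - η) := by nlinarith
  have h3 := mul_le_mul_of_nonneg_right h2 hnpos.le
  nlinarith

lemma main_ach {S X Y Θ : Type} [Fintype S] [Fintype X] [Fintype Y] [Nonempty X] [Nonempty Y] [Fintype Θ] [Nonempty Θ]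
    (W : Θ → X → S → PMF Y) (PS : PMF S) (N : ℕ)
    (R : ℝ) (hR0 : 0 ≤ R)
    (hR : ∀ θ, R < sSup (RSet (fun s => (PS s).toReal) (fun x s y => (W θ x s y).toReal) N)) :
    IsAchievableFB W PS R := by
  have hex : ∀ θ, ∃ q : Fin N → S → X → ℝ, (∀ u s x, 0 ≤ q u s x) ∧ (∀ s, ∑ u, ∑ x, q u s x = (PS s).toReal) ∧
      R < VV (fun x s y => (W θ x s y).toReal) q := by
    intro θ
    have hne : (RSet (fun s => (PS s).toReal) (fun x s y => (W θ x s y).toReal) N).Nonempty := by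
      by_contra h
      rw [Set.not_nonempty_iff_eq_empty] at h
      have := hR θ
      rw [h, Real.sSup_empty] at this
      linarith
    obtain ⟨r, ⟨q, h0, h1, rfl⟩, h2⟩ := exists_lt_of_lt_csSup hne (hR θ)
    exact ⟨q, h0, h1, h2⟩
  choose q h0 h1 h2 using hex
  refine ⟨hR0, fun ε hε γ hγ => ?_⟩
  obtain ⟨n₀, hn⟩ := achiev (fun s => (PS s).toReal) (fun θ x s y => (W θ x s y).toReal)
    (fun _ => ENNReal.toReal_nonneg) (pmf_sum PS) (fun _ _ _ _ => ENNReal.toReal_nonneg) (fun _ x s => pmf_sum _)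
    R hR0 q h0 h1 h2 ε hε.1
  refine ⟨n₀, fun n hnn => ?_⟩
  obtain ⟨M, hM, e, ψ, hr, hc, herr⟩ := hn n hnn
  obtain ⟨y0⟩ := ‹Nonempty Y›
  refine ⟨M, hM, fun i m yp s => e m s (fun j => if h : j.1 < i.1 then yp ⟨j.1, h⟩ else y0) i, ψ, ?_, ?_⟩
  · have := hγ.1
    linarith
  · intro m θ
    rw [avgError_eq]
    have : (fun (s : Fin n → S) (y : Fin n → Y) (i : Fin n) =>
        e m s (fun j => if h : j.1 < i.1 then (fun j : Fin i.1 => y ⟨j.1, lt_trans j.2 i.2⟩) ⟨j.1, h⟩ else y0) i) = e m := by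
      funext s y i
      apply hc m
      intro j hj
      have := Fin.lt_def.1 hj
      simp [this]
    rw [this]
    exact herr m θ

lemma zero_ach {S X Y Θ : Type} [Fintype S] [Fintype X] [Fintype Y] [Nonempty X]
    (W : Θ → X → S → PMF Y) (PS : PMF S) : IsAchievableFB W PS 0 := by
  obtain ⟨x0⟩ := ‹Nonempty X›
  refine ⟨le_rfl, fun ε hε γ hγ => ⟨0, fun n _ => ⟨1, le_rfl, fun _ _ _ _ => x0, fun _ => 0, ?_, ?_⟩⟩⟩
  · have := hγ.1
    simp; linarith
  · intro m θ
    have : m = 0 := Subsingleton.elim _ _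
    subst this
    simp [avgErrorFB]
    exact hε.1.le

end PartJ

/-- Theorem 5: the feedback capacity of the compound DMC with states known
non-causally at the transmitter and feedback equals
`min_θ sup_{P_{XU|S}} [ I(U;Y_θ) − I(U;S) ]`,
with auxiliary alphabet `𝒰 = Fin (|𝒳|·|𝒮| + |Θ|)` and informations computed
from `p_θ(u,s,x,y) = P_S(s)·P_{XU|S}(s)(x,u)·(W θ x s)(y)`. -/
theorem feedback_compound_capacity
    {Θ : Type} [Fintype Θ] [Nonempty Θ]
    (W : Θ → 𝒳 → 𝒮 → PMF 𝒴) (PS : PMF 𝒮) :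
    sSup {R : ℝ | IsAchievableFB W PS R} =
      Finset.univ.inf' Finset.univ_nonempty (fun θ : Θ =>
        sSup {r : ℝ |
          ∃ PXU : 𝒮 → PMF (𝒳 × Fin (Fintype.card 𝒳 * Fintype.card 𝒮 + Fintype.card Θ)),
            r =
              mutualInfo
                (fun q : Fin (Fintype.card 𝒳 * Fintype.card 𝒮 + Fintype.card Θ) × 𝒴 =>
                  ∑ s : 𝒮, ∑ x : 𝒳,
                    (PS s).toReal * ((PXU s) (x, q.1)).toReal * ((W θ x s) q.2).toReal) -
              mutualInfo
                (fun q : Fin (Fintype.card 𝒳 * Fintype.card 𝒮 + Fintype.card Θ) × 𝒮 =>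
                  ∑ x : 𝒳, ∑ y : 𝒴,
                    (PS q.2).toReal * ((PXU q.2) (x, q.1)).toReal * ((W θ x q.2) y).toReal)}) := by
  obtain ⟨s0, -⟩ := PS.support_nonempty
  have hΘ : 0 < Fintype.card Θ := Fintype.card_pos
  obtain ⟨θ0⟩ := ‹Nonempty Θ›
  rcases isEmpty_or_nonempty 𝒳 with hX | hX
  · have hl : {R : ℝ | IsAchievableFB W PS R} = ∅ := by
      rw [Set.eq_empty_iff_forall_notMem]
      rintro R ⟨-, hR⟩
      obtain ⟨n₀, h⟩ := hR (1 / 2) ⟨by norm_num, by norm_num⟩ (1 / 2) ⟨by norm_num, by norm_num⟩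
      obtain ⟨M, hM, φ, -⟩ := h (n₀ + 1) (by omega)
      exact hX.elim (φ ⟨0, by omega⟩ ⟨0, by omega⟩ (fun j => j.elim0) (fun _ => s0))
    rw [hl, Real.sSup_empty]
    symm
    apply le_antisymm
    · refine (Finset.inf'_le _ (Finset.mem_univ θ0)).trans (le_of_eq ?_)
      convert Real.sSup_empty
      rw [Set.eq_empty_iff_forall_notMem]
      rintro r ⟨PXU, -⟩
      obtain ⟨z, -⟩ := (PXU s0).support_nonempty
      exact hX.elim z.1
    · rw [Finset.le_inf'_iff]
      intro θ _
      refine le_of_eq ?_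
      symm
      convert Real.sSup_empty
      rw [Set.eq_empty_iff_forall_notMem]
      rintro r ⟨PXU, -⟩
      obtain ⟨z, -⟩ := (PXU s0).support_nonempty
      exact hX.elim z.1
  · obtain ⟨x0⟩ := id hX
    obtain ⟨y0, -⟩ := (W θ0 x0 s0).support_nonempty
    haveI : Nonempty 𝒴 := ⟨y0⟩
    haveI : Nonempty Θ := ⟨θ0⟩
    have hse : ∀ θ, _ := fun θ => set_eq PS (W θ) (Fintype.card 𝒳 * Fintype.card 𝒮 + Fintype.card Θ) (by omega)
    simp only [hse]
    have hcv : ∀ R, IsAchievableFB W PS R → R ≤ Finset.univ.inf' Finset.univ_nonempty (fun θ : Θ =>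
        sSup (RSet (fun s => (PS s).toReal) (fun x s y => (W θ x s y).toReal)
          (Fintype.card 𝒳 * Fintype.card 𝒮 + Fintype.card Θ))) := by
      intro R hR
      rw [Finset.le_inf'_iff]
      intro θ _
      exact main_conv W PS _ (by omega) R hR θ
    have hz := zero_ach W PS
    have hbdd : BddAbove {R : ℝ | IsAchievableFB W PS R} := ⟨_, fun R hR => hcv R hR⟩
    apply le_antisymm
    · exact csSup_le ⟨0, hz⟩ hcv
    · apply le_of_forall_lt_imp_le_of_dense
      intro r hr
      rcases lt_or_ge r 0 with h | h
      · exact h.le.trans (le_csSup hbdd hz)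
      · refine le_csSup hbdd (main_ach W PS (Fintype.card 𝒳 * Fintype.card 𝒮 + Fintype.card Θ) r h ?_)
        rw [Finset.lt_inf'_iff] at hr
        exact fun θ => hr θ (Finset.mem_univ _)

end CompoundFeedback
end
end

section
/- Let a, b be real numbers with a ≠ b and a + b ≠ 0. Then the function t ↦ ( Real.sqrt (b² + t) − Real.sqrt (a² + t) )² / (a + b)² is strictly decreasing on (0, ∞). -/
/-- The mismatch factor `t ↦ (√(b²+t) − √(a²+t))² / (a+b)²` of the compound
Gaussian dirty-paper channel is strictly decreasing in `t = T/Q` on `(0,∞)`. -/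
theorem mismatch_factor_strictAntiOn (a b : ℝ) (hne : a ≠ b) (hab : a + b ≠ 0) :
    StrictAntiOn
      (fun t : ℝ => (Real.sqrt (b ^ 2 + t) - Real.sqrt (a ^ 2 + t)) ^ 2 / (a + b) ^ 2)
      (Set.Ioi (0 : ℝ)) := by
  have key : ∀ t : ℝ, 0 < t →
      (Real.sqrt (b ^ 2 + t) - Real.sqrt (a ^ 2 + t)) ^ 2 / (a + b) ^ 2
        = (b - a) ^ 2 / (Real.sqrt (b ^ 2 + t) + Real.sqrt (a ^ 2 + t)) ^ 2 := by
    intro t ht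
    have hB : 0 < Real.sqrt (b ^ 2 + t) := Real.sqrt_pos.mpr (by positivity)
    have hA : 0 < Real.sqrt (a ^ 2 + t) := Real.sqrt_pos.mpr (by positivity)
    have h1 := Real.sq_sqrt (show 0 ≤ b ^ 2 + t by positivity)
    have h2 := Real.sq_sqrt (show 0 ≤ a ^ 2 + t by positivity)
    rw [div_eq_div_iff (by positivity) (by positivity), ← mul_pow, ← mul_pow]
    congr 1
    linear_combination h1 - h2
  intro s hs t ht hst
  have hs' : 0 < s := hs
  have ht' : 0 < t := ht
  show _ / _ < _ / _
  rw [key s hs', key t ht']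
  have hB : Real.sqrt (b ^ 2 + s) < Real.sqrt (b ^ 2 + t) :=
    Real.sqrt_lt_sqrt (by positivity) (by linarith)
  have hA : Real.sqrt (a ^ 2 + s) < Real.sqrt (a ^ 2 + t) :=
    Real.sqrt_lt_sqrt (by positivity) (by linarith)
  have hB0 : 0 < Real.sqrt (b ^ 2 + s) := Real.sqrt_pos.mpr (by positivity)
  have hA0 : 0 < Real.sqrt (a ^ 2 + s) := Real.sqrt_pos.mpr (by positivity)
  have hba : b - a ≠ 0 := sub_ne_zero.mpr hne.symm
  apply div_lt_div_of_pos_left (by positivity) (by positivity)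
  exact pow_lt_pow_left₀ (by linarith) (by positivity) two_ne_zero
end

section
/- Let P, N be real numbers with P > 0, N > 0, let K ≥ 1 be a natural number, and let ε be real with 0 ≤ ε < 1 and ε·(P + K·N) < N·(K − 1). Define f : ℝ → ℝ by f(x) = (1/(2K))·Real.log (1 + x/N) + (1/2)·Real.log (1 + (P − x)·(1 − ε)/(x + N + ε·(P − x))). Then for every x ∈ [0, P], f(x) ≤ f(0), and f(0) = (1/2)·Real.log (1 + P·(1 − ε)/(N + ε·P)). -/
/-- Achievable rate of the superposition scheme for the compound Gaussian
dirty-paper channel with `K` components: power `x` on the time-shared part,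
`P − x` on the common dirty-paper coded part. -/
noncomputable def rateFun (P N ε : ℝ) (K : ℕ) : ℝ → ℝ := fun x =>
  (1 / (2 * (K : ℝ))) * Real.log (1 + x / N) +
    (1 / 2) * Real.log (1 + (P - x) * (1 - ε) / (x + N + ε * (P - x)))

/-- First regime of the optimized lower bound: when `ε(P+KN) < N(K−1)`,
allocating all power to dirty-paper coding is optimal. -/
theorem dpc_regime_optimal (P N : ℝ) (hP : 0 < P) (hN : 0 < N) (K : ℕ) (hK : 1 ≤ K)
    (ε : ℝ) (hε0 : 0 ≤ ε) (hε1 : ε < 1)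
    (hth : ε * (P + (K : ℝ) * N) < N * ((K : ℝ) - 1)) :
    (∀ x ∈ Set.Icc (0 : ℝ) P, rateFun P N ε K x ≤ rateFun P N ε K 0) ∧
      rateFun P N ε K 0 = (1 / 2) * Real.log (1 + P * (1 - ε) / (N + ε * P)) := by
  have hK' : (1:ℝ) ≤ K := by exact_mod_cast hK
  have hA : 0 < N + ε * P := by positivity
  refine ⟨?_, by simp [rateFun]⟩
  rintro x ⟨hx0, hxP⟩
  have h1e : 0 < 1 - ε := by linarith
  have hPx : 0 ≤ P - x := by linarith
  have hD : 0 < x + N + ε * (P - x) := by positivity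
  have e1 : 1 + (P - x) * (1 - ε) / (x + N + ε * (P - x)) = (P + N) / (x + N + ε * (P - x)) := by
    rw [eq_div_iff hD.ne', add_mul, div_mul_cancel₀ _ hD.ne']; ring
  have e0 : 1 + P * (1 - ε) / (N + ε * P) = (P + N) / (N + ε * P) := by
    rw [eq_div_iff hA.ne', add_mul, div_mul_cancel₀ _ hA.ne']; ring
  have hb : 1 + x / N ≤ (1 + x / (K * N)) ^ K := by
    have h := one_add_mul_le_pow (a := x / (K * N))
      (by have : 0 ≤ x / (K * N) := by positivity
          linarith) K
    have h2 : (K:ℝ) * (x / (K * N)) = x / N := by field_simp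
    rwa [h2] at h
  have hl : Real.log (1 + x / N) ≤ K * Real.log (1 + x / (K * N)) := by
    rw [← Real.log_pow]
    exact Real.log_le_log (by positivity) hb
  have hc : 1 + x / (K * N) ≤ (x + N + ε * (P - x)) / (N + ε * P) := by
    have h3 : (x + N + ε * (P - x)) / (N + ε * P) = 1 + x * ((1 - ε) / (N + ε * P)) := by
      field_simp; ring
    rw [h3, div_eq_mul_one_div]
    have : 1 / (K * N) ≤ (1 - ε) / (N + ε * P) := by
      rw [div_le_div_iff₀ (by positivity) hA]; nlinarith
    gcongr
  have hl2 := Real.log_le_log (by positivity) hc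
  rw [Real.log_div hD.ne' hA.ne'] at hl2
  have hl3 : 1 / (2 * (K:ℝ)) * Real.log (1 + x / N) ≤ 1 / 2 * Real.log (1 + x / (K * N)) := by
    calc _ ≤ 1 / (2 * (K:ℝ)) * (K * Real.log (1 + x / (K * N))) := by gcongr
      _ = _ := by field_simp
  simp only [rateFun, sub_zero, zero_div, add_zero, Real.log_one, mul_zero, zero_add]
  rw [e1, e0, Real.log_div (by positivity) hD.ne', Real.log_div (by positivity) hA.ne']
  linarith
end

section
/- Let P, N be real numbers with P > 0, N > 0, let K ≥ 1 be a natural number, and let ε be real with (K − 1)/K ≤ ε ≤ 1. Define f : ℝ → ℝ by f(x) = (1/(2K))·Real.log (1 + x/N) + (1/2)·Real.log (1 + (P − x)·(1 − ε)/(x + N + ε·(P − x))). Then for every x ∈ [0, P], f(x) ≤ f(P), and f(P) = (1/(2K))·Real.log (1 + P/N). -/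
/-- Third regime of the optimized lower bound: when `ε ≥ (K−1)/K`,
pure time-sharing is optimal. -/
theorem time_sharing_regime_optimal (P N : ℝ) (hP : 0 < P) (hN : 0 < N)
    (K : ℕ) (hK : 1 ≤ K) (ε : ℝ)
    (hεlo : ((K : ℝ) - 1) / (K : ℝ) ≤ ε) (hεhi : ε ≤ 1) :
    (∀ x ∈ Set.Icc (0 : ℝ) P, rateFun P N ε K x ≤ rateFun P N ε K P) ∧
      rateFun P N ε K P = (1 / (2 * (K : ℝ))) * Real.log (1 + P / N) := by
  have hKpos : (0 : ℝ) < K := by exact_mod_cast hK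
  have hK1 : (1 : ℝ) ≤ K := by exact_mod_cast hK
  have hε0 : 0 ≤ ε := le_trans (div_nonneg (by linarith) hKpos.le) hεlo
  have hεK : 1 - ε ≤ 1 / (K : ℝ) := by
    have h : ((K : ℝ) - 1) / K = 1 - 1 / K := by field_simp
    linarith
  have hval : rateFun P N ε K P = (1 / (2 * (K : ℝ))) * Real.log (1 + P / N) := by
    simp [rateFun]
  refine ⟨?_, hval⟩
  rintro x ⟨hx0, hxP⟩
  rw [hval]
  unfold rateFun
  have ha : 0 < P + N := by linarith
  have hb : 0 < x + N := by linarith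
  have hD : 0 < x + N + ε * (P - x) := by
    have := mul_nonneg hε0 (sub_nonneg.2 hxP)
    linarith
  have e1 : 1 + (P - x) * (1 - ε) / (x + N + ε * (P - x))
      = (P + N) / (x + N + ε * (P - x)) := by
    rw [eq_div_iff hD.ne', add_mul, div_mul_cancel₀ _ hD.ne']
    ring
  have e2 : 1 + x / N = (x + N) / N := by field_simp; ring
  have e3 : 1 + P / N = (P + N) / N := by field_simp; ring
  rw [e1, e2, e3, Real.log_div ha.ne' hD.ne', Real.log_div hb.ne' hN.ne',
    Real.log_div ha.ne' hN.ne']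
  have hc := strictConcaveOn_log_Ioi.concaveOn.2 (Set.mem_Ioi.2 hb) (Set.mem_Ioi.2 ha)
    (sub_nonneg.2 hεhi) hε0 (by ring)
  simp only [smul_eq_mul] at hc
  have e4 : (1 - ε) * (x + N) + ε * (P + N) = x + N + ε * (P - x) := by ring
  rw [e4] at hc
  have hl : Real.log (x + N) ≤ Real.log (P + N) := Real.log_le_log hb (by linarith)
  have hm := mul_le_mul_of_nonneg_right hεK (sub_nonneg.2 hl)
  have e5 : 1 / (2 * (K : ℝ)) = 1 / 2 * (1 / K) := by field_simp
  rw [e5]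
  linarith
end

section
/- Let P, N be real numbers with P > 0, N > 0, let K ≥ 2 be a natural number, and let ε be real with N·(K − 1)/(P + K·N) ≤ ε ≤ (K − 1)/K. Define f : ℝ → ℝ by f(x) = (1/(2K))·Real.log (1 + x/N) + (1/2)·Real.log (1 + (P − x)·(1 − ε)/(x + N + ε·(P − x))), and set x* = (N + ε·P − K·N·(1 − ε)) / ((1 − ε)·(K − 1)). Then x* ∈ [0, P], f(x) ≤ f(x*) for every x ∈ [0, P], and f(x*) = (1/(2K))·Real.log ( (P + N)/(K·N·(1 − ε)) · ((K − 1)/(K·ε))^(K−1) ). -/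
theorem rate_form (P N ε : ℝ) (K : ℕ) (hP : 0 < P) (hN : 0 < N) (hK : 2 ≤ K) (h0 : 0 < ε)
    (h1 : ε < 1) (x : ℝ) (hx : 0 ≤ x) :
    rateFun P N ε K x = (1 / (2 * (K : ℝ))) * (Real.log (x + N) - Real.log N
      + K * Real.log (P + N) - K * Real.log ((1 - ε) * (x + N) + ε * (P + N))) := by
  have hk : (0 : ℝ) < K := by positivity
  have h2 : 0 < 1 - ε := by linarith
  have hD : 0 < (1 - ε) * (x + N) + ε * (P + N) := by positivity
  have e1 : 1 + x / N = (x + N) / N := by field_simp; ring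
  have e2 : 1 + (P - x) * (1 - ε) / (x + N + ε * (P - x)) =
      (P + N) / ((1 - ε) * (x + N) + ε * (P + N)) := by
    have : x + N + ε * (P - x) = (1 - ε) * (x + N) + ε * (P + N) := by ring
    rw [this, eq_div_iff hD.ne', add_mul, div_mul_cancel₀ _ hD.ne']
    ring
  unfold rateFun
  rw [e1, e2, Real.log_div (by positivity) (by positivity),
    Real.log_div (by positivity) (by positivity)]
  field_simp
  ring

/-- Intermediate regime of the optimized lower bound: when
`N(K−1)/(P+KN) ≤ ε ≤ (K−1)/K`, superposition of dirty-paper coding and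
time-sharing is optimal, with optimal split `x*` and value
`(1/(2K)) log( (P+N)/(KN(1−ε)) · ((K−1)/(Kε))^(K−1) )`. -/
theorem superposition_regime_optimal (P N : ℝ) (hP : 0 < P) (hN : 0 < N)
    (K : ℕ) (hK : 2 ≤ K) (ε : ℝ)
    (hεlo : N * ((K : ℝ) - 1) / (P + (K : ℝ) * N) ≤ ε)
    (hεhi : ε ≤ ((K : ℝ) - 1) / (K : ℝ)) :
    (N + ε * P - (K : ℝ) * N * (1 - ε)) / ((1 - ε) * ((K : ℝ) - 1)) ∈ Set.Icc (0 : ℝ) P ∧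
    (∀ x ∈ Set.Icc (0 : ℝ) P,
      rateFun P N ε K x ≤
        rateFun P N ε K ((N + ε * P - (K : ℝ) * N * (1 - ε)) / ((1 - ε) * ((K : ℝ) - 1)))) ∧
    rateFun P N ε K ((N + ε * P - (K : ℝ) * N * (1 - ε)) / ((1 - ε) * ((K : ℝ) - 1))) =
      (1 / (2 * (K : ℝ))) *
        Real.log ((P + N) / ((K : ℝ) * N * (1 - ε)) *
          (((K : ℝ) - 1) / ((K : ℝ) * ε)) ^ (K - 1)) := by
  have hk2 : (2 : ℝ) ≤ K := by exact_mod_cast hK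
  have hk : (0 : ℝ) < K := by linarith
  have hk1 : (0 : ℝ) < (K : ℝ) - 1 := by linarith
  have h0 : 0 < ε := lt_of_lt_of_le (by positivity) hεlo
  rw [div_le_iff₀ (by positivity)] at hεlo
  rw [le_div_iff₀ hk] at hεhi
  have h2 : 0 < 1 - ε := by nlinarith
  have h1 : ε < 1 := by linarith
  set y := (N + ε * P - (K : ℝ) * N * (1 - ε)) / ((1 - ε) * ((K : ℝ) - 1)) with hy
  have hu : y + N = ε * (P + N) / ((1 - ε) * ((K : ℝ) - 1)) := by
    rw [hy]; field_simp; ring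
  have hy0 : 0 ≤ y := by
    rw [hy]; apply div_nonneg _ (by positivity); nlinarith
  have hyP : y ≤ P := by
    have : y + N ≤ P + N := by
      rw [hu, div_le_iff₀ (by positivity)]
      nlinarith
    linarith
  have hD : (1 - ε) * (y + N) + ε * (P + N) = ε * (P + N) * K / ((K : ℝ) - 1) := by
    rw [hu]; field_simp; ring
  have hu0 : 0 < y + N := by positivity
  have hD0 : 0 < (1 - ε) * (y + N) + ε * (P + N) := by positivity
  refine ⟨⟨hy0, hyP⟩, ?_, ?_⟩
  · rintro x ⟨hx0, -⟩
    rw [rate_form P N ε K hP hN hK h0 h1 x hx0, rate_form P N ε K hP hN hK h0 h1 y hy0]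
    apply mul_le_mul_of_nonneg_left _ (by positivity)
    have hx' : 0 < x + N := by positivity
    have hDx : 0 < (1 - ε) * (x + N) + ε * (P + N) := by positivity
    have ht : 0 < (x + N) / (y + N) := by positivity
    have hr : ((1 - ε) * (x + N) + ε * (P + N)) / ((1 - ε) * (y + N) + ε * (P + N))
        = 1 + ((x + N) / (y + N) - 1) / K := by
      rw [hD, hu]; field_simp; ring
    have hb := one_add_mul_le_pow (a := ((x + N) / (y + N) - 1) / K) (by
      rw [le_div_iff₀ hk]; nlinarith) K
    rw [mul_div_cancel₀ _ hk.ne', ← hr, add_sub_cancel] at hb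
    have hl := Real.log_le_log ht hb
    rw [Real.log_pow, Real.log_div hx'.ne' hu0.ne', Real.log_div hDx.ne' hD0.ne'] at hl
    linarith
  · rw [rate_form P N ε K hP hN hK h0 h1 y hy0, hD, hu]
    have hc : ((K - 1 : ℕ) : ℝ) = (K : ℝ) - 1 := by
      rw [Nat.cast_sub (by omega)]; simp
    have hPN : 0 < P + N := by positivity
    congr 1
    rw [Real.log_mul (by positivity) (by positivity), Real.log_pow, hc,
      Real.log_div (by positivity) (by positivity), Real.log_div (by positivity) (by positivity),
      Real.log_div (by positivity) (by positivity), Real.log_div (by positivity) (by positivity),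
      Real.log_mul (by positivity) (by positivity), Real.log_mul (by positivity) (by positivity),
      Real.log_mul (by positivity) (by positivity), Real.log_mul (by positivity) (by positivity),
      Real.log_mul (by positivity) (by positivity), Real.log_mul (by positivity) (by positivity)]
    rw [Real.log_mul hk.ne' h0.ne']
    ring
end

section
/- Let P, N, c be real numbers with P > 0, N > 0, c > 0, let K ≥ 1 be a natural number, and suppose c < N·(K − 1). Define g : ℝ → ℝ by g(x) = (1/(2K))·Real.log (1 + x/N) + (1/2)·Real.log (1 + (P − x)/(x + N + c)). Then for every x ∈ [0, P], g(x) ≤ g(0), and g(0) = (1/2)·Real.log (1 + P/(N + c)). -/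
/-- Achievable rate of the superposition scheme for the compound Gaussian
dirty-paper channel with `K` components in the symmetric case
`|θmin| = |θmax|`, with residual interference power `c = θmin²·Q`: power `x`
on the time-shared part, `P − x` on the common dirty-paper coded part. -/
noncomputable def rateFunSym (P N c : ℝ) (K : ℕ) : ℝ → ℝ := fun x =>
  (1 / (2 * (K : ℝ))) * Real.log (1 + x / N) +
    (1 / 2) * Real.log (1 + (P - x) / (x + N + c))

/-- First regime (θmin²/(K−1) < N/Q): full-power dirty-paper coding, treating
the residual interference as noise, is optimal. -/
theorem sym_dpc_regime_optimal (P N c : ℝ) (hP : 0 < P) (hN : 0 < N) (hc : 0 < c)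
    (K : ℕ) (hK : 1 ≤ K) (hth : c < N * ((K : ℝ) - 1)) :
    (∀ x ∈ Set.Icc (0 : ℝ) P, rateFunSym P N c K x ≤ rateFunSym P N c K 0) ∧
      rateFunSym P N c K 0 = (1 / 2) * Real.log (1 + P / (N + c)) := by
  have h0 : rateFunSym P N c K 0 = (1 / 2) * Real.log (1 + P / (N + c)) := by
    simp [rateFunSym]
  refine ⟨?_, h0⟩
  rintro x ⟨hx0, hxP⟩
  rw [h0]
  have hKp : (0 : ℝ) < K := by exact_mod_cast hK
  have hNc : 0 < N + c := by linarith
  have hxNc : 0 < x + N + c := by linarith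
  have e1 : 1 + P / (N + c) = (1 + x / (N + c)) * (1 + (P - x) / (x + N + c)) := by
    field_simp
    ring
  have p1 : 0 < 1 + x / (N + c) := by positivity
  have p2 : 0 < 1 + (P - x) / (x + N + c) := by
    have : 0 ≤ (P - x) / (x + N + c) := div_nonneg (by linarith) hxNc.le
    linarith
  have p3 : 0 < 1 + x / N := by positivity
  have hb : 1 + x / N ≤ (1 + x / (N + c)) ^ K := by
    have hq : 0 ≤ x / (N + c) := by positivity
    refine le_trans ?_ (one_add_mul_le_pow (by linarith) K)
    have : x / N ≤ (K : ℝ) * (x / (N + c)) := by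
      rw [← mul_div_assoc, div_le_div_iff₀ hN hNc]
      nlinarith
    linarith
  have hl : Real.log (1 + x / N) ≤ (K : ℝ) * Real.log (1 + x / (N + c)) := by
    rw [← Real.log_pow]
    exact Real.log_le_log p3 hb
  have hm : (1 / (2 * (K : ℝ))) * Real.log (1 + x / N)
      ≤ (1 / 2) * Real.log (1 + x / (N + c)) := by
    calc _ ≤ (1 / (2 * (K : ℝ))) * ((K : ℝ) * Real.log (1 + x / (N + c))) :=
          mul_le_mul_of_nonneg_left hl (by positivity)
      _ = _ := by field_simp
  rw [e1, Real.log_mul p1.ne' p2.ne']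
  simp only [rateFunSym]
  linarith
end

section
/- Let P, N, c be real numbers with P > 0, N > 0, let K ≥ 2 be a natural number, and suppose N·(K − 1) ≤ c ≤ (K − 1)·(N + P). Define g : ℝ → ℝ by g(x) = (1/(2K))·Real.log (1 + x/N) + (1/2)·Real.log (1 + (P − x)/(x + N + c)), and set x* = c/(K − 1) − N. Then x* ∈ [0, P], g(x) ≤ g(x*) for every x ∈ [0, P], and g(x*) = (1/(2K))·Real.log ( (P + N + c)^K / (K·N) · ((K − 1)/(K·c))^(K−1) ). -/
theorem rateAux (P N c : ℝ) (hN : 0 < N) (hc : 0 < c)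
    (K : ℕ) (hK : 2 ≤ K) (x : ℝ) (hx : x ∈ Set.Icc (0 : ℝ) P) :
    rateFunSym P N c K x = (1 / (2 * (K : ℝ))) * (Real.log (x + N) - Real.log N
      + K * (Real.log (P + N + c) - Real.log (x + N + c))) := by
  obtain ⟨h0, h1⟩ := hx
  have hK0 : (K : ℝ) ≠ 0 := by positivity
  have e1 : 1 + x / N = (x + N) / N := by field_simp; ring
  have e2 : 1 + (P - x) / (x + N + c) = (P + N + c) / (x + N + c) := by
    have : x + N + c ≠ 0 := by positivity
    field_simp; ring
  have hS : P + N + c ≠ 0 := by linarith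
  unfold rateFunSym
  rw [e1, e2, Real.log_div (by positivity) (by positivity), Real.log_div hS (by positivity)]
  field_simp

/-- Intermediate regime (N/Q ≤ θmin²/(K−1) < (P+N)/Q): superposition is
optimal, with optimal split `x* = c/(K−1) − N`. -/
theorem sym_superposition_regime_optimal (P N c : ℝ) (hP : 0 < P) (hN : 0 < N)
    (K : ℕ) (hK : 2 ≤ K)
    (hlo : N * ((K : ℝ) - 1) ≤ c) (hhi : c ≤ ((K : ℝ) - 1) * (N + P)) :
    c / ((K : ℝ) - 1) - N ∈ Set.Icc (0 : ℝ) P ∧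
    (∀ x ∈ Set.Icc (0 : ℝ) P,
      rateFunSym P N c K x ≤ rateFunSym P N c K (c / ((K : ℝ) - 1) - N)) ∧
    rateFunSym P N c K (c / ((K : ℝ) - 1) - N) =
      (1 / (2 * (K : ℝ))) *
        Real.log ((P + N + c) ^ K / ((K : ℝ) * N) *
          (((K : ℝ) - 1) / ((K : ℝ) * c)) ^ (K - 1)) := by
  have hK1 : (2 : ℝ) ≤ K := by exact_mod_cast hK
  have hk : (0 : ℝ) < (K : ℝ) - 1 := by linarith
  have hK0 : (0 : ℝ) < K := by linarith
  have hc : 0 < c := lt_of_lt_of_le (by positivity) hlo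
  have hmem : c / ((K : ℝ) - 1) - N ∈ Set.Icc (0 : ℝ) P := by
    constructor
    · rw [sub_nonneg, le_div_iff₀ hk]; exact hlo
    · rw [sub_le_iff_le_add, div_le_iff₀ hk]; linarith
  have hS : 0 < P + N + c := by positivity
  have e : c / ((K : ℝ) - 1) + c = K * c / ((K : ℝ) - 1) := by field_simp; ring
  refine ⟨hmem, ?_, ?_⟩
  · intro x hx
    rw [rateAux P N c hN hc K hK x hx, rateAux P N c hN hc K hK _ hmem]
    have hy : 0 < x + N := by linarith [hx.1]
    apply mul_le_mul_of_nonneg_left _ (by positivity)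
    rw [sub_add_cancel]
    have hb := one_add_mul_le_pow
      (a := (x + N + c) / (c / ((K : ℝ) - 1) + c) - 1)
      (by
        have : 0 < (x + N + c) / (c / ((K : ℝ) - 1) + c) := by positivity
        linarith) K
    have e3 : 1 + (K : ℝ) * ((x + N + c) / (c / ((K : ℝ) - 1) + c) - 1)
        = (x + N) / (c / ((K : ℝ) - 1)) := by
      rw [e]; field_simp; ring
    rw [e3, add_sub_cancel] at hb
    have hl := Real.log_le_log (by positivity) hb
    rw [Real.log_pow, Real.log_div (x := x + N) (by positivity) (by positivity),
      Real.log_div (x := x + N + c) (by positivity) (by positivity)] at hl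
    linarith
  · rw [rateAux P N c hN hc K hK _ hmem, sub_add_cancel, e,
      Real.log_mul (x := (P + N + c) ^ K / ((K : ℝ) * N)) (by positivity) (by positivity),
      Real.log_pow,
      Real.log_div (x := c) (by positivity) (by positivity),
      Real.log_div (x := K * c) (by positivity) (by positivity),
      Real.log_div (x := (P + N + c) ^ K) (by positivity) (by positivity),
      Real.log_div (x := (K : ℝ) - 1) (by positivity) (by positivity), Real.log_pow,
      Real.log_mul (y := c) (by positivity) (by positivity),
      Real.log_mul (y := N) (by positivity) (by positivity),
      Nat.cast_sub (by omega)]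
    push_cast
    ring
end

section
/- Let P, N, c be real numbers with P > 0, N > 0, c > 0, let K ≥ 1 be a natural number, and suppose c ≥ (K − 1)·(N + P). Define g : ℝ → ℝ by g(x) = (1/(2K))·Real.log (1 + x/N) + (1/2)·Real.log (1 + (P − x)/(x + N + c)). Then for every x ∈ [0, P], g(x) ≤ g(P), and g(P) = (1/(2K))·Real.log (1 + P/N). -/
/-- Third regime (θmin²/(K−1) ≥ (P+N)/Q): pure time-sharing is optimal. -/
theorem sym_time_sharing_regime_optimal (P N c : ℝ) (hP : 0 < P) (hN : 0 < N)
    (hc : 0 < c) (K : ℕ) (hK : 1 ≤ K) (hth : ((K : ℝ) - 1) * (N + P) ≤ c) :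
    (∀ x ∈ Set.Icc (0 : ℝ) P, rateFunSym P N c K x ≤ rateFunSym P N c K P) ∧
      rateFunSym P N c K P = (1 / (2 * (K : ℝ))) * Real.log (1 + P / N) := by
  have hK0 : (0 : ℝ) < K := by exact_mod_cast hK
  have hval : rateFunSym P N c K P = (1 / (2 * (K : ℝ))) * Real.log (1 + P / N) := by
    simp [rateFunSym]
  refine ⟨?_, hval⟩
  rintro x ⟨hx0, hxP⟩
  rw [hval]
  unfold rateFunSym
  have hA : 0 < P + N := by linarith
  have hB : 0 < x + N := by linarith
  have hAc : 0 < P + N + c := by linarith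
  have hBc : 0 < x + N + c := by linarith
  have e1 : 1 + x / N = (x + N) / N := by field_simp; ring
  have e2 : 1 + P / N = (P + N) / N := by field_simp; ring
  have e3 : 1 + (P - x) / (x + N + c) = (P + N + c) / (x + N + c) := by field_simp; ring
  rw [e1, e2, e3, Real.log_div hB.ne' hN.ne', Real.log_div hA.ne' hN.ne',
    Real.log_div hAc.ne' hBc.ne']
  have hbern := one_add_mul_le_pow (a := -((P - x) / (P + N + c))) (by
    have : (P - x) / (P + N + c) ≤ 1 := by
      rw [div_le_one hAc]; linarith
    linarith) K
  have e4 : 1 + -((P - x) / (P + N + c)) = (x + N + c) / (P + N + c) := by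
    field_simp; ring
  rw [e4] at hbern
  have h5 : (x + N) / (P + N) ≤ 1 + (K : ℝ) * -((P - x) / (P + N + c)) := by
    have h6 : (K : ℝ) * ((P - x) / (P + N + c)) ≤ (P - x) / (P + N) := by
      rw [← mul_div_assoc, div_le_div_iff₀ hAc hA]
      have : 0 ≤ P - x := by linarith
      nlinarith [mul_nonneg this (sub_nonneg.2 hth)]
    have h7 : (x + N) / (P + N) = 1 - (P - x) / (P + N) := by field_simp; ring
    rw [h7]; linarith
  have h8 := Real.log_le_log (div_pos hB hA) (h5.trans hbern)
  rw [Real.log_pow, Real.log_div hB.ne' hA.ne', Real.log_div hBc.ne' hAc.ne'] at h8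
  have h9 := mul_le_mul_of_nonneg_left h8 (by positivity : 0 ≤ 1 / (2 * (K : ℝ)))
  have h10 : 1 / (2 * (K : ℝ)) * (K * (Real.log (x + N + c) - Real.log (P + N + c)))
      = 1 / 2 * (Real.log (x + N + c) - Real.log (P + N + c)) := by
    field_simp
  rw [h10] at h9
  linarith
end

section
/- Let P, N be real numbers with P > 0 and N > 0, and let ε be real with 0 ≤ ε < 1. For each natural number K ≥ 1 define f_K : ℝ → ℝ by f_K(x) = (1/(2K))·Real.log (1 + x/N) + (1/2)·Real.log (1 + (P − x)·(1 − ε)/(x + N + ε·(P − x))). Then there exists K₀ such that for all K ≥ K₀ and all x ∈ [0, P], f_K(x) ≤ (1/2)·Real.log (1 + P·(1 − ε)/(N + ε·P)), and this bound equals f_K(0). -/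
/-- As the number of components `K → ∞`, the optimized lower bound for the
compound Gaussian dirty-paper channel reduces to
`(1/2)·log(1 + P(1−ε)/(N+εP))`, attained by pure dirty-paper coding. -/
theorem many_components_limit (P N : ℝ) (hP : 0 < P) (hN : 0 < N)
    (ε : ℝ) (hε0 : 0 ≤ ε) (hε1 : ε < 1) :
    ∃ K₀ : ℕ, ∀ K ≥ K₀,
      (∀ x ∈ Set.Icc (0 : ℝ) P,
        rateFun P N ε K x ≤ (1 / 2) * Real.log (1 + P * (1 - ε) / (N + ε * P))) ∧
      (1 / 2) * Real.log (1 + P * (1 - ε) / (N + ε * P)) = rateFun P N ε K 0 := by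
  have ha : 0 < 1 - ε := by linarith
  have hD : 0 < N + ε * P := by positivity
  obtain ⟨K₀, hK₀⟩ := exists_nat_gt ((N + P) / ((1 - ε) * N))
  refine ⟨K₀, fun K hK => ⟨?_, ?_⟩⟩
  · rintro x ⟨hx0, hxP⟩
    have hKr : (N + P) / ((1 - ε) * N) < (K : ℝ) :=
      lt_of_lt_of_le hK₀ (by exact_mod_cast hK)
    have hKpos : (0 : ℝ) < K := lt_trans (by positivity) hKr
    have hE : 0 < N + ε * P + (1 - ε) * x := by positivity
    have hE' : x + N + ε * (P - x) = N + ε * P + (1 - ε) * x := by ring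
    have e1 : 1 + (P - x) * (1 - ε) / (x + N + ε * (P - x))
        = (P + N) / (N + ε * P + (1 - ε) * x) := by
      rw [hE', eq_div_iff hE.ne', add_mul, div_mul_cancel₀ _ hE.ne']
      ring
    have e2 : 1 + P * (1 - ε) / (N + ε * P) = (P + N) / (N + ε * P) := by
      rw [eq_div_iff hD.ne', add_mul, div_mul_cancel₀ _ hD.ne']
      ring
    have hPN : 0 < P + N := by positivity
    have h1 : Real.log (1 + x / N) ≤ x / N := by
      have := Real.log_le_sub_one_of_pos (show 0 < 1 + x / N by positivity)
      linarith
    have h2 := Real.one_sub_inv_le_log_of_pos (div_pos hE hD)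
    rw [Real.log_div hE.ne' hD.ne', inv_div] at h2
    have h3 : (1 - ε) * x / (P + N)
        ≤ 1 - (N + ε * P) / (N + ε * P + (1 - ε) * x) := by
      have : 1 - (N + ε * P) / (N + ε * P + (1 - ε) * x)
          = (1 - ε) * x / (N + ε * P + (1 - ε) * x) := by
        rw [eq_div_iff hE.ne', sub_mul, div_mul_cancel₀ _ hE.ne']
        ring
      rw [this]
      apply div_le_div_of_nonneg_left (by positivity) hE
      nlinarith
    have h4 : 1 / (K : ℝ) * (x / N) ≤ (1 - ε) * x / (P + N) := by
      rw [div_lt_iff₀ (by positivity)] at hKr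
      rw [div_mul_div_comm, div_le_div_iff₀ (by positivity) hPN]
      nlinarith
    have h5 : 1 / (K : ℝ) * Real.log (1 + x / N) ≤ 1 / (K : ℝ) * (x / N) :=
      mul_le_mul_of_nonneg_left h1 (by positivity)
    have h6 : 1 / (2 * (K : ℝ)) * Real.log (1 + x / N)
        = 1 / 2 * (1 / (K : ℝ) * Real.log (1 + x / N)) := by
      rw [← mul_assoc, div_mul_div_comm, one_mul]
    simp only [rateFun]
    rw [e1, e2, h6, Real.log_div hPN.ne' hE.ne', Real.log_div hPN.ne' hD.ne']
    linarith
  · simp [rateFun]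
end
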